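/- Let p and q be prime numbers with p ≡ 5 (mod 8), q ≡ 3 (mod 8), and Legendre symbol (p/q) = 1. Then the 2-class group of the field K = ℚ(√(2p), √q, i) is isomorphic to ℤ/2ℤ × ℤ/2ℤ. -/

import Mathlib

/-- The 2-class group of a subfield `K` of `ℂ` (i.e. the 2-Sylow subgroup of
the class group of its ring of integers) is of type `(2,2)`,
i.e. isomorphic to `ℤ/2ℤ × ℤ/2ℤ`. -/
def TwoClassGroupIsTypeTwoTwo (K : IntermediateField ℚ ℂ) : Prop :=
  ∀ P : Sylow 2 (ClassGroup (integralClosure ℤ K)),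
    Nonempty (P ≃* Multiplicative (ZMod 2 × ZMod 2))

namespace TwoClassGroup

/-- If coprime `u`, `v` have product `D z ^ 2`, then each of them is a divisor of `D` times a
square, and the two divisors are complementary. -/
theorem exists_eq_mul_sq_of_coprime {u v D z : ℕ} (hD : 0 < D) (huv : u.Coprime v)
    (h : u * v = D * z ^ 2) :
    ∃ d e a b : ℕ, D = d * e ∧ u = d * a ^ 2 ∧ v = e * b ^ 2 := by
  have hde : D.gcd u * D.gcd v = D := by
    rw [← huv.gcd_mul D, h, Nat.gcd_mul_right_right]
  obtain ⟨u', hu'⟩ := Nat.gcd_dvd_right D u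
  obtain ⟨v', hv'⟩ := Nat.gcd_dvd_right D v
  set d := D.gcd u
  set e := D.gcd v
  have hpos : 0 < d * e := by omega
  have huv' : u' * v' = z ^ 2 := by
    apply Nat.eq_of_mul_eq_mul_left hpos
    calc d * e * (u' * v') = (d * u') * (e * v') := by ring
      _ = d * e * z ^ 2 := by rw [← hu', ← hv', h, hde]
  have hcop : u'.Coprime v' :=
    Nat.Coprime.coprime_dvd_left (Dvd.intro_left d hu'.symm)
      (Nat.Coprime.coprime_dvd_right (Dvd.intro_left e hv'.symm) huv)
  obtain ⟨a, ha⟩ := exists_eq_pow_of_mul_eq_pow (Nat.isUnit_iff.2 hcop) huv'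
  obtain ⟨b, hb⟩ := exists_eq_pow_of_mul_eq_pow (Nat.isUnit_iff.2 hcop.symm)
    ((mul_comm _ _).trans huv')
  exact ⟨d, e, a, b, hde.symm, by rw [← ha, ← hu'], by rw [← hb, ← hv']⟩

/-- A positive nonsquare even `D` factors as `d * e` with `e b ^ 2 - d a ^ 2 = 1` in a way different
from the trivial `(d, e) = (D, 1)`. -/
theorem exists_mul_sq_eq_mul_sq_add_one {D : ℕ} (hD : 0 < D) (hsq : ¬ IsSquare D)
    (hmod : D % 4 = 2) :
    ∃ d e a b : ℕ, D = d * e ∧ e ≠ 1 ∧ e * b ^ 2 = d * a ^ 2 + 1 := by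
  have hsq' : ¬ IsSquare (D : ℤ) := by simpa using hsq
  obtain ⟨s, hs⟩ := Pell.IsFundamental.exists_of_not_isSquare (by exact_mod_cast hD) hsq'
  obtain ⟨X, hX⟩ := Int.eq_ofNat_of_zero_le hs.x_pos.le
  obtain ⟨Y, hY⟩ := Int.eq_ofNat_of_zero_le hs.2.1.le
  have hpell : X ^ 2 = 1 + D * Y ^ 2 := by
    have := s.prop_x
    rw [hX, hY] at this
    exact_mod_cast this
  have hX1 : 1 < X := by have := hs.1; rw [hX] at this; exact_mod_cast this
  have hXodd : X % 2 = 1 := by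
    have h1 : X ^ 2 % 2 = 1 := by
      rw [hpell, show D = 2 * (D / 2) by omega, mul_assoc]; omega
    rcases Nat.mod_two_eq_zero_or_one X with h | h
    · simp [Nat.pow_mod, h] at h1
    · exact h
  have hYeven : Y % 2 = 0 := by
    by_contra hY2
    obtain ⟨m, hm⟩ : ∃ m, X = 2 * m + 1 := ⟨X / 2, by omega⟩
    obtain ⟨n, hn⟩ : ∃ n, Y = 2 * n + 1 := ⟨Y / 2, by omega⟩
    obtain ⟨l, hl⟩ : ∃ l, D = 4 * l + 2 := ⟨D / 4, by omega⟩
    rw [hm, hn, hl] at hpell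
    have : 4 * (m * m + m) = 4 * (l * (2 * n + 1) ^ 2 + 2 * (n * n + n)) + 2 := by nlinarith
    omega
  obtain ⟨m, hm⟩ : ∃ m, X = 2 * m + 1 := ⟨X / 2, by omega⟩
  obtain ⟨n, hn⟩ : ∃ n, Y = 2 * n := ⟨Y / 2, by omega⟩
  have hmn : m * (m + 1) = D * n ^ 2 := by
    rw [hm, hn] at hpell
    nlinarith
  obtain ⟨d, e, a, b, h1, h2, h3⟩ := exists_eq_mul_sq_of_coprime hD (by simp) hmn
  refine ⟨d, e, a, b, h1, ?_, by omega⟩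
  rintro rfl
  have hb : 1 < (b : ℤ) := by
    have : 1 < b := by
      by_contra hb
      have : b ^ 2 ≤ 1 := by
        have : b ≤ 1 := by omega
        nlinarith
      omega
    exact_mod_cast this
  have hprop : (b : ℤ) ^ 2 - D * (a : ℤ) ^ 2 = 1 := by
    have : b ^ 2 = D * a ^ 2 + 1 := by rw [h1, mul_one, ← h2]; omega
    have : (b : ℤ) ^ 2 = D * a ^ 2 + 1 := by exact_mod_cast this
    linarith
  have hle := hs.x_le_x (a := Pell.Solution₁.mk b a hprop) (by simpa using hb)
  rw [hX] at hle
  simp at hle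
  have : m + 1 = b ^ 2 := by omega
  have hb' : 1 < b := by exact_mod_cast hb
  nlinarith

section residues

variable {p q : ℕ} [Fact p.Prime] [Fact q.Prime]

theorem not_isSquare_two_of_five (hp : p % 8 = 5) : ¬ IsSquare (2 : ZMod p) := by
  rw [ZMod.exists_sq_eq_two_iff (by rintro rfl; omega)]; omega

theorem not_isSquare_two_of_three (hq : q % 8 = 3) : ¬ IsSquare (2 : ZMod q) := by
  rw [ZMod.exists_sq_eq_two_iff (by rintro rfl; omega)]; omega

theorem isSquare_neg_one_of_five (hp : p % 8 = 5) : IsSquare (-1 : ZMod p) := by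
  rw [ZMod.exists_sq_eq_neg_one_iff]; omega

theorem not_isSquare_neg_one_of_three (hq : q % 8 = 3) : ¬ IsSquare (-1 : ZMod q) := by
  rw [ZMod.exists_sq_eq_neg_one_iff]; omega

theorem isSquare_of_legendreSym {p q : ℕ} [Fact q.Prime] (hleg : legendreSym q (p : ℤ) = 1) :
    IsSquare (p : ZMod q) := by
  have h0 : ((p : ℤ) : ZMod q) ≠ 0 := by
    intro h0
    rw [(legendreSym.eq_zero_iff q (p : ℤ)).2 h0] at hleg
    exact zero_ne_one hleg
  simpa using (legendreSym.eq_one_iff q h0).1 hleg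

theorem ne_of_legendreSym {p q : ℕ} [Fact q.Prime] (hleg : legendreSym q (p : ℤ) = 1) : p ≠ q := by
  rintro rfl
  have : legendreSym p (p : ℤ) = 0 := by simp [legendreSym.eq_zero_iff]
  omega

theorem natCast_ne_zero_of_ne (h : p ≠ q) : (q : ZMod p) ≠ 0 := by
  rw [Ne, ZMod.natCast_eq_zero_iff]
  intro hd
  exact h ((Nat.prime_dvd_prime_iff_eq Fact.out Fact.out).1 hd)

theorem isSquare_of_legendreSym' (hp : p % 8 = 5) (hq : q % 8 = 3)
    (hleg : legendreSym q (p : ℤ) = 1) : IsSquare (q : ZMod p) := by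
  have h0 : ((q : ℤ) : ZMod p) ≠ 0 := by
    simpa using natCast_ne_zero_of_ne (ne_of_legendreSym hleg)
  have := legendreSym.quadratic_reciprocity_one_mod_four (p := p) (q := q) (by omega)
    (by rintro rfl; omega)
  rw [hleg] at this
  simpa using (legendreSym.eq_one_iff p h0).1 this.symm

theorem mul_eq_prime_mul {r d e n : ℕ} (hr : r.Prime) (h : d * e = r * n) :
    (∃ d', d = r * d' ∧ d' * e = n) ∨ ∃ e', e = r * e' ∧ d * e' = n := by
  rcases (hr.dvd_mul).1 (Dvd.intro n h.symm) with ⟨d', rfl⟩ | ⟨e', rfl⟩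
  · exact Or.inl ⟨d', rfl, Nat.eq_of_mul_eq_mul_left hr.pos (by linarith)⟩
  · exact Or.inr ⟨e', rfl, Nat.eq_of_mul_eq_mul_left hr.pos (by linarith)⟩

theorem not_isSquare_of_mod_four {n : ℕ} (hn : n % 4 = 2) : ¬ IsSquare n := by
  rintro ⟨r, rfl⟩
  have hr : r % 4 < 4 := Nat.mod_lt _ (by norm_num)
  rw [Nat.mul_mod] at hn
  interval_cases r % 4 <;> omega

theorem isSquare_of_mul_sq_eq {F : Type*} [Field F] {c x s : F} (h : c * x ^ 2 = s)
    (hs : IsSquare s) (h0 : s ≠ 0) : IsSquare c := by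
  have hx : x ≠ 0 := by rintro rfl; simp at h; exact h0 h.symm
  obtain ⟨y, rfl⟩ := hs
  exact ⟨y / x, by field_simp; linear_combination h⟩

theorem exists_sq_add_one_eq (hp : p % 8 = 5) : ∃ a b : ℕ, a ^ 2 + 1 = 2 * p * b ^ 2 := by
  have hP : p.Prime := Fact.out
  have h2 := not_isSquare_two_of_five hp
  have h1 := isSquare_neg_one_of_five hp
  have hp0 : (p : ZMod p) = 0 := by simp
  obtain ⟨d, e, a, b, hde, he, h⟩ := exists_mul_sq_eq_mul_sq_add_one (D := 2 * p)
    (by have := hP.pos; omega) (not_isSquare_of_mod_four (by omega)) (by omega)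
  have hz : (e : ZMod p) * b ^ 2 = d * a ^ 2 + 1 := by exact_mod_cast congrArg (Nat.cast) h
  rcases mul_eq_prime_mul Nat.prime_two hde.symm with ⟨d, rfl, h3⟩ | ⟨e, rfl, h3⟩ <;>
  rcases mul_eq_prime_mul (n := 1) hP (h3.trans (mul_one p).symm) with
    ⟨d, rfl, h5⟩ | ⟨e, rfl, h5⟩ <;>
  obtain ⟨rfl, rfl⟩ := mul_eq_one.1 h5 <;>
  simp only [Nat.cast_mul, hp0, Nat.cast_one, Nat.cast_ofNat] at hz
  · simp at he
  · exact absurd (isSquare_of_mul_sq_eq (x := (a : ZMod p)) (by linear_combination -hz) h1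
      (by simp)) h2
  · exact absurd (isSquare_of_mul_sq_eq (x := (b : ZMod p)) (by linear_combination hz)
      (IsSquare.one) (by simp)) h2
  · exact ⟨a, b, by linarith⟩

theorem exists_mul_sq_sub_eq_one (hp : p % 8 = 5) (hq : q % 8 = 3)
    (hleg : legendreSym q (p : ℤ) = 1) :
    ∃ a b : ℕ, q * a ^ 2 = 2 * p * b ^ 2 + 1 := by
  have hP : p.Prime := Fact.out
  have hQ : q.Prime := Fact.out
  have h2 := not_isSquare_two_of_five hp
  have h1 := isSquare_neg_one_of_five hp
  have h2q := not_isSquare_two_of_three hq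
  have h1q := not_isSquare_neg_one_of_three hq
  have hqp := isSquare_of_legendreSym' hp hq hleg
  have hpq := isSquare_of_legendreSym hleg
  have hqp0 := natCast_ne_zero_of_ne (ne_of_legendreSym hleg)
  have hpq0 := natCast_ne_zero_of_ne (ne_of_legendreSym hleg).symm
  have hp0 : (p : ZMod p) = 0 := by simp
  have hq0 : (q : ZMod q) = 0 := by simp
  have hmod : (2 * (p * q)) % 4 = 2 := by
    have : (p * q) % 8 = 7 := by rw [Nat.mul_mod, hp, hq]
    omega
  obtain ⟨d, e, a, b, hde, he, h⟩ := exists_mul_sq_eq_mul_sq_add_one (D := 2 * (p * q))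
    (by have := Nat.mul_pos hP.pos hQ.pos; omega) (not_isSquare_of_mod_four hmod) hmod
  have hz : (e : ZMod p) * b ^ 2 = d * a ^ 2 + 1 := by exact_mod_cast congrArg (Nat.cast) h
  have hzq : (e : ZMod q) * b ^ 2 = d * a ^ 2 + 1 := by exact_mod_cast congrArg (Nat.cast) h
  rcases mul_eq_prime_mul Nat.prime_two hde.symm with ⟨d, rfl, h3⟩ | ⟨e, rfl, h3⟩ <;>
  rcases mul_eq_prime_mul hP h3 with ⟨d, rfl, h4⟩ | ⟨e, rfl, h4⟩ <;>
  rcases mul_eq_prime_mul (n := 1) hQ (h4.trans (mul_one q).symm) with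
    ⟨d, rfl, h5⟩ | ⟨e, rfl, h5⟩ <;>
  obtain ⟨rfl, rfl⟩ := mul_eq_one.1 h5 <;>
  simp only [Nat.cast_mul, hp0, hq0, Nat.cast_one, Nat.cast_ofNat] at hz hzq
  · simp at he
  · exact ⟨b, a, by linarith⟩
  · have := isSquare_of_mul_sq_eq (c := 2 * (q : ZMod p)) (x := a) (by linear_combination -hz) h1
      (by simp)
    exact absurd (by simpa [hqp0] using this.div hqp) h2
  · exact absurd (isSquare_of_mul_sq_eq (x := (a : ZMod p)) (by linear_combination -hz) h1
      (by simp)) h2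
  · exact absurd (isSquare_of_mul_sq_eq (x := (b : ZMod p)) (by linear_combination hz)
      (IsSquare.one) (by simp)) h2
  · have := isSquare_of_mul_sq_eq (c := 2 * (q : ZMod p)) (x := b) (by linear_combination hz)
      IsSquare.one (by simp)
    exact absurd (by simpa [hqp0] using this.div hqp) h2
  · have := isSquare_of_mul_sq_eq (c := 2 * (p : ZMod q)) (x := b) (by linear_combination hzq)
      IsSquare.one (by simp)
    exact absurd (by simpa [hpq0] using this.div hpq) h2q
  · refine absurd ?_ h1q
    exact ⟨a, by linear_combination hzq⟩

theorem exists_sq_add_two_eq (hq : q % 8 = 3) : ∃ x y : ℕ, x ^ 2 + 2 = q * y ^ 2 := by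
  have hQ : q.Prime := Fact.out
  have h2q := not_isSquare_two_of_three hq
  have h1q := not_isSquare_neg_one_of_three hq
  have hq0 : (q : ZMod q) = 0 := by simp
  have hsq : ¬ IsSquare (q : ℤ) := by
    rw [Int.isSquare_natCast_iff]; exact hQ.prime.not_isSquare
  obtain ⟨s, hs⟩ := Pell.IsFundamental.exists_of_not_isSquare (by exact_mod_cast hQ.pos) hsq
  obtain ⟨X, hX⟩ := Int.eq_ofNat_of_zero_le hs.x_pos.le
  obtain ⟨Y, hY⟩ := Int.eq_ofNat_of_zero_le hs.2.1.le
  have hpell : X ^ 2 = 1 + q * Y ^ 2 := by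
    have := s.prop_x
    rw [hX, hY] at this
    exact_mod_cast this
  have hX1 : 1 < X := by have := hs.1; rw [hX] at this; exact_mod_cast this
  rcases Nat.even_or_odd' X with ⟨m, hm | hm⟩
  · have hprod : (X - 1) * (X + 1) = q * Y ^ 2 := by
      obtain ⟨k, rfl⟩ : ∃ k, X = k + 1 := ⟨X - 1, by omega⟩
      simp only [Nat.add_sub_cancel]
      nlinarith
    have hcop : (X - 1).Coprime (X + 1) := by
      obtain ⟨k, hk⟩ : ∃ k, X - 1 = 2 * k + 1 := ⟨m - 1, by omega⟩
      rw [hk, show X + 1 = 2 * k + 1 + 2 by omega]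
      simp
    obtain ⟨d, e, a, b, hde, h3, h4⟩ := exists_eq_mul_sq_of_coprime hQ.pos hcop hprod
    have h : e * b ^ 2 = d * a ^ 2 + 2 := by omega
    have hzq : (e : ZMod q) * b ^ 2 = d * a ^ 2 + 2 := by exact_mod_cast congrArg (Nat.cast) h
    rcases mul_eq_prime_mul (n := 1) hQ (hde.symm.trans (mul_one q).symm) with
      ⟨d, rfl, h5⟩ | ⟨e, rfl, h5⟩ <;>
    obtain ⟨rfl, rfl⟩ := mul_eq_one.1 h5 <;>
    simp only [Nat.cast_mul, hq0, Nat.cast_one] at hzq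
    · exact absurd ⟨(b : ZMod q), by linear_combination -hzq⟩ h2q
    · exact ⟨a, b, by linarith⟩
  · exfalso
    have hYeven : Y % 2 = 0 := by
      by_contra hY2
      obtain ⟨n, hn⟩ : ∃ n, Y = 2 * n + 1 := ⟨Y / 2, by omega⟩
      obtain ⟨l, hl⟩ : ∃ l, q = 2 * l + 1 := ⟨q / 2, by omega⟩
      rw [hm, hn, hl] at hpell
      have : 2 * (2 * (m * m + m)) = 2 * (l * (2 * n + 1) ^ 2 + 2 * (n * n + n)) + 1 := by nlinarith
      omega
    obtain ⟨n, hn⟩ : ∃ n, Y = 2 * n := ⟨Y / 2, by omega⟩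
    have hmn : m * (m + 1) = q * n ^ 2 := by
      rw [hm, hn] at hpell
      nlinarith
    obtain ⟨d, e, a, b, hde, h3, h4⟩ := exists_eq_mul_sq_of_coprime hQ.pos (by simp) hmn
    have h : e * b ^ 2 = d * a ^ 2 + 1 := by omega
    have hzq : (e : ZMod q) * b ^ 2 = d * a ^ 2 + 1 := by exact_mod_cast congrArg (Nat.cast) h
    rcases mul_eq_prime_mul (n := 1) hQ (hde.symm.trans (mul_one q).symm) with
      ⟨d, rfl, h5⟩ | ⟨e, rfl, h5⟩ <;>
    obtain ⟨rfl, rfl⟩ := mul_eq_one.1 h5 <;>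
    simp only [Nat.cast_mul, hq0, Nat.cast_one] at hzq
    · have hb' : 1 < b := by
        by_contra hb
        have : b ^ 2 ≤ 1 := by
          have : b ≤ 1 := by omega
          nlinarith
        omega
      have hprop : (b : ℤ) ^ 2 - q * (a : ℤ) ^ 2 = 1 := by
        have : (b : ℤ) ^ 2 = q * a ^ 2 + 1 := by exact_mod_cast (by linarith)
        linarith
      have hle := hs.x_le_x (a := Pell.Solution₁.mk b a hprop) (by simpa using hb')
      rw [hX] at hle
      simp at hle
      nlinarith
    · exact absurd ⟨(a : ZMod q), by linear_combination hzq⟩ h1q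

end residues

end TwoClassGroup

namespace TwoClassGroup

open IsDedekindDomain nonZeroDivisors WithZero

section squareClasses

variable {R : Type*} [CommRing R] [IsDedekindDomain R]
variable {L : Type*} [Field L] [Algebra R L]

/-- `Represents R c x`: up to squares of elements, `x` generates the square of an ideal in the
class `c`. -/
def Represents (R : Type*) [CommRing R] [IsDedekindDomain R] {L : Type*} [Field L] [Algebra R L]
    (c : ClassGroup R) (x : L) : Prop :=
  ∃ (I : (Ideal R)⁰) (y : R) (t : L), t ≠ 0 ∧ ClassGroup.mk0 I = c ∧
    algebraMap R L y = x * t ^ 2 ∧ (I : Ideal R) ^ 2 = Ideal.span {y}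

theorem ideal_eq_of_sq_eq {I J : Ideal R} (h : I ^ 2 = J ^ 2) : I = J := by
  have h1 : I ∣ J := (UniqueFactorizationMonoid.pow_dvd_pow_iff_dvd two_ne_zero).1 h.dvd
  have h2 : J ∣ I := (UniqueFactorizationMonoid.pow_dvd_pow_iff_dvd two_ne_zero).1 h.symm.dvd
  exact le_antisymm (Ideal.le_of_dvd h2) (Ideal.le_of_dvd h1)

theorem Represents.ne_zero [IsFractionRing R L] {c : ClassGroup R} {x : L} (h : Represents R c x) :
    x ≠ 0 := by
  obtain ⟨I, y, t, ht, -, hy, hI⟩ := h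
  rintro rfl
  have hy0 : y = 0 := by simpa using hy
  rw [hy0] at hI
  have : (I : Ideal R) ^ 2 = 0 := by simpa using hI
  exact nonZeroDivisors.coe_ne_zero I (pow_eq_zero_iff two_ne_zero |>.1 this)

theorem Represents.mul {c c' : ClassGroup R} {x x' : L} (h : Represents R c x)
    (h' : Represents R c' x') : Represents R (c * c') (x * x') := by
  obtain ⟨I, y, t, ht, rfl, hy, hI⟩ := h
  obtain ⟨I', y', t', ht', rfl, hy', hI'⟩ := h'
  refine ⟨I * I', y * y', t * t', mul_ne_zero ht ht', map_mul _ _ _, ?_, ?_⟩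
  · rw [map_mul, hy, hy']; ring
  · rw [Submonoid.coe_mul, mul_pow, hI, hI', Ideal.span_singleton_mul_span_singleton]

theorem Represents.mul_sq {c : ClassGroup R} {x : L} (h : Represents R c x) {v : L} (hv : v ≠ 0) :
    Represents R c (x * v ^ 2) := by
  obtain ⟨I, y, t, ht, hc, hy, hI⟩ := h
  refine ⟨I, y, t / v, div_ne_zero ht hv, hc, ?_, hI⟩
  rw [hy]; field_simp

theorem represents_one_of_unit (u : Rˣ) : Represents R 1 (algebraMap R L u) := by
  refine ⟨1, u, 1, one_ne_zero, map_one _, by simp, ?_⟩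
  simp [Ideal.span_singleton_eq_top.2 u.isUnit]

theorem represents_one_sq {v : L} (hv : v ≠ 0) : Represents R 1 (v ^ 2) := by
  simpa using (represents_one_of_unit (L := L) (1 : Rˣ)).mul_sq hv

theorem Represents.pow {c : ClassGroup R} {x : L} (h : Represents R c x) (n : ℕ) :
    Represents R (c ^ n) (x ^ n) := by
  induction n with
  | zero => simpa using represents_one_sq (R := R) (one_ne_zero (α := L))
  | succ n ih => rw [pow_succ, pow_succ]; exact ih.mul h

theorem Represents.sq_eq_one {c : ClassGroup R} {x : L} (h : Represents R c x) : c ^ 2 = 1 := by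
  obtain ⟨I, y, t, ht, rfl, hy, hI⟩ := h
  rw [← map_pow, ClassGroup.mk0_eq_one_iff]
  rw [SubmonoidClass.coe_pow, hI]
  infer_instance

theorem exists_represents {c : ClassGroup R} (hc : c ^ 2 = 1) :
    ∃ y : R, Represents R c (algebraMap R L y) := by
  obtain ⟨I, rfl⟩ := ClassGroup.mk0_surjective c
  rw [← map_pow, ClassGroup.mk0_eq_one_iff, SubmonoidClass.coe_pow] at hc
  obtain ⟨y, hy⟩ := hc
  exact ⟨y, I, y, 1, one_ne_zero, rfl, by simp, hy⟩

variable (L) in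
theorem represents_sq_of_pow_four {d : ClassGroup R} (hd : d ^ 4 = 1) :
    ∃ (J : Ideal R) (y : R), J ^ 4 = Ideal.span {y} ∧ Represents R (d ^ 2) (algebraMap R L y) := by
  obtain ⟨I, rfl⟩ := ClassGroup.mk0_surjective d
  rw [← map_pow, ClassGroup.mk0_eq_one_iff, SubmonoidClass.coe_pow] at hd
  obtain ⟨y, hy⟩ := hd
  refine ⟨I, y, hy, I ^ 2, y, 1, one_ne_zero, map_pow _ _ _, by simp, ?_⟩
  rw [SubmonoidClass.coe_pow, ← pow_mul]
  exact hy

variable [IsFractionRing R L]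

theorem Represents.exists_unit {x : L} (h : Represents R 1 x) :
    ∃ (u : Rˣ) (v : L), v ≠ 0 ∧ x = algebraMap R L u * v ^ 2 := by
  obtain ⟨I, y, t, ht, hc, hy, hI⟩ := h
  rw [ClassGroup.mk0_eq_one_iff] at hc
  obtain ⟨z, hz⟩ := hc
  have hz' : (I : Ideal R) = Ideal.span {z} := hz
  rw [hz', Ideal.span_singleton_pow, Ideal.span_singleton_eq_span_singleton] at hI
  obtain ⟨u, hu⟩ := hI
  have hz0 : algebraMap R L z ≠ 0 := by
    intro h0
    have : z = 0 := by simpa using h0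
    rw [this] at hz'
    exact nonZeroDivisors.coe_ne_zero I (by simpa using hz')
  refine ⟨u, algebraMap R L z / t, div_ne_zero hz0 ht, ?_⟩
  have := congrArg (algebraMap R L) hu
  rw [hy, map_mul, map_pow] at this
  field_simp
  linear_combination -this

theorem Represents.unique {c c' : ClassGroup R} {x : L} (h : Represents R c x)
    (h' : Represents R c' x) : c = c' := by
  obtain ⟨I, y, t, ht, rfl, hy, hI⟩ := h
  obtain ⟨I', y', t', ht', rfl, hy', hI'⟩ := h'
  have hx : x ≠ 0 := Represents.ne_zero ⟨I, y, t, ht, rfl, hy, hI⟩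
  obtain ⟨a, b, hb, hab⟩ := IsFractionRing.div_surjective (A := R) (t / t')
  have hb0 : b ≠ 0 := nonZeroDivisors.ne_zero hb
  have hbL : algebraMap R L b ≠ 0 := by simpa using hb0
  have ha0 : a ≠ 0 := by
    rintro rfl
    rw [map_zero, zero_div] at hab
    exact div_ne_zero ht ht' hab.symm
  rw [ClassGroup.mk0_eq_mk0_iff]
  refine ⟨b, a, hb0, ha0, ideal_eq_of_sq_eq ?_⟩
  rw [mul_pow, mul_pow, hI, hI', Ideal.span_singleton_pow, Ideal.span_singleton_pow,
    Ideal.span_singleton_mul_span_singleton, Ideal.span_singleton_mul_span_singleton]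
  congr 2
  apply IsFractionRing.injective R L
  rw [map_mul, map_mul, hy, hy', map_pow, map_pow]
  field_simp at hab
  linear_combination x * (-algebraMap R L a * t' - t * algebraMap R L b) * hab

theorem isSquare_exp_iff (n : ℤ) : IsSquare (exp n : ℤᵐ⁰) ↔ Even n := by
  constructor
  · rintro ⟨z, hz⟩
    have hz0 : z ≠ 0 := by rintro rfl; simp at hz
    refine ⟨log z, ?_⟩
    have := congrArg log hz
    rwa [log_exp, log_mul hz0 hz0] at this
  · rintro ⟨m, rfl⟩
    exact ⟨exp m, by rw [exp_add]⟩

theorem Represents.isSquare_valuation {c : ClassGroup R} {x : L} (h : Represents R c x)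
    (v : HeightOneSpectrum R) : IsSquare (v.valuation L x) := by
  have hx := h.ne_zero
  obtain ⟨I, y, t, ht, -, hy, hI⟩ := h
  have hy0 : y ≠ 0 := by
    rintro rfl
    rw [map_zero] at hy
    exact mul_ne_zero hx (pow_ne_zero 2 ht) hy.symm
  have h1 : IsSquare (v.valuation L (algebraMap R L y)) := by
    rw [v.valuation_of_algebraMap, v.intValuation_eq_exp_neg_multiplicity hy0, ← hI,
      isSquare_exp_iff, even_neg, Int.even_coe_nat,
      FiniteMultiplicity.multiplicity_pow v.prime]
    · exact even_two_mul _
    · exact FiniteMultiplicity.of_prime_left v.prime (nonZeroDivisors.coe_ne_zero I)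
  have : v.valuation L x = v.valuation L (algebraMap R L y) * (v.valuation L t)⁻¹ ^ 2 := by
    rw [hy, map_mul, map_pow]
    have : v.valuation L t ≠ 0 := (Valuation.ne_zero_iff _).2 ht
    field_simp
  rw [this]
  exact h1.mul (IsSquare.sq _)

theorem exists_represents_of_isSquare {x : L} (hx : x ≠ 0)
    (h : ∀ v : HeightOneSpectrum R, IsSquare (v.valuation L x)) :
    ∃ c : ClassGroup R, Represents R c x := by
  obtain ⟨a, b, hb, rfl⟩ := IsFractionRing.div_surjective (A := R) x
  have hbL : algebraMap R L b ≠ 0 := by simpa using nonZeroDivisors.ne_zero hb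
  have ha0 : a ≠ 0 := by rintro rfl; simp at hx
  have hab : a * b ≠ 0 := mul_ne_zero ha0 (nonZeroDivisors.ne_zero hb)
  have hval : ∀ v : HeightOneSpectrum R, Even (multiplicity v.asIdeal (Ideal.span {a * b})) := by
    intro v
    have h1 : IsSquare (v.valuation L (algebraMap R L (a * b))) := by
      have : algebraMap R L (a * b) = algebraMap R L a / algebraMap R L b *
          (algebraMap R L b) ^ 2 := by rw [map_mul]; field_simp
      rw [this, map_mul, map_pow]
      exact (h v).mul (IsSquare.sq _)
    rw [v.valuation_of_algebraMap, v.intValuation_eq_exp_neg_multiplicity hab,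
      isSquare_exp_iff, even_neg, Int.even_coe_nat] at h1
    exact h1
  classical
  have hI0 : Ideal.span {a * b} ≠ (0 : Ideal R) := by simpa using hab
  obtain ⟨s, hs⟩ : ∃ s : Multiset (Ideal R),
      UniqueFactorizationMonoid.normalizedFactors (Ideal.span {a * b}) = 2 • s := by
    apply Multiset.exists_smul_of_dvd_count
    intro P hP
    have hPp := UniqueFactorizationMonoid.prime_of_normalized_factor P hP
    have := hval ⟨P, Ideal.isPrime_of_prime hPp, hPp.ne_zero⟩
    have hm :=
      UniqueFactorizationMonoid.emultiplicity_eq_count_normalizedFactors hPp.irreducible hI0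
    rw [normalize_eq] at hm
    rw [← even_iff_two_dvd]
    have hfin := FiniteMultiplicity.of_prime_left hPp hI0
    rw [hfin.emultiplicity_eq_multiplicity, Nat.cast_inj] at hm
    rw [← hm]
    exact this
  have hprod : s.prod ^ 2 = Ideal.span {a * b} := by
    rw [← Multiset.prod_nsmul, ← hs]
    exact Ideal.prod_normalizedFactors_eq_self hI0
  have hs0 : s.prod ≠ 0 := by
    intro h0
    rw [h0] at hprod
    exact hI0 (by rw [← hprod]; simp)
  refine ⟨_, ⟨s.prod, mem_nonZeroDivisors_of_ne_zero hs0⟩, a * b, algebraMap R L b, hbL, rfl, ?_,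
    hprod⟩
  rw [map_mul]; field_simp

end squareClasses

section norm

variable {M L : Type*} [Field M] [Field L] [NumberField M] [NumberField L] [Algebra M L]

open NumberField

theorem algebraMap_intNorm_ringOfIntegers (y : 𝓞 L) :
    algebraMap (𝓞 M) M (Algebra.intNorm (𝓞 M) (𝓞 L) y) =
      Algebra.norm M (algebraMap (𝓞 L) L y) :=
  Algebra.algebraMap_intNorm (A := 𝓞 M) (K := M) (L := L) (B := 𝓞 L) y

variable (M) in
theorem exists_norm_pow {n : ℕ} {J : Ideal (𝓞 L)} {y : 𝓞 L} (h : J ^ n = Ideal.span {y}) :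
    ∃ (J' : Ideal (𝓞 M)) (y' : 𝓞 M), J' ^ n = Ideal.span {y'} ∧
      algebraMap (𝓞 M) M y' = Algebra.norm M (algebraMap (𝓞 L) L y) := by
  refine ⟨Ideal.relNorm (𝓞 M) J, Algebra.intNorm (𝓞 M) (𝓞 L) y, ?_,
    algebraMap_intNorm_ringOfIntegers y⟩
  rw [← map_pow, h, Ideal.relNorm_singleton]

theorem Represents.norm {c : ClassGroup (𝓞 L)} {x : L} (h : Represents (𝓞 L) c x) :
    ∃ c' : ClassGroup (𝓞 M), Represents (𝓞 M) c' (Algebra.norm M x) := by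
  obtain ⟨I, y, t, ht, -, hy, hI⟩ := h
  obtain ⟨J, y', hJ, hy'⟩ := exists_norm_pow M hI
  have hy0 : y ≠ 0 := by
    rintro rfl
    exact pow_ne_zero 2 (nonZeroDivisors.coe_ne_zero I) (by simpa using hI)
  have hJ0 : J ≠ 0 := by
    rintro rfl
    have h0 : y' = 0 := by simpa using hJ.symm
    rw [h0, map_zero] at hy'
    have := Algebra.norm_eq_zero_iff.1 hy'.symm
    exact hy0 (by simpa using this)
  refine ⟨_, ⟨J, mem_nonZeroDivisors_of_ne_zero hJ0⟩, y', Algebra.norm M t,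
    by simpa [Algebra.norm_eq_zero_iff] using ht, rfl, ?_, hJ⟩
  rw [hy', hy, map_mul, map_pow]

/-- If `m ^ 2` is up to squares of elements the fourth power of an ideal, then `m` is up to
elements the square of an ideal. -/
theorem exists_represents_of_sq {J : Ideal (𝓞 M)} {y : 𝓞 M} (hJ : J ^ 4 = Ideal.span {y})
    (hJ0 : J ≠ 0) {g : M} (hg : algebraMap (𝓞 M) M y = g ^ 2) :
    ∃ c' : ClassGroup (𝓞 M), Represents (𝓞 M) c' g := by
  have hg_int : IsIntegral ℤ g := by
    apply IsIntegral.of_pow (n := 2) (by norm_num)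
    rw [← hg]
    exact RingOfIntegers.isIntegral_coe y
  obtain ⟨z, rfl⟩ : ∃ z : 𝓞 M, algebraMap (𝓞 M) M z = g := ⟨⟨g, hg_int⟩, rfl⟩
  have hz : y = z ^ 2 := by
    apply RingOfIntegers.coe_injective
    simpa using hg
  refine ⟨_, ⟨J, mem_nonZeroDivisors_of_ne_zero hJ0⟩, z, 1, one_ne_zero, rfl, by simp, ?_⟩
  apply ideal_eq_of_sq_eq
  rw [← pow_mul, Ideal.span_singleton_pow, ← hz]
  exact hJ

end norm

end TwoClassGroup

namespace TwoClassGroup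

section quadratic

/-- `L = M(w)` is a quadratic extension with `w ^ 2 = d`. -/
structure IsQuad (M L : Type*) [Field M] [Field L] [Algebra M L] (d : M) (w : L) : Prop where
  sq_eq : w ^ 2 = algebraMap M L d
  not_isSquare : ¬ IsSquare d
  exists_eq : ∀ x : L, ∃ r s : M, x = algebraMap M L r + algebraMap M L s * w

variable {M L : Type*} [Field M] [Field L] [Algebra M L] {d : M} {w : L}

namespace IsQuad

theorem ne_zero (h : IsQuad M L d w) : w ≠ 0 := by
  rintro rfl
  have h1 := h.sq_eq
  have h2 := h.not_isSquare
  rw [zero_pow two_ne_zero, eq_comm, map_eq_zero] at h1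
  exact h2 (h1 ▸ IsSquare.zero)

theorem base_ne_zero (h : IsQuad M L d w) : d ≠ 0 := by
  rintro rfl
  exact h.not_isSquare IsSquare.zero

theorem eq_zero_of_add_eq_zero (h : IsQuad M L d w) {r s : M}
    (hrs : algebraMap M L r + algebraMap M L s * w = 0) : r = 0 ∧ s = 0 := by
  have hs : s = 0 := by
    by_contra hs
    apply h.not_isSquare
    refine ⟨r / s, ?_⟩
    apply (algebraMap M L).injective
    have hs' : algebraMap M L s ≠ 0 := by simpa using hs
    rw [map_mul, map_div₀, ← h.sq_eq]
    field_simp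
    linear_combination (algebraMap M L s * w - algebraMap M L r) * hrs
  subst hs
  simpa using hrs

theorem coord_ext (h : IsQuad M L d w) {r s r' s' : M}
    (hrs : algebraMap M L r + algebraMap M L s * w = algebraMap M L r' + algebraMap M L s' * w) :
    r = r' ∧ s = s' := by
  have := h.eq_zero_of_add_eq_zero (r := r - r') (s := s - s')
    (by rw [map_sub, map_sub]; linear_combination hrs)
  exact ⟨sub_eq_zero.1 this.1, sub_eq_zero.1 this.2⟩

theorem exists_basis (h : IsQuad M L d w) : ∃ b : Module.Basis (Fin 2) M L, ⇑b = ![1, w] := by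
  refine ⟨Module.Basis.mk (v := ![1, w]) ?_ ?_, Module.Basis.coe_mk _ _⟩
  · rw [LinearIndependent.pair_iff]
    intro r s hrs
    apply h.eq_zero_of_add_eq_zero
    simpa [Algebra.smul_def] using hrs
  · rintro x -
    obtain ⟨r, s, rfl⟩ := h.exists_eq x
    have h1 : (1 : L) ∈ Submodule.span M (Set.range ![1, w]) := Submodule.subset_span ⟨0, rfl⟩
    have h2 : w ∈ Submodule.span M (Set.range ![1, w]) := Submodule.subset_span ⟨1, rfl⟩
    have := add_mem (Submodule.smul_mem _ r h1) (Submodule.smul_mem _ s h2)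
    simpa [Algebra.smul_def] using this

theorem finiteDimensional (h : IsQuad M L d w) : FiniteDimensional M L := by
  obtain ⟨b, -⟩ := h.exists_basis
  exact Module.Finite.of_basis b

theorem norm_eq (h : IsQuad M L d w) (r s : M) :
    Algebra.norm M (algebraMap M L r + algebraMap M L s * w) = r ^ 2 - d * s ^ 2 := by
  obtain ⟨b, hb⟩ := h.exists_basis
  have hb0 : b 0 = 1 := by rw [hb]; rfl
  have hb1 : b 1 = w := by rw [hb]; rfl
  have hrepr : ∀ r s : M, algebraMap M L r + algebraMap M L s * w = r • b 0 + s • b 1 := by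
    intro r s
    rw [hb0, hb1, Algebra.smul_def, Algebra.smul_def, mul_one]
  have h2 : (algebraMap M L r + algebraMap M L s * w) * w = (s * d) • b 0 + r • b 1 := by
    rw [← hrepr, map_mul, ← h.sq_eq]; ring
  rw [Algebra.norm_eq_matrix_det b, Matrix.det_fin_two]
  simp only [Algebra.leftMulMatrix_eq_repr_mul]
  rw [hb0, hb1, h2, mul_one, hrepr]
  simp
  ring

theorem norm_algebraMap (h : IsQuad M L d w) (r : M) :
    Algebra.norm M (algebraMap M L r) = r ^ 2 := by
  simpa using h.norm_eq r 0

theorem exists_lift (h : IsQuad M L d w) {E : Type*} [Field E] (f : M →+* E) {e : E}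
    (he : e ^ 2 = f d) : ∃ g : L →+* E, (∀ m, g (algebraMap M L m) = f m) ∧ g w = e := by
  choose r s hrs using h.exists_eq
  have key : ∀ x a b, x = algebraMap M L a + algebraMap M L b * w → r x = a ∧ s x = b :=
    fun x a b hx => h.coord_ext ((hrs x).symm.trans hx)
  have hof : ∀ m, r (algebraMap M L m) = m ∧ s (algebraMap M L m) = 0 :=
    fun m => key _ m 0 (by simp)
  have hone := hof 1
  have hzero := hof 0
  rw [map_one] at hone
  rw [map_zero] at hzero
  have hadd : ∀ x y, r (x + y) = r x + r y ∧ s (x + y) = s x + s y := fun x y => by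
    apply key
    conv_lhs => rw [hrs x, hrs y]
    simp only [map_add]
    ring
  have hmul : ∀ x y, r (x * y) = r x * r y + d * (s x * s y) ∧
      s (x * y) = r x * s y + s x * r y := fun x y => by
    apply key
    conv_lhs => rw [hrs x, hrs y]
    simp only [map_add, map_mul, ← h.sq_eq]
    ring
  refine ⟨⟨⟨⟨fun x => f (r x) + f (s x) * e, ?_⟩, ?_⟩, ?_, ?_⟩, ?_, ?_⟩
  · simp [hone]
  · intro x y
    simp only [hmul, map_add, map_mul, ← he]
    ring
  · simp [hzero]
  · intro x y
    simp only [hadd, map_add]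
    ring
  · intro m
    simp [hof]
  · have := key w 0 1 (by simp)
    simp [this]

/-- An element whose relative norm is a square lies in the base up to squares. -/
theorem exists_eq_mul_sq_of_norm_eq_sq [NeZero (2 : M)] (h : IsQuad M L d w) {x : L}
    (hx : x ≠ 0) {f : M} (hf : Algebra.norm M x = f ^ 2) :
    ∃ (m : M) (v : L), m ≠ 0 ∧ v ≠ 0 ∧ x = algebraMap M L m * v ^ 2 := by
  obtain ⟨r, s, rfl⟩ := h.exists_eq x
  rw [h.norm_eq] at hf
  have hf' := congrArg (algebraMap M L) hf
  simp only [map_sub, map_mul, map_pow, ← h.sq_eq] at hf'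
  by_cases h0 : algebraMap M L r + algebraMap M L s * w + algebraMap M L f = 0
  · have h1 : r + f = 0 ∧ s = 0 := h.eq_zero_of_add_eq_zero
      (by rw [map_add]; linear_combination h0)
    refine ⟨r, 1, ?_, one_ne_zero, by simp [h1.2]⟩
    rintro rfl
    simp [h1.2] at hx
  have key : (algebraMap M L r + algebraMap M L s * w + algebraMap M L f) ^ 2 =
      (algebraMap M L r + algebraMap M L s * w) * algebraMap M L (2 * (r + f)) := by
    simp only [map_mul, map_add, map_ofNat]
    linear_combination -hf'
  have hm : 2 * (r + f) ≠ 0 := by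
    intro hm
    rw [hm, map_zero, mul_zero] at key
    exact h0 (pow_eq_zero_iff two_ne_zero |>.1 key)
  have hm' : algebraMap M L (2 * (r + f)) ≠ 0 := (map_ne_zero _).2 hm
  refine ⟨2 * (r + f), (algebraMap M L r + algebraMap M L s * w + algebraMap M L f) /
    algebraMap M L (2 * (r + f)), hm, div_ne_zero h0 hm', ?_⟩
  rw [div_pow, key]
  field_simp

end IsQuad

end quadratic

end TwoClassGroup

namespace TwoClassGroup

open IsDedekindDomain NumberField

section unramified

variable {M L : Type*} [Field M] [Field L] [NumberField M] [Algebra M L]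

theorem exists_under_eq (P : HeightOneSpectrum (𝓞 M)) :
    ∃ Q : HeightOneSpectrum (𝓞 L), Q.under (𝓞 M) = P := by
  have hPm : P.asIdeal.IsMaximal := P.isMaximal
  obtain ⟨Q, hQ, hQP⟩ := Ideal.exists_maximal_ideal_liesOver_of_isIntegral (S := 𝓞 L) P.asIdeal
  refine ⟨⟨Q, hQ.isPrime, Ideal.ne_bot_of_liesOver_of_ne_bot P.ne_bot Q⟩, ?_⟩
  ext1
  exact hQP.over.symm

variable [NumberField L] {d : M} {w : L}

open Polynomial in
/-- Away from the discriminant of an integral generator, a quadratic extension is unramified. -/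
theorem IsQuad.valuation_eq (h : IsQuad M L d w) (Q : HeightOneSpectrum (𝓞 L)) (z : 𝓞 L)
    (T n : 𝓞 M) (hz : z ^ 2 - algebraMap (𝓞 M) (𝓞 L) T * z + algebraMap (𝓞 M) (𝓞 L) n = 0)
    (hzM : ∀ m : M, (z : L) ≠ algebraMap M L m)
    (hQ : 2 * z - algebraMap (𝓞 M) (𝓞 L) T ∉ Q.asIdeal) (x : M) :
    Q.valuation L (algebraMap M L x) = (Q.under (𝓞 M)).valuation M x := by
  have hlies : Q.asIdeal.LiesOver (Q.under (𝓞 M)).asIdeal := ⟨rfl⟩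
  have := h.finiteDimensional
  have hadj : Algebra.adjoin M {algebraMap (𝓞 L) L z} = ⊤ := by
    rw [eq_top_iff]
    rintro y -
    obtain ⟨r, s, hrs⟩ := h.exists_eq (algebraMap (𝓞 L) L z)
    have hs : s ≠ 0 := by
      rintro rfl
      exact hzM r (by simpa using hrs)
    have hs' : algebraMap M L s ≠ 0 := by simpa using hs
    obtain ⟨a, b, rfl⟩ := h.exists_eq y
    have hw : w = algebraMap M L s⁻¹ * (algebraMap (𝓞 L) L z - algebraMap M L r) := by
      rw [hrs, map_inv₀]
      field_simp
      ring
    have hzm : algebraMap (𝓞 L) L z ∈ Algebra.adjoin M {algebraMap (𝓞 L) L z} :=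
      Algebra.subset_adjoin rfl
    have hwm : w ∈ Algebra.adjoin M {algebraMap (𝓞 L) L z} := by
      rw [hw]
      exact mul_mem (algebraMap_mem _ _) (sub_mem hzm (algebraMap_mem _ _))
    exact add_mem (algebraMap_mem _ _) (mul_mem (algebraMap_mem _ _) hwm)
  have hdiff := aeval_derivative_mem_differentIdeal (𝓞 M) M L z hadj
  have hmem : 2 * z - algebraMap (𝓞 M) (𝓞 L) T ∈ differentIdeal (𝓞 M) (𝓞 L) := by
    set f : (𝓞 M)[X] := X ^ 2 - C T * X + C n with hf
    have hfz : aeval z f = 0 := by simp [hf, hz]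
    obtain ⟨g, hg⟩ := minpoly.isIntegrallyClosed_dvd (R := 𝓞 M) (S := 𝓞 L)
      (Algebra.IsIntegral.isIntegral z) hfz
    have hfd : aeval z (derivative f) = 2 * z - algebraMap (𝓞 M) (𝓞 L) T := by
      have h2 : algebraMap (𝓞 M) (𝓞 L) 2 = 2 := map_ofNat _ 2
      simp [hf, one_add_one_eq_two, h2]
    rw [← hfd, hg, derivative_mul, map_add, map_mul, map_mul, minpoly.aeval, zero_mul, add_zero]
    exact Ideal.mul_mem_right _ _ hdiff
  have hmax : (Q.under (𝓞 M)).asIdeal.IsMaximal := (Q.under (𝓞 M)).isMaximal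
  have hle : Ideal.map (algebraMap (𝓞 M) (𝓞 L)) (Q.under (𝓞 M)).asIdeal ≤ Q.asIdeal :=
    Ideal.map_le_iff_le_comap.2 hlies.over.le
  have he : (Q.under (𝓞 M)).asIdeal.ramificationIdx' Q.asIdeal = 1 := by
    by_contra hne
    rw [← ne_eq, Ideal.ramificationIdx'_ne_one_iff hle, ← Ideal.dvd_iff_le] at hne
    have := pow_sub_one_dvd_differentIdeal (𝓞 M) Q.asIdeal 2 (Q.under (𝓞 M)).ne_bot hne
    rw [Nat.add_one_sub_one, pow_one, Ideal.dvd_iff_le] at this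
    exact hQ (this hmem)
  rw [← HeightOneSpectrum.valuation_liesOver L (Q.under (𝓞 M)) Q x, he, pow_one]

end unramified

end TwoClassGroup

namespace TwoClassGroup

open IsDedekindDomain NumberField

section gaussian

variable {F : Type*} [Field F] [NumberField F] {i : F}

theorem isIntegral_of_sq_eq_neg_one {A : Type*} [CommRing A] {i : A} (hi : i ^ 2 = -1) :
    IsIntegral ℤ i :=
  IsIntegral.of_pow (n := 2) (by norm_num) (hi ▸ isIntegral_one.neg)

theorem IsQuad.sq_eq_neg_one (hF : IsQuad ℚ F (-1) i) : i ^ 2 = -1 := by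
  simpa using hF.sq_eq

theorem exists_int_of_isIntegral {r : ℚ} (h : IsIntegral ℤ r) : ∃ n : ℤ, (n : ℚ) = r := by
  obtain ⟨n, hn⟩ := IsIntegrallyClosed.isIntegral_iff.1 h
  exact ⟨n, by simpa using hn⟩

theorem exists_int_of_gaussian (hF : IsQuad ℚ F (-1) i) {x : F} (hx : IsIntegral ℤ x) :
    ∃ a b : ℤ, x = a + b * i := by
  obtain ⟨r, s, hrs⟩ := hF.exists_eq x
  have hi := isIntegral_of_sq_eq_neg_one hF.sq_eq_neg_one
  have hn : ∀ r s : ℚ, IsIntegral ℤ (algebraMap ℚ F r + algebraMap ℚ F s * i) →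
      ∃ n : ℤ, (n : ℚ) = r ^ 2 + s ^ 2 := by
    intro r s h
    have := Algebra.isIntegral_norm ℚ h
    rw [hF.norm_eq] at this
    obtain ⟨n, hn⟩ := exists_int_of_isIntegral this
    exact ⟨n, by rw [hn]; ring⟩
  obtain ⟨n₀, h₀⟩ := hn r s (hrs ▸ hx)
  obtain ⟨n₁, h₁⟩ := hn (r + 1) s (by
    have e : algebraMap ℚ F (r + 1) + algebraMap ℚ F s * i = x + 1 := by
      rw [hrs, map_add, map_one]; ring
    rw [e]
    exact hx.add isIntegral_one)
  obtain ⟨n₂, h₂⟩ := hn r (s + 1) (by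
    have e : algebraMap ℚ F r + algebraMap ℚ F (s + 1) * i = x + i := by
      rw [hrs, map_add, map_one]; ring
    rw [e]
    exact hx.add hi)
  have hr : r = ((n₁ - n₀ - 1 : ℤ) : ℚ) / 2 := by push_cast; rw [h₁, h₀]; ring
  have hs : s = ((n₂ - n₀ - 1 : ℤ) : ℚ) / 2 := by push_cast; rw [h₂, h₀]; ring
  set u := n₁ - n₀ - 1
  set v := n₂ - n₀ - 1
  have huv : u ^ 2 + v ^ 2 = 4 * n₀ := by
    have : (u : ℚ) ^ 2 + v ^ 2 = 4 * n₀ := by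
      rw [h₀, hr, hs]; ring
    exact_mod_cast this
  have heven : u % 2 = 0 ∧ v % 2 = 0 := by
    rcases Int.emod_two_eq_zero_or_one u with hu | hu <;>
    rcases Int.emod_two_eq_zero_or_one v with hv | hv
    · exact ⟨hu, hv⟩
    all_goals
      exfalso
      obtain ⟨a, ha⟩ : ∃ a, u = 2 * a + u % 2 := ⟨u / 2, by omega⟩
      obtain ⟨b, hb⟩ : ∃ b, v = 2 * b + v % 2 := ⟨v / 2, by omega⟩
      rw [hu] at ha
      rw [hv] at hb
      rw [ha, hb] at huv
      ring_nf at huv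
      omega
  obtain ⟨a, ha⟩ : ∃ a, u = 2 * a := ⟨u / 2, by omega⟩
  obtain ⟨b, hb⟩ : ∃ b, v = 2 * b := ⟨v / 2, by omega⟩
  refine ⟨a, b, ?_⟩
  rw [hrs, hr, hs, ha, hb]
  push_cast
  have : (2 : F) ≠ 0 := two_ne_zero
  simp

theorem exists_gaussianInt_equiv (hF : IsQuad ℚ F (-1) i) :
    ∃ e : GaussianInt ≃+* 𝓞 F, ∀ x, (e x : F) = x.re + x.im * i := by
  have hi2 := hF.sq_eq_neg_one
  have hi := isIntegral_of_sq_eq_neg_one hi2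
  let iO : 𝓞 F := ⟨i, hi⟩
  let f : GaussianInt →+* 𝓞 F := Zsqrtd.lift ⟨iO, by
    apply RingOfIntegers.coe_injective
    have : algebraMap (𝓞 F) F iO = i := rfl
    simp [this, ← pow_two, hi2]⟩
  have hf : ∀ x, (f x : F) = x.re + x.im * i := by
    intro x
    have h1 : f x = x.re + x.im * iO := rfl
    have : algebraMap (𝓞 F) F iO = i := rfl
    rw [h1]
    simp [this]
  refine ⟨RingEquiv.ofBijective f ⟨?_, ?_⟩, hf⟩
  · rw [injective_iff_map_eq_zero]
    intro x hx
    have := hf x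
    rw [hx] at this
    have := hF.eq_zero_of_add_eq_zero (r := x.re) (s := x.im) (by simpa using this.symm)
    exact Zsqrtd.ext (by simpa using this.1) (by simpa using this.2)
  · intro y
    obtain ⟨a, b, hab⟩ := exists_int_of_gaussian hF y.2
    refine ⟨⟨a, b⟩, ?_⟩
    apply RingOfIntegers.coe_injective
    exact (hf _).trans hab.symm

theorem isPrincipalIdealRing_gaussian (hF : IsQuad ℚ F (-1) i) : IsPrincipalIdealRing (𝓞 F) := by
  obtain ⟨e, -⟩ := exists_gaussianInt_equiv hF
  exact IsPrincipalIdealRing.of_surjective e.toRingHom e.surjective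

theorem gaussian_represents (hF : IsQuad ℚ F (-1) i) {c : ClassGroup (𝓞 F)} {x : F}
    (h : Represents (𝓞 F) c x) : ∃ (j : ℕ) (f : F), f ≠ 0 ∧ x = i ^ j * f ^ 2 := by
  have := isPrincipalIdealRing_gaussian hF
  have hc : c = 1 := Subsingleton.elim _ _
  subst hc
  obtain ⟨u, v, hv, rfl⟩ := h.exists_unit
  have hi2 := hF.sq_eq_neg_one
  obtain ⟨e, he⟩ := exists_gaussianInt_equiv hF
  have hu : IsUnit (e.symm u) := u.isUnit.map e.symm
  rw [← Zsqrtd.norm_eq_one_iff' (by norm_num)] at hu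
  have hue : (algebraMap (𝓞 F) F u) = (e.symm u).re + (e.symm u).im * i := by
    rw [← he, e.apply_symm_apply]
  rw [hue]
  set a := (e.symm (u : 𝓞 F)).re
  set b := (e.symm (u : 𝓞 F)).im
  have hab : a ^ 2 + b ^ 2 = 1 := by
    rw [Zsqrtd.norm_def] at hu
    linarith
  have hi0 := hF.ne_zero
  have ha : -1 ≤ a ∧ a ≤ 1 := ⟨by nlinarith, by nlinarith⟩
  have hb : -1 ≤ b ∧ b ≤ 1 := ⟨by nlinarith, by nlinarith⟩
  obtain ⟨ha1, ha2⟩ := ha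
  obtain ⟨hb1, hb2⟩ := hb
  interval_cases a <;> interval_cases b <;> norm_num at hab
  · exact ⟨0, i * v, mul_ne_zero hi0 hv, by push_cast; linear_combination -v ^ 2 * hi2⟩
  · exact ⟨1, i * v, mul_ne_zero hi0 hv, by push_cast; linear_combination -i * v ^ 2 * hi2⟩
  · exact ⟨1, v, hv, by push_cast; ring⟩
  · exact ⟨0, v, hv, by push_cast; ring⟩

theorem gaussian_prime (hF : IsQuad ℚ F (-1) i) {q : ℕ} [Fact q.Prime] (hq : q % 8 = 3) :
    Prime (q : 𝓞 F) := by
  obtain ⟨e, -⟩ := exists_gaussianInt_equiv hF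
  have := GaussianInt.prime_of_nat_prime_of_mod_four_eq_three q (by omega)
  rw [← MulEquiv.prime_iff e] at this
  simpa using this

theorem gaussian_prime_one_add (hF : IsQuad ℚ F (-1) i) :
    ∃ π : 𝓞 F, (π : F) = 1 + i ∧ Prime π := by
  obtain ⟨e, he⟩ := exists_gaussianInt_equiv hF
  refine ⟨e ⟨1, 1⟩, by rw [he]; simp, ?_⟩
  rw [MulEquiv.prime_iff e, ← irreducible_iff_prime]
  have hnorm : Zsqrtd.norm (⟨1, 1⟩ : GaussianInt) = 2 := by rw [Zsqrtd.norm_def]; norm_num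
  refine ⟨?_, ?_⟩
  · rw [← Zsqrtd.norm_eq_one_iff' (by norm_num), hnorm]
    norm_num
  · intro a b hab
    rw [← Zsqrtd.norm_eq_one_iff' (by norm_num), ← Zsqrtd.norm_eq_one_iff' (by norm_num)]
    have h1 : a.norm * b.norm = 2 := by rw [← Zsqrtd.norm_mul, ← hab, hnorm]
    have ha := GaussianInt.norm_nonneg a
    have hb := GaussianInt.norm_nonneg b
    have hdvd : a.norm ∣ 2 := Dvd.intro _ h1
    have := Int.le_of_dvd (by norm_num) hdvd
    have : a.norm = 0 ∨ a.norm = 1 ∨ a.norm = 2 := by omega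
    rcases this with h | h | h
    · rw [h] at h1; norm_num at h1
    · exact Or.inl h
    · right; rw [h] at h1; omega

end gaussian

theorem valuation_prime {R L : Type*} [CommRing R] [IsDedekindDomain R] [Field L] [Algebra R L]
    [IsFractionRing R L] {π : R} (hπ : Prime π) (v : HeightOneSpectrum R) (hv : π ∈ v.asIdeal) :
    v.valuation L (algebraMap R L π) = WithZero.exp (-1 : ℤ) := by
  rw [v.valuation_of_algebraMap]
  apply v.intValuation_singleton hπ.ne_zero
  have hprime : (Ideal.span {π}).IsPrime := (Ideal.span_singleton_prime hπ.ne_zero).2 hπ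
  have hmax := hprime.isMaximal (by simpa using hπ.ne_zero)
  exact (hmax.eq_of_le v.isPrime.ne_top (by simpa [Ideal.span_le] using hv)).symm

theorem not_isSquare_valuation_prime {R L : Type*} [CommRing R] [IsDedekindDomain R] [Field L]
    [Algebra R L] [IsFractionRing R L] {π : R} (hπ : Prime π) (v : HeightOneSpectrum R)
    (hv : π ∈ v.asIdeal) : ¬ IsSquare (v.valuation L (algebraMap R L π)) := by
  rw [valuation_prime hπ v hv, isSquare_exp_iff]
  decide

theorem prime_natCast_rat {p : ℕ} (hp : p.Prime) : Prime (p : 𝓞 ℚ) := by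
  rw [← MulEquiv.prime_iff Rat.ringOfIntegersEquiv, map_natCast]
  exact Nat.prime_iff_prime_int.1 hp

end TwoClassGroup

namespace TwoClassGroup

open IsDedekindDomain NumberField WithZero

theorem isSquare_mul_iff {a b : ℤᵐ⁰} (ha : a ≠ 0) (hb : b ≠ 0) :
    IsSquare (a * b) ↔ (IsSquare a ↔ IsSquare b) := by
  rw [← exp_log ha, ← exp_log hb, ← exp_add, isSquare_exp_iff, isSquare_exp_iff,
    isSquare_exp_iff, Int.even_add]

/-- The element `x` has even valuation at `v`. -/
def EvenAt {R L : Type*} [CommRing R] [IsDedekindDomain R] [Field L] [Algebra R L]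
    [IsFractionRing R L] (v : HeightOneSpectrum R) (x : L) : Prop :=
  IsSquare (v.valuation L x)

section evenAt

variable {R L : Type*} [CommRing R] [IsDedekindDomain R] [Field L] [Algebra R L]
  [IsFractionRing R L] {v : HeightOneSpectrum R}

theorem evenAt_mul_iff {x y : L} (hx : x ≠ 0) (hy : y ≠ 0) :
    EvenAt v (x * y) ↔ (EvenAt v x ↔ EvenAt v y) := by
  unfold EvenAt
  rw [map_mul, isSquare_mul_iff (by simpa using hx) (by simpa using hy)]

theorem evenAt_sq (x : L) : EvenAt v (x ^ 2) := by
  unfold EvenAt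
  rw [map_pow]
  exact IsSquare.sq _

theorem EvenAt.mul {x y : L} (hx : EvenAt v x) (hy : EvenAt v y) : EvenAt v (x * y) := by
  unfold EvenAt at *
  rw [map_mul]
  exact hx.mul hy

theorem EvenAt.pow {x : L} (hx : EvenAt v x) (n : ℕ) : EvenAt v (x ^ n) := by
  unfold EvenAt at *
  rw [map_pow]
  exact hx.pow n

theorem evenAt_of_notMem {x : R} (hx : x ∉ v.asIdeal) : EvenAt v (algebraMap R L x) := by
  unfold EvenAt
  rw [(v.valuation_eq_one_iff_notMem).2 hx]
  exact IsSquare.one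

theorem evenAt_unit (u : Rˣ) : EvenAt v (algebraMap R L u) :=
  evenAt_of_notMem fun h => v.isPrime.ne_top (Ideal.eq_top_of_isUnit_mem _ h u.isUnit)

end evenAt

/-- Two elements of a quadratic extension conjugate over the base multiply to the norm, after
any pair of conjugate embeddings. -/
theorem IsQuad.map_mul_map {M L E : Type*} [Field M] [Field L] [Field E] [Algebra M L] {d : M}
    {w : L} (h : IsQuad M L d w) {f g : L →+* E}
    (hfg : ∀ m, g (algebraMap M L m) = f (algebraMap M L m)) (hw : g w = -f w) (x : L) :
    f x * g x = f (algebraMap M L (Algebra.norm M x)) := by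
  obtain ⟨r, s, rfl⟩ := h.exists_eq x
  rw [h.norm_eq]
  simp only [map_add, map_mul, map_sub, map_pow, hfg, hw, ← h.sq_eq]
  ring

section biquadratic

variable {F k : Type*} [Field F] [NumberField F] [Field k] [NumberField k] [Algebra F k]
  {i : F} {s : k} {q : ℕ}

theorem exists_omega (hF : IsQuad ℚ F (-1) i) (hk : IsQuad F k (q : F) s) (hq : q % 8 = 3) :
    ∃ (ω : 𝓞 k) (t : ℕ), q = 8 * t + 3 ∧ 2 * algebraMap (𝓞 k) k ω = 1 + algebraMap F k i * s ∧
      ω ^ 2 - ω + (2 * t + 1) = 0 := by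
  obtain ⟨t, ht⟩ : ∃ t, q = 8 * t + 3 := ⟨q / 8, by omega⟩
  set ω : k := (1 + algebraMap F k i * s) / 2 with hω
  have hi : algebraMap F k i ^ 2 = -1 := by rw [← map_pow, hF.sq_eq_neg_one]; simp
  have hs : s ^ 2 = 8 * t + 3 := by rw [hk.sq_eq, ht]; simp [map_ofNat]
  have h2 : ω ^ 2 - ω + (2 * t + 1) = 0 := by
    rw [hω]
    field_simp
    linear_combination s ^ 2 * hi - hs
  have hg_int : IsIntegral ℤ ω := by
    refine ⟨Polynomial.X ^ 2 - Polynomial.X + Polynomial.C (2 * (t : ℤ) + 1), ?_, ?_⟩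
    · monicity!
    · simpa using h2
  obtain ⟨o, ho⟩ : ∃ o : 𝓞 k, algebraMap (𝓞 k) k o = ω := ⟨⟨ω, hg_int⟩, rfl⟩
  refine ⟨o, t, ht, ?_, ?_⟩
  · rw [ho, hω]; field_simp
  · apply RingOfIntegers.coe_injective
    rw [map_add, map_sub, map_pow, ho, map_zero]
    simpa [map_ofNat] using h2

theorem exists_unit_norm_eq_neg_i (hF : IsQuad ℚ F (-1) i) (hk : IsQuad F k (q : F) s)
    [Fact q.Prime] (hq : q % 8 = 3) :
    ∃ (η : (𝓞 k)ˣ) (x y : ℕ), x ^ 2 + 2 = q * y ^ 2 ∧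
      2 * algebraMap (𝓞 k) k η = (1 + algebraMap F k i) * (x + y * s) ∧
      Algebra.norm F (algebraMap (𝓞 k) k η) = -i := by
  obtain ⟨x, y, hxy⟩ := exists_sq_add_two_eq hq
  have hi0 : i ^ 2 = -1 := hF.sq_eq_neg_one
  have hi : algebraMap F k i ^ 2 = -1 := by rw [← map_pow, hi0]; simp
  have hs : s ^ 2 = q := by rw [hk.sq_eq]; simp
  have hxyk : (x : k) ^ 2 + 2 = q * y ^ 2 := by exact_mod_cast congrArg (Nat.cast (R := k)) hxy
  have hxyF : (x : F) ^ 2 + 2 = q * y ^ 2 := by exact_mod_cast congrArg (Nat.cast (R := F)) hxy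
  have hsint : IsIntegral ℤ s := IsIntegral.of_pow (n := 2) (by norm_num)
    (hs ▸ by simpa using isIntegral_algebraMap (R := ℤ) (A := k) (x := (q : ℤ)))
  have hiint : IsIntegral ℤ (algebraMap F k i) := isIntegral_of_sq_eq_neg_one hi
  have hN : ∀ n : ℕ, IsIntegral ℤ (n : k) := fun n => by
    simpa using isIntegral_algebraMap (R := ℤ) (A := k) (x := (n : ℤ))
  have key : ∀ s : k, s ^ 2 = q → IsIntegral ℤ s →
      IsIntegral ℤ ((1 + algebraMap F k i) * (x + y * s) / 2) := by
    intro s hs hsint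
    apply IsIntegral.of_pow (n := 2) (by norm_num)
    have : ((1 + algebraMap F k i) * (x + y * s) / 2) ^ 2 =
        algebraMap F k i * (x ^ 2 + 1 + x * y * s) := by
      field_simp
      linear_combination (x + y * s) ^ 2 * hi + 2 * algebraMap F k i * y ^ 2 * hs -
        2 * algebraMap F k i * hxyk
    rw [this]
    exact hiint.mul ((((hN x).pow 2).add isIntegral_one).add (((hN x).mul (hN y)).mul hsint))
  set e : k := (1 + algebraMap F k i) * (x + y * s) / 2 with he
  set e' : k := (1 + algebraMap F k i) * (x + y * (-s)) / 2 with he'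
  have hee : e * (algebraMap F k i * e') = 1 := by
    rw [he, he']
    field_simp
    linear_combination (-4 + algebraMap F k i * (x + y * s) * (x + y * -s)) * hi
      - 2 * algebraMap F k i ^ 2 * y ^ 2 * hs + 2 * algebraMap F k i ^ 2 * hxyk
  let a : 𝓞 k := ⟨e, key s hs hsint⟩
  let b : 𝓞 k := ⟨algebraMap F k i * e', hiint.mul (key (-s) (by rw [neg_sq, hs]) hsint.neg)⟩
  have hab : a * b = 1 := RingOfIntegers.coe_injective (by
    rw [map_mul, map_one]; exact hee)
  refine ⟨⟨a, b, hab, by rw [mul_comm, hab]⟩, x, y, hxy, ?_, ?_⟩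
  · show 2 * e = _
    rw [he]; field_simp
  have : algebraMap (𝓞 k) k a = algebraMap F k ((1 + i) * x / 2) +
      algebraMap F k ((1 + i) * y / 2) * s := by
    show e = _
    rw [he]
    simp only [map_div₀, map_mul, map_add, map_one, map_natCast, map_ofNat]
    ring
  show Algebra.norm F (algebraMap (𝓞 k) k a) = _
  rw [this, hk.norm_eq]
  field_simp
  linear_combination (x ^ 2 - q * y ^ 2) * hi0 + 2 * i * hxyF

theorem represents_biquadratic (hF : IsQuad ℚ F (-1) i) (hk : IsQuad F k (q : F) s)
    [Fact q.Prime] (hq : q % 8 = 3) {η : (𝓞 k)ˣ}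
    (hη : Algebra.norm F (algebraMap (𝓞 k) k η) = -i) {c : ClassGroup (𝓞 k)} {x : k}
    (h : Represents (𝓞 k) c x) :
    ∃ (j l : ℕ) (f : k), f ≠ 0 ∧ x = algebraMap F k i ^ j * algebraMap (𝓞 k) k η ^ l * f ^ 2 := by
  have hi2 := hF.sq_eq_neg_one
  set e := algebraMap (𝓞 k) k η with he
  have he0 : e ≠ 0 := by simp [he]
  have hi0 : i ≠ 0 := hF.ne_zero
  have hx0 := h.ne_zero
  obtain ⟨c', hc'⟩ := h.norm (M := F)
  obtain ⟨j, f, hf, hfx⟩ := gaussian_represents hF hc'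
  have hNe : Algebra.norm F (x * e ^ j) = f ^ 2 := by
    rw [map_mul, map_pow, hη, hfx]
    calc i ^ j * f ^ 2 * (-i) ^ j = (-i ^ 2) ^ j * f ^ 2 := by
          rw [mul_right_comm, ← mul_pow]; ring
      _ = f ^ 2 := by rw [hi2]; simp
  obtain ⟨m, v, hm, hv, hmv⟩ := hk.exists_eq_mul_sq_of_norm_eq_sq
    (mul_ne_zero hx0 (pow_ne_zero j he0)) hNe
  have hmk : algebraMap F k m ≠ 0 := by simpa using hm
  have heven : ∀ Q : HeightOneSpectrum (𝓞 k), EvenAt Q (algebraMap F k m) := by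
    intro Q
    have h1 : EvenAt Q (x * e ^ j) :=
      EvenAt.mul (h.isSquare_valuation Q) ((evenAt_unit η).pow j)
    rw [hmv, evenAt_mul_iff hmk (pow_ne_zero 2 hv)] at h1
    exact h1.2 (evenAt_sq v)
  obtain ⟨ω, t, ht, hω, hω2⟩ := exists_omega hF hk hq
  have hq0 : (q : F) ≠ 0 := hk.base_ne_zero
  have hi2k : algebraMap F k i ^ 2 = -1 := by rw [← map_pow, hi2]; simp
  have hsq : s ^ 2 = q := by rw [hk.sq_eq]; simp
  have hunr : ∀ P : HeightOneSpectrum (𝓞 F), (q : 𝓞 F) ∉ P.asIdeal → EvenAt P m := by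
    intro P hP
    obtain ⟨Q, rfl⟩ := exists_under_eq (L := k) P
    have h1 := hk.valuation_eq Q ω 1 (2 * t + 1) (by simpa [map_ofNat] using hω2) (by
      intro m' hm'
      have h2 : algebraMap F k (2 * m' - 1) + algebraMap F k (-i) * s = 0 := by
        have : algebraMap (𝓞 k) k ω = algebraMap F k m' := hm'
        rw [this] at hω
        simp only [map_sub, map_mul, map_ofNat, map_one, map_neg]
        linear_combination hω
      have := (hk.eq_zero_of_add_eq_zero h2).2
      exact hi0 (neg_eq_zero.1 this)) (by
      intro hmem
      apply hP
      have h3 : algebraMap (𝓞 F) (𝓞 k) (q : 𝓞 F) =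
          -((2 * ω - algebraMap (𝓞 F) (𝓞 k) 1) * (2 * ω - algebraMap (𝓞 F) (𝓞 k) 1)) := by
        rw [ht]
        push_cast
        simp only [map_ofNat]
        linear_combination 4 * hω2
      show algebraMap (𝓞 F) (𝓞 k) (q : 𝓞 F) ∈ Q.asIdeal
      rw [h3]
      exact neg_mem (Ideal.mul_mem_left _ _ hmem)) m
    have h2 := heven Q
    unfold EvenAt at h2 ⊢
    rwa [h1] at h2
  have hqp := gaussian_prime hF hq
  have hqval : ∀ P : HeightOneSpectrum (𝓞 F), (q : 𝓞 F) ∈ P.asIdeal → ¬ EvenAt P (q : F) := by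
    intro P hP
    have := not_isSquare_valuation_prime (L := F) hqp P hP
    rwa [map_natCast] at this
  have hqnval : ∀ P : HeightOneSpectrum (𝓞 F), (q : 𝓞 F) ∉ P.asIdeal → EvenAt P (q : F) := by
    intro P hP
    have := evenAt_of_notMem (L := F) hP
    rwa [map_natCast] at this
  have hfin : ∃ (j' : ℕ) (g : k), g ≠ 0 ∧ algebraMap F k m = algebraMap F k i ^ j' * g ^ 2 := by
    by_cases hall : ∀ P : HeightOneSpectrum (𝓞 F), EvenAt P m
    · obtain ⟨c, hc⟩ := exists_represents_of_isSquare hm hall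
      obtain ⟨j', g, hg, hgm⟩ := gaussian_represents hF hc
      exact ⟨j', algebraMap F k g, by simpa using hg, by rw [hgm]; simp⟩
    · push Not at hall
      obtain ⟨P₀, hP₀⟩ := hall
      have hqP₀ : (q : 𝓞 F) ∈ P₀.asIdeal := by
        by_contra hc
        exact hP₀ (hunr P₀ hc)
      have huniq : ∀ P : HeightOneSpectrum (𝓞 F), (q : 𝓞 F) ∈ P.asIdeal → P = P₀ := by
        have hpr : (Ideal.span {(q : 𝓞 F)}).IsPrime :=
          (Ideal.span_singleton_prime hqp.ne_zero).2 hqp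
        have hmax := hpr.isMaximal (by simpa using hqp.ne_zero)
        intro P hP
        ext1
        rw [← hmax.eq_of_le P.isPrime.ne_top (by simpa [Ideal.span_le] using hP),
          ← hmax.eq_of_le P₀.isPrime.ne_top (by simpa [Ideal.span_le] using hqP₀)]
      have hall' : ∀ P : HeightOneSpectrum (𝓞 F), EvenAt P (m * q) := by
        intro P
        rw [evenAt_mul_iff hm hq0]
        by_cases hP : (q : 𝓞 F) ∈ P.asIdeal
        · rw [huniq P hP]
          exact iff_of_false hP₀ (hqval P₀ hqP₀)
        · exact iff_of_true (hunr P hP) (hqnval P hP)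
      obtain ⟨c, hc⟩ := exists_represents_of_isSquare (mul_ne_zero hm hq0) hall'
      obtain ⟨j', g, hg, hgm⟩ := gaussian_represents hF hc
      have hs0 := hk.ne_zero
      refine ⟨j', algebraMap F k g / s, div_ne_zero (by simpa using hg) hs0, ?_⟩
      have := congrArg (algebraMap F k) hgm
      simp only [map_mul, map_natCast, map_pow] at this
      rw [← hsq] at this
      field_simp
      linear_combination this
  obtain ⟨j', g, hg, hgm⟩ := hfin
  refine ⟨j', j, g * v / e ^ j, div_ne_zero (mul_ne_zero hg hv) (pow_ne_zero _ he0), ?_⟩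
  have hej := pow_ne_zero j he0
  rw [hgm] at hmv
  field_simp
  linear_combination hmv

end biquadratic

end TwoClassGroup

namespace TwoClassGroup

open IsDedekindDomain NumberField WithZero

theorem intCast_mem_iff {R : Type*} [CommRing R] {P : Ideal R} (hP : P.IsPrime) {p : ℕ}
    (hp : p.Prime) (hpP : (p : R) ∈ P) (n : ℤ) : (n : R) ∈ P ↔ (p : ℤ) ∣ n := by
  constructor
  · intro hn
    by_contra h
    have hc : IsCoprime (p : ℤ) n := (Nat.prime_iff_prime_int.1 hp).coprime_iff_not_dvd.2 h
    obtain ⟨a, b, hab⟩ := hc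
    have h1 : (a : R) * (p : ℕ) + b * n = 1 := by exact_mod_cast congrArg (Int.cast (R := R)) hab
    apply hP.ne_top
    rw [Ideal.eq_top_iff_one, ← h1]
    exact add_mem (Ideal.mul_mem_left _ _ hpP) (Ideal.mul_mem_left _ _ hn)
  · rintro ⟨m, rfl⟩
    push_cast
    exact Ideal.mul_mem_right _ _ hpP

/-- The integers `i`, `s = √q` and `(1 + i * s) / 2` of `k = ℚ(i, √q)`. -/
structure Generators (F k : Type*) [Field F] [Field k] [Algebra F k] (i : F) (s : k) (q : ℕ)
    (ι σ ω : 𝓞 k) : Prop where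
  coe_ι : algebraMap (𝓞 k) k ι = algebraMap F k i
  coe_σ : algebraMap (𝓞 k) k σ = s
  ι_sq : ι ^ 2 = -1
  σ_sq : σ ^ 2 = q
  two_mul_ω : 2 * ω = 1 + ι * σ
  ω_eq : ∃ t : ℕ, q = 8 * t + 3 ∧ ω ^ 2 - ω + (2 * t + 1) = 0

theorem Generators.mem_iff_of_two_mem {F k : Type*} [Field F] [Field k] [Algebra F k]
    {i : F} {s : k} {q : ℕ} {ι σ ω : 𝓞 k} (hg : Generators F k i s q ι σ ω)
    {P : HeightOneSpectrum (𝓞 k)}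
    (hP : (2 : 𝓞 k) ∈ P.asIdeal) (a b c d : ℤ) :
    a + b * ι + (c + d * ι) * ω ∈ P.asIdeal ↔ Even (a + b) ∧ Even (c + d) := by
  have hPp := P.isPrime
  obtain ⟨t, ht, hω⟩ := hg.ω_eq
  have hone : (1 : 𝓞 k) ∉ P.asIdeal := fun h => hPp.ne_top ((Ideal.eq_top_iff_one _).2 h)
  have hι : ι - 1 ∈ P.asIdeal := by
    apply hPp.mem_of_pow_mem 2
    have : (ι - 1) ^ 2 = 2 * (-ι) := by linear_combination hg.ι_sq
    rw [this]
    exact Ideal.mul_mem_right _ _ hP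
  have hω1 : ω * (ω - 1) ∉ P.asIdeal := by
    intro h
    apply hone
    have : (1 : 𝓞 k) = -(ω * (ω - 1)) - 2 * t := by linear_combination hω
    rw [this]
    exact sub_mem (neg_mem h) (Ideal.mul_mem_right _ _ hP)
  have hωP : ω ∉ P.asIdeal := fun h => hω1 (Ideal.mul_mem_right _ _ h)
  have hω1P : ω - 1 ∉ P.asIdeal := fun h => hω1 (Ideal.mul_mem_left _ _ h)
  have hred : a + b * ι + (c + d * ι) * ω ∈ P.asIdeal ↔
      ((a + b : ℤ) : 𝓞 k) + ((c + d : ℤ) : 𝓞 k) * ω ∈ P.asIdeal := by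
    have : a + b * ι + (c + d * ι) * ω =
        (((a + b : ℤ) : 𝓞 k) + ((c + d : ℤ) : 𝓞 k) * ω) + (b + d * ω) * (ι - 1) := by
      push_cast; ring
    rw [this]
    exact Ideal.add_mem_iff_left _ (Ideal.mul_mem_left _ _ hι)
  rw [hred]
  generalize a + b = n
  generalize c + d = m
  have h2m : ∀ r : ℤ, (((r + r : ℤ)) : 𝓞 k) ∈ P.asIdeal := fun r => by
    have : ((r + r : ℤ) : 𝓞 k) = 2 * r := by push_cast; ring
    rw [this]
    exact Ideal.mul_mem_right _ _ hP
  have h2m' : ∀ r : ℤ, (((r + r : ℤ)) : 𝓞 k) * ω ∈ P.asIdeal :=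
    fun r => Ideal.mul_mem_right _ _ (h2m r)
  constructor
  · intro h
    rcases Int.even_or_odd' n with ⟨n', rfl | rfl⟩ <;>
      rcases Int.even_or_odd' m with ⟨m', rfl | rfl⟩
    · exact ⟨even_two_mul _, even_two_mul _⟩
    · exfalso; apply hωP
      convert sub_mem (sub_mem h (h2m n')) (h2m' m') using 1
      push_cast; ring
    · exfalso; apply hone
      convert sub_mem (sub_mem h (h2m n')) (h2m' m') using 1
      push_cast; ring
    · exfalso; apply hω1P
      convert sub_mem (sub_mem (sub_mem h (h2m n')) (h2m' m')) (h2m 1) using 1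
      push_cast; ring
  · rintro ⟨⟨n', rfl⟩, ⟨m', rfl⟩⟩
    exact add_mem (h2m _) (h2m' _)

section integralBasis

variable {F k : Type*} [Field F] [NumberField F] [Field k] [NumberField k] [Algebra F k]
  {i : F} {s : k} {q : ℕ}

theorem exists_generators (hF : IsQuad ℚ F (-1) i) (hk : IsQuad F k (q : F) s) (hq : q % 8 = 3) :
    ∃ ι σ ω : 𝓞 k, Generators F k i s q ι σ ω := by
  obtain ⟨ω, t, ht, hω, hω2⟩ := exists_omega hF hk hq
  have hi : algebraMap F k i ^ 2 = -1 := by rw [← map_pow, hF.sq_eq_neg_one]; simp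
  have hs : s ^ 2 = q := by rw [hk.sq_eq]; simp
  obtain ⟨ι, hι⟩ : ∃ o : 𝓞 k, algebraMap (𝓞 k) k o = algebraMap F k i :=
    ⟨⟨_, isIntegral_of_sq_eq_neg_one hi⟩, rfl⟩
  obtain ⟨σ, hσ⟩ : ∃ o : 𝓞 k, algebraMap (𝓞 k) k o = s :=
    ⟨⟨_, IsIntegral.of_pow (n := 2) (by norm_num)
      (hs ▸ by simpa using isIntegral_algebraMap (R := ℤ) (A := k) (x := (q : ℤ)))⟩, rfl⟩
  refine ⟨ι, σ, ω, hι, hσ, ?_, ?_, ?_, t, ht, hω2⟩ <;> apply RingOfIntegers.coe_injective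
  · simp [hι, hi]
  · simp [hσ, hs]
  · simp [hι, hσ, hω, map_ofNat]

namespace Generators

variable {ι σ ω : 𝓞 k}

theorem exists_coords (hg : Generators F k i s q ι σ ω) (hF : IsQuad ℚ F (-1) i)
    (hk : IsQuad F k (q : F) s) (x : 𝓞 k) :
    ∃ a b c d : ℤ, q * x = a + b * ι + (c + d * ι) * ω := by
  have hs : s ^ 2 = q := by rw [hk.sq_eq]; simp
  have hi : algebraMap F k i ^ 2 = -1 := by rw [← map_pow, hF.sq_eq_neg_one]; simp
  obtain ⟨g, hgm, hgs⟩ := hk.exists_lift (algebraMap F k) (e := -s) (by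
    rw [neg_sq, hs]; simp)
  obtain ⟨r, t, hrt⟩ := hk.exists_eq (algebraMap (𝓞 k) k x)
  have hx : IsIntegral ℤ (algebraMap (𝓞 k) k x) := x.2
  have hgx : IsIntegral ℤ (g (algebraMap (𝓞 k) k x)) := hx.map g.toIntAlgHom
  have hσ : IsIntegral ℤ s := hg.coe_σ ▸ σ.2
  have hι : IsIntegral ℤ (algebraMap F k i) := hg.coe_ι ▸ ι.2
  have hω : IsIntegral ℤ (algebraMap (𝓞 k) k ω) := ω.2
  have h2ω : 2 * algebraMap (𝓞 k) k ω = 1 + algebraMap F k i * s := by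
    have := congrArg (algebraMap (𝓞 k) k) hg.two_mul_ω
    simpa [map_ofNat, hg.coe_ι, hg.coe_σ] using this
  have hqk : IsIntegral ℤ (q : k) := by
    simpa using isIntegral_algebraMap (R := ℤ) (A := k) (x := (q : ℤ))
  rw [hrt] at hx hgx
  have hB : IsIntegral ℤ (algebraMap F k (-2 * i * q * t)) := by
    have : algebraMap F k (-2 * i * q * t) = -(algebraMap F k i * s *
        ((algebraMap F k r + algebraMap F k t * s) -
          g (algebraMap F k r + algebraMap F k t * s))) := by
      simp only [map_add, map_mul, hgm, hgs, map_neg, map_ofNat, map_natCast]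
      linear_combination 2 * algebraMap F k i * algebraMap F k t * hs
    rw [this]
    exact ((hι.mul hσ).mul (hx.sub hgx)).neg
  have hA : IsIntegral ℤ (algebraMap F k (q * (r + t * i))) := by
    have : algebraMap F k (q * (r + t * i)) = q * (algebraMap F k r + algebraMap F k t * s) -
        algebraMap F k (-2 * i * q * t) * algebraMap (𝓞 k) k ω := by
      simp only [map_add, map_mul, map_neg, map_ofNat, map_natCast]
      linear_combination -algebraMap F k i * q * algebraMap F k t * h2ω -
        q * algebraMap F k t * s * hi
    rw [this]
    exact (hqk.mul hx).sub (hB.mul hω)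
  rw [isIntegral_algebraMap_iff (algebraMap F k).injective] at hA hB
  obtain ⟨a, b, hab⟩ := exists_int_of_gaussian hF hA
  obtain ⟨c, d, hcd⟩ := exists_int_of_gaussian hF hB
  refine ⟨a, b, c, d, RingOfIntegers.coe_injective ?_⟩
  have hab' := congrArg (algebraMap F k) hab
  have hcd' := congrArg (algebraMap F k) hcd
  simp only [map_add, map_mul, map_neg, map_ofNat, map_natCast, map_intCast, hg.coe_ι] at *
  rw [← hcd', ← hab', hrt]
  linear_combination algebraMap F k i * q * algebraMap F k t * h2ω +
        q * algebraMap F k t * s * hi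

theorem eq_of_two_mem (hg : Generators F k i s q ι σ ω) (hF : IsQuad ℚ F (-1) i)
    (hk : IsQuad F k (q : F) s) {P P' : HeightOneSpectrum (𝓞 k)}
    (hP : (2 : 𝓞 k) ∈ P.asIdeal) (hP' : (2 : 𝓞 k) ∈ P'.asIdeal) : P = P' := by
  ext1
  apply P.isMaximal.eq_of_le P'.isPrime.ne_top
  intro x hx
  obtain ⟨t, ht, -⟩ := hg.ω_eq
  obtain ⟨a, b, c, d, h⟩ := hg.exists_coords hF hk x
  have h1 : (q : 𝓞 k) * x ∈ P.asIdeal := Ideal.mul_mem_left _ _ hx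
  rw [h, hg.mem_iff_of_two_mem hP, ← hg.mem_iff_of_two_mem hP', ← h] at h1
  refine (P'.isPrime.mem_or_mem h1).resolve_left fun hq => P'.isPrime.ne_top ?_
  rw [Ideal.eq_top_iff_one]
  have : (1 : 𝓞 k) = q - 2 * (4 * t + 1) := by rw [ht]; push_cast; ring
  rw [this]
  exact sub_mem hq (Ideal.mul_mem_right _ _ hP')

theorem valuation_eq_under_two (hg : Generators F k i s q ι σ ω) (hF : IsQuad ℚ F (-1) i)
    (hk : IsQuad F k (q : F) s) {P : HeightOneSpectrum (𝓞 k)}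
    (hP : (2 : 𝓞 k) ∈ P.asIdeal) (x : F) :
    P.valuation k (algebraMap F k x) = (P.under (𝓞 F)).valuation F x := by
  obtain ⟨t, ht, hω⟩ := hg.ω_eq
  refine hk.valuation_eq P ω 1 (2 * t + 1) (by simpa [map_ofNat] using hω) ?_ ?_ x
  · intro m hm
    have hm' : algebraMap (𝓞 k) k ω = algebraMap F k m := hm
    have h2 := congrArg (algebraMap (𝓞 k) k) hg.two_mul_ω
    simp only [map_mul, map_add, map_one, map_ofNat, hg.coe_ι, hg.coe_σ, hm'] at h2
    have h3 : algebraMap F k (2 * m - 1) + algebraMap F k (-i) * s = 0 := by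
      simp only [map_sub, map_mul, map_ofNat, map_one, map_neg]
      linear_combination h2
    exact hF.ne_zero (neg_eq_zero.1 (hk.eq_zero_of_add_eq_zero h3).2)
  · rw [map_one]
    intro h
    apply P.isPrime.ne_top
    rw [Ideal.eq_top_iff_one]
    convert sub_mem (Ideal.mul_mem_right ω _ hP) h using 1
    ring

theorem not_evenAt_one_add (hg : Generators F k i s q ι σ ω) (hF : IsQuad ℚ F (-1) i)
    (hk : IsQuad F k (q : F) s) {P : HeightOneSpectrum (𝓞 k)}
    (hP : (2 : 𝓞 k) ∈ P.asIdeal) : ¬ EvenAt P (1 + algebraMap F k i) := by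
  obtain ⟨π, hπ, hπp⟩ := gaussian_prime_one_add hF
  have hπ' : algebraMap (𝓞 F) F π = 1 + i := hπ
  have h := hg.valuation_eq_under_two hF hk hP (1 + i)
  unfold EvenAt
  rw [map_add, map_one] at h
  rw [h, ← hπ']
  apply not_isSquare_valuation_prime hπp
  show algebraMap (𝓞 F) (𝓞 k) π ∈ P.asIdeal
  apply P.isPrime.mem_of_pow_mem 2
  have : algebraMap (𝓞 F) (𝓞 k) π ^ 2 = 2 * ι := by
    apply RingOfIntegers.coe_injective
    have h1 : algebraMap (𝓞 k) k (algebraMap (𝓞 F) (𝓞 k) π) = algebraMap F k (1 + i) := by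
      rw [← hπ']; rfl
    have h2 := congrArg (algebraMap F k) hF.sq_eq_neg_one
    rw [map_pow, h1, map_mul, hg.coe_ι, map_ofNat]
    simp only [map_add, map_one, map_pow, map_neg] at h2 ⊢
    linear_combination h2
  rw [this]
  exact Ideal.mul_mem_right _ _ hP

theorem exists_int_sub_mem (hg : Generators F k i s q ι σ ω) (hF : IsQuad ℚ F (-1) i)
    (hk : IsQuad F k (q : F) s) {p : ℕ} (hp : p.Prime) {u : ℤ} (hu : ¬ (p : ℤ) ∣ 2 * q * u)
    (t n : ℤ) (x : 𝓞 k) : ∃ N : ℤ, ∀ P : HeightOneSpectrum (𝓞 k), (p : 𝓞 k) ∈ P.asIdeal →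
      ι - t ∈ P.asIdeal → u * σ - n ∈ P.asIdeal → x - N ∈ P.asIdeal := by
  obtain ⟨a, b, c, d, h⟩ := hg.exists_coords hF hk x
  obtain ⟨α, β, hαβ⟩ := (Nat.prime_iff_prime_int.1 hp).coprime_iff_not_dvd.2 hu
  refine ⟨β * (u * (2 * a + 2 * b * t) + (c + d * t) * (u + t * n)), fun P hpP hι hσ => ?_⟩
  have h1 : (α : 𝓞 k) * (p : ℕ) + β * (2 * (q : ℕ) * u) = 1 := by
    exact_mod_cast congrArg (Int.cast (R := 𝓞 k)) hαβ
  have h2 := hg.two_mul_ω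
  have key : x - ((β * (u * (2 * a + 2 * b * t) + (c + d * t) * (u + t * n)) : ℤ) : 𝓞 k) =
      p * (α * x) + (ι - t) * (β * (2 * b * u + d * u * (1 + ι * σ) + (c + d * t) * (u * σ)))
      + (u * σ - n) * (β * (c + d * t) * t) := by
    push_cast
    linear_combination -x * h1 + 2 * β * u * h + β * u * (c + d * ι) * h2
  rw [key]
  exact add_mem (add_mem (Ideal.mul_mem_right _ _ hpP) (Ideal.mul_mem_right _ _ hι))
    (Ideal.mul_mem_right _ _ hσ)

theorem eq_of_residues (hg : Generators F k i s q ι σ ω) (hF : IsQuad ℚ F (-1) i)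
    (hk : IsQuad F k (q : F) s) {p : ℕ} (hp : p.Prime) {u : ℤ} (hu : ¬ (p : ℤ) ∣ 2 * q * u)
    {t n : ℤ} {P P' : HeightOneSpectrum (𝓞 k)} (hpP : (p : 𝓞 k) ∈ P.asIdeal)
    (hpP' : (p : 𝓞 k) ∈ P'.asIdeal) (hι : ι - t ∈ P.asIdeal) (hι' : ι - t ∈ P'.asIdeal)
    (hσ : u * σ - n ∈ P.asIdeal) (hσ' : u * σ - n ∈ P'.asIdeal) : P = P' := by
  ext1
  apply P.isMaximal.eq_of_le P'.isPrime.ne_top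
  intro x hx
  obtain ⟨N, hN⟩ := hg.exists_int_sub_mem hF hk hp hu t n x
  have h1 : (N : 𝓞 k) ∈ P.asIdeal := by
    simpa using sub_mem hx (hN P hpP hι hσ)
  rw [intCast_mem_iff P.isPrime hp hpP, ← intCast_mem_iff P'.isPrime hp hpP'] at h1
  simpa using add_mem (hN P' hpP' hι' hσ') h1

theorem absNorm_eq (hg : Generators F k i s q ι σ ω) (hF : IsQuad ℚ F (-1) i)
    (hk : IsQuad F k (q : F) s) {p : ℕ} (hp : p.Prime) {u : ℤ} (hu : ¬ (p : ℤ) ∣ 2 * q * u)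
    {t n : ℤ} {P : HeightOneSpectrum (𝓞 k)} (hpP : (p : 𝓞 k) ∈ P.asIdeal)
    (hι : ι - t ∈ P.asIdeal) (hσ : u * σ - n ∈ P.asIdeal) : Ideal.absNorm P.asIdeal = p := by
  let f : ℤ →+* 𝓞 k ⧸ P.asIdeal := Int.castRingHom _
  have hf : Function.Surjective f := by
    intro y
    obtain ⟨x, rfl⟩ := Ideal.Quotient.mk_surjective y
    obtain ⟨N, hN⟩ := hg.exists_int_sub_mem hF hk hp hu t n x
    refine ⟨N, ?_⟩
    have := hN P hpP hι hσ
    rw [← Ideal.Quotient.mk_eq_mk_iff_sub_mem] at this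
    rw [this]
    simp [f]
  have hker : RingHom.ker f = Ideal.span {(p : ℤ)} := by
    ext N
    rw [RingHom.mem_ker, Ideal.mem_span_singleton, ← intCast_mem_iff P.isPrime hp hpP,
      ← Ideal.Quotient.eq_zero_iff_mem]
    simp [f]
  have e := (Ideal.quotEquivOfEq hker).symm.trans (RingHom.quotientKerEquivOfSurjective hf)
  rw [Ideal.absNorm_apply, Submodule.cardQuot_apply]
  rw [← Nat.card_congr e.toEquiv, Nat.card_congr (Int.quotientSpanNatEquivZMod p).toEquiv,
    Nat.card_zmod]

theorem not_evenAt_prime (hg : Generators F k i s q ι σ ω) (hF : IsQuad ℚ F (-1) i)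
    (hk : IsQuad F k (q : F) s) {p : ℕ} (hp : p.Prime) (hpq : ¬ (p : ℤ) ∣ 2 * q)
    {P : HeightOneSpectrum (𝓞 k)} (hpP : (p : 𝓞 k) ∈ P.asIdeal) : ¬ EvenAt P (p : k) := by
  have hp2 : ¬ (p : ℤ) ∣ 2 := fun h => hpq (h.mul_right _)
  have h2q : ((2 * q : ℤ) : 𝓞 k) ∉ P.asIdeal := by
    rwa [intCast_mem_iff P.isPrime hp hpP]
  have h2 : ((2 : ℤ) : 𝓞 k) ∉ P.asIdeal := by
    rwa [intCast_mem_iff P.isPrime hp hpP]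
  have e1 := hk.valuation_eq P σ 0 (-q) (by simp [hg.σ_sq]) (by
    intro m hm
    have hm' : s = algebraMap F k m := by rw [← hg.coe_σ]; exact hm
    have h3 : algebraMap F k (-m) + algebraMap F k 1 * s = 0 := by rw [hm']; simp
    exact one_ne_zero (hk.eq_zero_of_add_eq_zero h3).2) (by
    intro h
    apply h2q
    have : ((2 * q : ℤ) : 𝓞 k) = (2 * σ - algebraMap (𝓞 F) (𝓞 k) 0) * σ := by
      push_cast [map_zero]
      linear_combination -2 * hg.σ_sq
    rw [this]
    exact Ideal.mul_mem_right _ _ h) (p : F)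
  obtain ⟨ι', hι'⟩ : ∃ o : 𝓞 F, algebraMap (𝓞 F) F o = i :=
    ⟨⟨_, isIntegral_of_sq_eq_neg_one hF.sq_eq_neg_one⟩, rfl⟩
  have hι2 : ι' ^ 2 = -1 := by
    apply RingOfIntegers.coe_injective
    simp [hι', hF.sq_eq_neg_one]
  have e2 := hF.valuation_eq (P.under (𝓞 F)) ι' 0 1 (by simp [hι2]) (by
    intro m hm
    have hm' : i = algebraMap ℚ F m := by rw [← hι']; exact hm
    have h3 : algebraMap ℚ F (-m) + algebraMap ℚ F 1 * i = 0 := by rw [hm']; simp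
    exact one_ne_zero (hF.eq_zero_of_add_eq_zero h3).2) (by
    intro h
    apply h2
    have h3 : (2 : 𝓞 F) ∈ (P.under (𝓞 F)).asIdeal := by
      have : (2 : 𝓞 F) = (2 * ι' - algebraMap (𝓞 ℚ) (𝓞 F) 0) * (-ι') := by
        rw [map_zero]
        linear_combination 2 * hι2
      rw [this]
      exact Ideal.mul_mem_right _ _ h
    have h4 : algebraMap (𝓞 F) (𝓞 k) 2 ∈ P.asIdeal := h3
    simpa [map_ofNat] using h4) (p : ℚ)
  unfold EvenAt
  rw [map_natCast] at e1 e2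
  rw [e1, e2]
  have := not_isSquare_valuation_prime (L := ℚ) (prime_natCast_rat hp)
    ((P.under (𝓞 F)).under (𝓞 ℚ)) (by
      show algebraMap (𝓞 F) (𝓞 k) (algebraMap (𝓞 ℚ) (𝓞 F) (p : 𝓞 ℚ)) ∈ P.asIdeal
      simpa using hpP)
  rwa [map_natCast] at this

end Generators

end integralBasis

end TwoClassGroup

namespace TwoClassGroup

open NumberField

section padic

variable {p : ℕ} [Fact p.Prime]

/-- `x` is of the form `r ^ 2 - 2 * p * s ^ 2` over `ℚ_[p]`. -/
def IsNormForm (p : ℕ) [Fact p.Prime] (x : ℚ_[p]) : Prop :=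
  ∃ r s : ℚ_[p], x = r ^ 2 - 2 * p * s ^ 2

theorem IsNormForm.mul {x y : ℚ_[p]} (hx : IsNormForm p x) (hy : IsNormForm p y) :
    IsNormForm p (x * y) := by
  obtain ⟨r, s, rfl⟩ := hx
  obtain ⟨r', s', rfl⟩ := hy
  exact ⟨r * r' + 2 * p * s * s', r * s' + s * r', by ring⟩

theorem isNormForm_neg_two_mul_prime : IsNormForm p (-(2 * p)) := ⟨0, 1, by ring⟩

theorem isNormForm_sq (x : ℚ_[p]) : IsNormForm p (x ^ 2) := ⟨x, 0, by ring⟩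

theorem IsNormForm.of_mul_sq {x y : ℚ_[p]} (h : IsNormForm p (x * y ^ 2)) (hy : y ≠ 0) :
    IsNormForm p x := by
  have := h.mul (isNormForm_sq y⁻¹)
  convert this using 1
  field_simp

theorem IsNormForm.isSquare_toZMod (hp2 : p ≠ 2) {x : ℤ_[p]} (hx : ‖x‖ = 1)
    (h : IsNormForm p x) : IsSquare (PadicInt.toZMod x) := by
  obtain ⟨r, s, hrs⟩ := h
  have hp1 : (1 : ℝ) < p := by exact_mod_cast (Fact.out : p.Prime).one_lt
  have hnp : ‖(2 * p * s ^ 2 : ℚ_[p])‖ = (p : ℝ)⁻¹ * ‖s‖ ^ 2 := by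
    have h2 : ‖(2 : ℚ_[p])‖ = 1 := by
      have : ‖((2 : ℕ) : ℚ_[p])‖ = 1 := by
        rw [Padic.norm_natCast_eq_one_iff]
        exact (Nat.coprime_primes Fact.out Nat.prime_two).2 hp2
      exact_mod_cast this
    rw [norm_mul, norm_mul, norm_pow, h2, Padic.norm_p, one_mul]
  have hmax : ‖r‖ ^ 2 ≤ 1 ∧ (p : ℝ)⁻¹ * ‖s‖ ^ 2 ≤ 1 := by
    by_cases hne : ‖r ^ 2‖ = ‖(2 * p * s ^ 2 : ℚ_[p])‖
    · rw [hnp, norm_pow] at hne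
      by_cases hs : s = 0
      · subst hs
        simp at hne
        simp [hne]
      · have hr : r ≠ 0 := by
          rintro rfl
          have : ‖s‖ ≠ 0 := by simpa using hs
          have hp0 : (p : ℝ) ≠ 0 := by positivity
          simp [hp0, this] at hne
        exfalso
        rw [Padic.norm_eq_zpow_neg_valuation hr, Padic.norm_eq_zpow_neg_valuation hs,
          ← zpow_neg_one, ← zpow_natCast, ← zpow_natCast, ← zpow_mul, ← zpow_mul,
          ← zpow_add₀ (by positivity)] at hne
        have := zpow_right_injective₀ (by positivity) hp1.ne' hne
        push_cast at this
        omega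
    · have h1 := Padic.add_eq_max_of_ne (q := r ^ 2) (r := -(2 * (p : ℚ_[p]) * s ^ 2))
        (by rwa [norm_neg])
      rw [norm_neg, ← sub_eq_add_neg, ← hrs, hnp, norm_pow] at h1
      have h2 : ‖(x : ℚ_[p])‖ = 1 := hx
      rw [h2] at h1
      exact ⟨h1 ▸ le_max_left _ _, h1 ▸ le_max_right _ _⟩
  have hr : ‖r‖ ≤ 1 := by
    have := hmax.1
    nlinarith [norm_nonneg r]
  have hs : ‖s‖ ≤ 1 := by
    by_cases hs : s = 0
    · simp [hs]
    · have h1 := hmax.2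
      rw [Padic.norm_eq_zpow_neg_valuation hs] at h1 ⊢
      rw [← zpow_neg_one, ← zpow_natCast, ← zpow_mul, ← zpow_add₀ (by positivity),
        zpow_le_one_iff_right₀ hp1] at h1
      rw [zpow_le_one_iff_right₀ hp1]
      push_cast at h1
      omega
  obtain ⟨r, rfl⟩ : ∃ r' : ℤ_[p], (r' : ℚ_[p]) = r := ⟨⟨r, hr⟩, rfl⟩
  obtain ⟨s, rfl⟩ : ∃ s' : ℤ_[p], (s' : ℚ_[p]) = s := ⟨⟨s, hs⟩, rfl⟩
  have : x = r ^ 2 - 2 * p * s ^ 2 := by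
    apply PadicInt.ext
    rw [hrs]
    push_cast
    rfl
  rw [this, map_sub, map_mul, map_mul, map_natCast, ZMod.natCast_self, mul_zero, zero_mul,
    sub_zero, map_pow]
  exact IsSquare.sq _

theorem not_isNormForm_of_sq_eq_neg_one (hp : p % 8 = 5) {x : ℤ_[p]} (hx : x ^ 2 = -1) :
    ¬ IsNormForm p x := by
  intro h
  have hn : ‖x‖ = 1 := by
    have : ‖x‖ ^ 2 = 1 := by rw [← norm_pow, hx, norm_neg, norm_one]
    exact (pow_eq_one_iff_of_nonneg (norm_nonneg _) two_ne_zero).1 this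
  obtain ⟨a, ha⟩ := h.isSquare_toZMod (by rintro rfl; omega) hn
  have h1 : a ^ 4 = -1 := by
    calc a ^ 4 = (PadicInt.toZMod x) ^ 2 := by rw [ha]; ring
      _ = -1 := by rw [← map_pow, hx, map_neg, map_one]
  have hp2 : (-1 : ZMod p) ≠ 1 := by
    have : Fact (2 < p) := ⟨by have := (Fact.out : p.Prime).two_le; omega⟩
    exact ZMod.neg_one_ne_one
  have hord : orderOf a = 2 ^ (2 + 1) := orderOf_eq_prime_pow (by
    rw [show 2 ^ 2 = 4 by norm_num, h1]; exact hp2) (by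
    rw [show 2 ^ (2 + 1) = 4 * 2 by norm_num, pow_mul, h1]; ring)
  have ha0 : a ≠ 0 := by rintro rfl; simp at h1
  have := ZMod.orderOf_dvd_card_sub_one ha0
  rw [hord] at this
  omega

theorem not_isNormForm_two (hp : p % 8 = 5) {ε : ℤ} (hε : ε = 1 ∨ ε = -1) :
    ¬ IsNormForm p (ε * 2) := by
  intro h
  have hp2 : p ≠ 2 := by rintro rfl; omega
  have hn : ‖((2 * ε : ℤ) : ℤ_[p])‖ = 1 := by
    have h2 : ‖((2 : ℕ) : ℤ_[p])‖ = 1 := by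
      rw [PadicInt.norm_natCast_eq_one_iff]
      exact (Nat.coprime_primes Fact.out Nat.prime_two).2 hp2
    rcases hε with rfl | rfl
    · simpa using h2
    · simpa using h2
  have h1 := IsNormForm.isSquare_toZMod hp2 hn (by
    convert h using 1; push_cast; exact mul_comm _ _)
  rw [map_intCast] at h1
  apply not_isSquare_two_of_five hp
  rcases hε with rfl | rfl
  · simpa using h1
  · have := (isSquare_neg_one_of_five hp).mul h1
    simpa using this

theorem exists_sq_eq_padicInt (hp2 : p ≠ 2) {n : ℤ} (h : IsSquare (n : ZMod p))
    (hn : ¬ (p : ℤ) ∣ n) : ∃ x : ℤ_[p], x ^ 2 = n := by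
  obtain ⟨a, ha⟩ := h
  obtain ⟨b, rfl⟩ := ZMod.intCast_surjective a
  have hb : (p : ℤ) ∣ b ^ 2 - n := by
    rw [← ZMod.intCast_zmod_eq_zero_iff_dvd]
    push_cast
    rw [ha]; ring
  have hpb : ¬ (p : ℤ) ∣ 2 * b := by
    intro h
    have hpp := Nat.prime_iff_prime_int.1 (Fact.out : p.Prime)
    rcases hpp.dvd_or_dvd h with h | h
    · have h3 := (Nat.prime_dvd_prime_iff_eq (Fact.out : p.Prime) Nat.prime_two).1
        (by exact_mod_cast h)
      exact hp2 h3
    · apply hn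
      have := dvd_sub (Dvd.dvd.pow h two_ne_zero) hb
      simpa using this
  have hnorm : ‖((2 * b : ℤ) : ℤ_[p])‖ = 1 := by
    by_contra hc
    have := lt_of_le_of_ne (PadicInt.norm_le_one _) hc
    rw [PadicInt.norm_int_lt_one_iff_dvd] at this
    exact hpb this
  obtain ⟨z, hz, -⟩ := hensels_lemma (p := p)
    (F := (Polynomial.X ^ 2 - Polynomial.C (n : ℤ_[p]))) (a := (b : ℤ_[p])) (by
    have : ‖((b ^ 2 - n : ℤ) : ℤ_[p])‖ < 1 := PadicInt.norm_int_lt_one_iff_dvd _ |>.2 hb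
    have h3 : (2 * (b : ℤ_[p])) = ((2 * b : ℤ) : ℤ_[p]) := by push_cast; ring
    simp only [Polynomial.derivative_sub, Polynomial.derivative_X_pow, Polynomial.derivative_C]
    simp only [map_sub, map_mul, map_pow, Polynomial.aeval_X, Polynomial.aeval_C, map_zero]
    push_cast at this
    simpa only [map_intCast, mul_zero, sub_zero, Nat.cast_ofNat, map_ofNat, h3, hnorm, one_pow,
      Nat.add_one_sub_one, pow_one] using this)
  exact ⟨z, by simpa [sub_eq_zero] using hz⟩

end padic

end TwoClassGroup

namespace TwoClassGroup

open NumberField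

theorem IsQuad.isNormForm_map {k K : Type*} [Field k] [Field K] [Algebra k K] {p : ℕ}
    [Fact p.Prime] {w : K} (hK : IsQuad k K (2 * (p : k)) w) (f : k →+* ℚ_[p]) (y : K) :
    IsNormForm p (f (Algebra.norm k y)) := by
  obtain ⟨r, s, rfl⟩ := hK.exists_eq y
  rw [hK.norm_eq]
  exact ⟨f r, f s, by simp [map_ofNat]⟩

section embeddings

variable {F k : Type*} [Field F] [Field k] [Algebra F k] {i : F} {s : k} {p q : ℕ}
  [Fact p.Prime]

/-- The four embeddings of `k = ℚ(i, √q)` in `ℚ_[p]`. -/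
structure Embeddings (F k : Type*) [Field F] [Field k] [Algebra F k] (i : F) (s : k)
    (p : ℕ) [Fact p.Prime] where
  T : ℤ_[p]
  ψ : F →+* ℚ_[p]
  ψ' : F →+* ℚ_[p]
  f : k →+* ℚ_[p]
  f' : k →+* ℚ_[p]
  g : k →+* ℚ_[p]
  g' : k →+* ℚ_[p]
  T_sq : T ^ 2 = -1
  ψ_i : ψ i = T
  ψ'_i : ψ' i = -T
  f_algebraMap (m : F) : f (algebraMap F k m) = ψ m
  f'_algebraMap (m : F) : f' (algebraMap F k m) = ψ m
  g_algebraMap (m : F) : g (algebraMap F k m) = ψ' m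
  g'_algebraMap (m : F) : g' (algebraMap F k m) = ψ' m
  f'_s : f' s = -f s
  g'_s : g' s = -g s
  g_s : g s = f s

theorem exists_embeddings [NumberField F] (hF : IsQuad ℚ F (-1) i) (hk : IsQuad F k (q : F) s)
    (hp : p % 8 = 5) (hq : IsSquare (q : ZMod p)) (hq0 : (q : ZMod p) ≠ 0) :
    Nonempty (Embeddings F k i s p) := by
  have hp2 : p ≠ 2 := by rintro rfl; omega
  obtain ⟨T, hT⟩ := exists_sq_eq_padicInt hp2 (n := -1)
    (by simpa using isSquare_neg_one_of_five hp) (by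
      rw [Int.dvd_neg]
      exact fun h => (Nat.prime_iff_prime_int.1 (Fact.out : p.Prime)).not_dvd_one h)
  obtain ⟨U, hU⟩ := exists_sq_eq_padicInt hp2 (n := q) (by simpa using hq) (by
    rw [← ZMod.intCast_zmod_eq_zero_iff_dvd]
    simpa using hq0)
  have hT' : (T : ℚ_[p]) ^ 2 = -1 := by
    have := congrArg (fun x : ℤ_[p] => (x : ℚ_[p])) hT
    simpa using this
  have hU' : (U : ℚ_[p]) ^ 2 = q := by
    have := congrArg (fun x : ℤ_[p] => (x : ℚ_[p])) hU
    simpa using this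
  obtain ⟨ψ, -, hψ⟩ := hF.exists_lift (algebraMap ℚ ℚ_[p]) (e := T) (by simp [hT'])
  obtain ⟨ψ', -, hψ'⟩ := hF.exists_lift (algebraMap ℚ ℚ_[p]) (e := -T) (by simp [hT'])
  obtain ⟨f, hf, hfs⟩ := hk.exists_lift ψ (e := U) (by simp [hU'])
  obtain ⟨f', hf', hfs'⟩ := hk.exists_lift ψ (e := -U) (by simp [hU'])
  obtain ⟨g, hg, hgs⟩ := hk.exists_lift ψ' (e := U) (by simp [hU'])
  obtain ⟨g', hg', hgs'⟩ := hk.exists_lift ψ' (e := -U) (by simp [hU'])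
  exact ⟨⟨T, ψ, ψ', f, f', g, g', by simpa using hT, hψ, hψ', hf, hf', hg, hg',
    by rw [hfs, hfs'], by rw [hgs, hgs'], by rw [hgs, hfs]⟩⟩

namespace Embeddings

variable {K : Type*} [Field K] [Algebra k K] {w : K}

theorem f_mul_f' (φ : Embeddings F k i s p) (hk : IsQuad F k (q : F) s) (x : k) :
    φ.f x * φ.f' x = φ.ψ (Algebra.norm F x) := by
  rw [hk.map_mul_map (f := φ.f) (g := φ.f')
    (fun m => by rw [φ.f_algebraMap, φ.f'_algebraMap]) φ.f'_s, φ.f_algebraMap]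

theorem g_mul_g' (φ : Embeddings F k i s p) (hk : IsQuad F k (q : F) s) (x : k) :
    φ.g x * φ.g' x = φ.ψ' (Algebra.norm F x) := by
  rw [hk.map_mul_map (f := φ.g) (g := φ.g')
    (fun m => by rw [φ.g_algebraMap, φ.g'_algebraMap]) φ.g'_s, φ.g_algebraMap]

theorem mul_eq_norm [NumberField F] [NumberField k] (φ : Embeddings F k i s p)
    (hF : IsQuad ℚ F (-1) i)
    (hk : IsQuad F k (q : F) s) (x : k) :
    φ.f x * φ.f' x * (φ.g x * φ.g' x) = (Algebra.norm ℚ x : ℚ) := by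
  rw [φ.f_mul_f' hk, φ.g_mul_g' hk,
    hF.map_mul_map (f := φ.ψ) (g := φ.ψ') (fun m => by simp) (by rw [φ.ψ_i, φ.ψ'_i]),
    Algebra.norm_norm]
  simp

theorem even_of_norm_eq (φ : Embeddings F k i s p) (hk : IsQuad F k (q : F) s)
    (hK : IsQuad k K (2 * (p : k)) w) (hp : p % 8 = 5) {η : k}
    (hη : Algebra.norm F η = -i) {j l : ℕ} {v : k} (hv : v ≠ 0) {y : K}
    (hy : Algebra.norm k y = algebraMap F k i ^ j * η ^ l * v ^ 2) : Even j ∧ Even l := by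
  have hTn : ∀ x : ℤ_[p], x ^ 2 = -1 → ∀ z : ℚ_[p], z ≠ 0 → ¬ IsNormForm p (x * z ^ 2) :=
    fun x hx z hz h => not_isNormForm_of_sq_eq_neg_one hp hx (h.of_mul_sq hz)
  have hl : Even l := by
    by_contra hl
    rw [Nat.not_even_iff_odd] at hl
    have h1 := (hK.isNormForm_map φ.f y).mul (hK.isNormForm_map φ.f' y)
    have hv' : φ.f v * φ.f' v ≠ 0 := by simpa using hv
    refine hTn ((-1) ^ j * (-φ.T) ^ l) ?_ (φ.f v * φ.f' v) hv' ?_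
    · rw [mul_pow, ← pow_mul, ← pow_mul, mul_comm l 2, pow_mul (-φ.T), neg_sq, φ.T_sq,
        hl.neg_one_pow,
        mul_comm j 2, pow_mul]
      simp
    · convert h1 using 1
      have h2 := φ.f_mul_f' hk η
      rw [hη, map_neg, φ.ψ_i] at h2
      have hT : (φ.T : ℚ_[p]) * φ.T = -1 := by
        have := congrArg (fun x : ℤ_[p] => (x : ℚ_[p])) φ.T_sq
        simpa [pow_two] using this
      rw [hy]
      simp only [map_mul, map_pow, φ.f_algebraMap, φ.f'_algebraMap, φ.ψ_i]
      push_cast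
      rw [← hT, ← h2, mul_pow, mul_pow]
      ring
  refine ⟨?_, hl⟩
  by_contra hj
  rw [Nat.not_even_iff_odd] at hj
  obtain ⟨l', rfl⟩ := hl
  have h1 := hK.isNormForm_map φ.f y
  have hη0 : η ≠ 0 := by
    rintro rfl
    have h2 := φ.f_mul_f' hk 0
    rw [hη, map_zero, map_neg, φ.ψ_i, zero_mul, eq_comm, neg_eq_zero] at h2
    have h3 := φ.T_sq
    have h4 : φ.T = 0 := by simpa using h2
    rw [h4] at h3
    simp at h3
  refine hTn (φ.T ^ j) ?_ (φ.f (η ^ l' * v)) ?_ ?_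
  · rw [← pow_mul, mul_comm j 2, pow_mul, φ.T_sq, hj.neg_one_pow]
  · simp [hη0, hv]
  · convert h1 using 1
    rw [hy]
    simp only [map_mul, map_pow, φ.f_algebraMap, φ.ψ_i]
    push_cast
    ring

theorem norm_ne_one_add (φ : Embeddings F k i s p) (hk : IsQuad F k (q : F) s)
    (hK : IsQuad k K (2 * (p : k)) w) (hp : p % 8 = 5) {η : k} {a b : ℕ}
    (hab : a ^ 2 + 2 = q * b ^ 2) (hη : 2 * η = (1 + algebraMap F k i) * (a + b * s))
    (j l : ℕ) {v : k} (hv : v ≠ 0) (y : K) :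
    Algebra.norm k y ≠ (1 + algebraMap F k i) * (algebraMap F k i ^ j * η ^ l * v ^ 2) := by
  intro hy
  have h1 := (hK.isNormForm_map φ.f y).mul (hK.isNormForm_map φ.g' y)
  have hT : (φ.T : ℚ_[p]) ^ 2 = -1 := by
    have := congrArg (fun x : ℤ_[p] => (x : ℚ_[p])) φ.T_sq
    simpa using this
  have hs : φ.f s ^ 2 = q := by rw [← map_pow, hk.sq_eq]; simp
  have hab' : (a : ℚ_[p]) ^ 2 + 2 = q * b ^ 2 := by
    exact_mod_cast congrArg (Nat.cast (R := ℚ_[p])) hab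
  have hη' : φ.f η * φ.g' η = -1 := by
    have e1 := congrArg φ.f hη
    have e2 := congrArg φ.g' hη
    simp only [map_mul, map_add, map_ofNat, map_one, map_natCast, φ.f_algebraMap,
      φ.g'_algebraMap, φ.ψ_i, φ.ψ'_i, φ.g'_s, φ.g_s] at e1 e2
    have e3 : (2 * φ.f η) * (2 * φ.g' η) = -4 := by
      rw [e1, e2]
      linear_combination (-(a ^ 2 - b ^ 2 * φ.f s ^ 2)) * hT - 2 * b ^ 2 * hs + 2 * hab'
    linear_combination e3 / 4
  refine not_isNormForm_two (p := p) (ε := (-1) ^ l) hp (neg_one_pow_eq_or ℤ l)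
    (IsNormForm.of_mul_sq (y := φ.f v * φ.g' v) ?_ (by simpa using hv))
  convert h1 using 1
  rw [hy]
  simp only [map_mul, map_pow, map_add, map_one, φ.f_algebraMap, φ.g'_algebraMap, φ.ψ_i, φ.ψ'_i]
  push_cast
  rw [← hη']
  have hTj : (φ.T : ℚ_[p]) ^ j * (-φ.T) ^ j = 1 := by
    rw [← mul_pow]
    have : (φ.T : ℚ_[p]) * -φ.T = 1 := by linear_combination -hT
    rw [this, one_pow]
  linear_combination (-(φ.f η * φ.g' η) ^ l * (φ.f v * φ.g' v) ^ 2 * (1 - φ.T ^ 2)) * hTj +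
    (φ.f η * φ.g' η) ^ l * (φ.f v * φ.g' v) ^ 2 * hT

theorem norm_ne_of_odd [NumberField F] [NumberField k] (φ : Embeddings F k i s p)
    (hF : IsQuad ℚ F (-1) i)
    (hk : IsQuad F k (q : F) s) (hK : IsQuad k K (2 * (p : k)) w) (hp : p % 8 = 5)
    {x : k} {ε : ℤ} (hε : ε = 1 ∨ ε = -1) {h : ℕ} (hh : Odd h) {r : ℚ} (hr : r ≠ 0)
    (hx : Algebra.norm ℚ x = ε * p ^ h * r ^ 2) (y : K) :
    Algebra.norm k y ≠ x := by
  intro hy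
  have h1 := ((hK.isNormForm_map φ.f y).mul (hK.isNormForm_map φ.f' y)).mul
    ((hK.isNormForm_map φ.g y).mul (hK.isNormForm_map φ.g' y))
  rw [hy, φ.mul_eq_norm hF hk, hx] at h1
  obtain ⟨n, rfl⟩ := hh
  have hp0 : (p : ℚ_[p]) ≠ 0 := by simpa using (Fact.out : p.Prime).ne_zero
  refine not_isNormForm_two (p := p) (ε := -ε) hp (by omega)
    (IsNormForm.of_mul_sq (y := p ^ (n + 1) * r) ?_ (mul_ne_zero (pow_ne_zero _ hp0) ?_))
  · convert h1.mul isNormForm_neg_two_mul_prime using 1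
    push_cast
    ring
  · exact_mod_cast hr

end Embeddings

end embeddings

end TwoClassGroup

namespace TwoClassGroup

open NumberField IsDedekindDomain

/-- The tower `ℚ ⊆ F = ℚ(i) ⊆ k = F(√q) ⊆ K = k(√(2p))`, with the congruence and residue
conditions on `p` and `q`. -/
structure Tower (F k K : Type*) [Field F] [NumberField F] [Field k] [NumberField k] [Field K]
    [NumberField K] [Algebra F k] [Algebra k K] (i : F) (s : k) (w : K) (p q : ℕ)
    [Fact q.Prime] : Prop where
  quad_F : IsQuad ℚ F (-1) i
  quad_k : IsQuad F k (q : F) s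
  quad_K : IsQuad k K (2 * (p : k)) w
  mod_p : p % 8 = 5
  mod_q : q % 8 = 3
  legendre : legendreSym q (p : ℤ) = 1

variable {F k K : Type*} [Field F] [NumberField F] [Field k] [NumberField k] [Field K]
  [NumberField K] [Algebra F k] [Algebra k K] {i : F} {s : k} {w : K} {p q : ℕ}
  [Fact q.Prime]

namespace Tower

theorem nonempty_embeddings [Fact p.Prime] (T : Tower F k K i s w p q) :
    Nonempty (Embeddings F k i s p) :=
  exists_embeddings T.quad_F T.quad_k T.mod_p
    (isSquare_of_legendreSym' T.mod_p T.mod_q T.legendre)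
    (natCast_ne_zero_of_ne (ne_of_legendreSym T.legendre))

variable {η : (𝓞 k)ˣ}

theorem exists_represents_algebraMap [Fact p.Prime] (T : Tower F k K i s w p q)
    (hη : Algebra.norm F (algebraMap (𝓞 k) k η) = -i) {c : ClassGroup (𝓞 K)} (hc : c ^ 2 = 1) :
    ∃ m : k, m ≠ 0 ∧ Represents (𝓞 K) c (algebraMap k K m) := by
  obtain ⟨φ⟩ := T.nonempty_embeddings
  obtain ⟨y, hy⟩ := exists_represents (L := K) hc
  obtain ⟨c', hc'⟩ := hy.norm (M := k)
  obtain ⟨j, l, f, hf, hN⟩ := represents_biquadratic T.quad_F T.quad_k T.mod_q hη hc'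
  obtain ⟨hj, hl⟩ := φ.even_of_norm_eq T.quad_k T.quad_K T.mod_p hη hf hN
  obtain ⟨j, rfl⟩ := hj
  obtain ⟨l, rfl⟩ := hl
  obtain ⟨m, v, hm, hv, h⟩ := T.quad_K.exists_eq_mul_sq_of_norm_eq_sq hy.ne_zero
    (f := algebraMap F k i ^ j * algebraMap (𝓞 k) k η ^ l * f) (by rw [hN]; ring)
  refine ⟨m, hm, ?_⟩
  have := hy.mul_sq (inv_ne_zero hv)
  rwa [h, mul_assoc, ← mul_pow, mul_inv_cancel₀ hv, one_pow, mul_one] at this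

theorem exists_norm_eq_of_represents_sq (T : Tower F k K i s w p q)
    (hη : Algebra.norm F (algebraMap (𝓞 k) k η) = -i) {d : ClassGroup (𝓞 K)}
    (hd : (d ^ 2) ^ 2 = 1) {m : k} (hm : m ≠ 0)
    (h : Represents (𝓞 K) (d ^ 2) (algebraMap k K m)) :
    ∃ (j l : ℕ) (v : k) (y : K), v ≠ 0 ∧
      Algebra.norm k y = m * (algebraMap F k i ^ j * algebraMap (𝓞 k) k η ^ l * v ^ 2) := by
  have := T.quad_K.finiteDimensional
  obtain ⟨J, y₀, hJ, hy₀⟩ := represents_sq_of_pow_four K (d := d) (by rw [← hd, ← pow_mul])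
  have h1 := h.mul hy₀
  rw [← pow_two, hd] at h1
  obtain ⟨ε, v, hv, hε⟩ := h1.exists_unit
  have hspan : J ^ 4 = Ideal.span {(ε : 𝓞 K) * y₀} := by
    rw [hJ]
    exact (Ideal.span_singleton_mul_left_unit ε.isUnit y₀).symm
  obtain ⟨J', y', hJ', hy'⟩ := exists_norm_pow k hspan
  have hε0 : algebraMap (𝓞 K) K ε ≠ 0 := by simp
  set g : K := algebraMap (𝓞 K) K ε * v with hg
  have hg0 : g ≠ 0 := mul_ne_zero hε0 hv
  have key : algebraMap (𝓞 k) k y' = (Algebra.norm k g / m) ^ 2 := by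
    have h2 : algebraMap k K m * algebraMap (𝓞 K) K (ε * y₀) = g ^ 2 := by
      rw [map_mul]
      linear_combination algebraMap (𝓞 K) K ε * hε
    have h3 := congrArg (Algebra.norm k) h2
    rw [map_mul, map_pow, T.quad_K.norm_algebraMap, ← hy'] at h3
    field_simp
    rw [← h3]
    ring
  have hNg : Algebra.norm k g ≠ 0 := Algebra.norm_ne_zero_iff.mpr hg0
  have hJ0 : J' ≠ 0 := by
    rintro rfl
    rw [zero_pow (by norm_num), eq_comm, Ideal.zero_eq_bot, Ideal.span_singleton_eq_bot] at hJ'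
    rw [hJ', map_zero, eq_comm, pow_eq_zero_iff (by norm_num)] at key
    exact div_ne_zero hNg hm key
  obtain ⟨c', hc'⟩ := exists_represents_of_sq hJ' hJ0 key
  obtain ⟨j, l, f, hf, hN⟩ := represents_biquadratic T.quad_F T.quad_k T.mod_q hη hc'
  refine ⟨j, l, f, g, hf, ?_⟩
  rw [← hN]
  field_simp

end Tower

end TwoClassGroup

namespace TwoClassGroup

open NumberField IsDedekindDomain

section Relations

variable {K : Type*} [Field K] [NumberField K]

theorem represents_one_of_mul_eq_one {x y : K} (hx : IsIntegral ℤ x) (hy : IsIntegral ℤ y)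
    (h : x * y = 1) : Represents (𝓞 K) 1 x := by
  obtain ⟨a, rfl⟩ : ∃ a : 𝓞 K, algebraMap (𝓞 K) K a = x := ⟨⟨x, hx⟩, rfl⟩
  obtain ⟨b, rfl⟩ : ∃ b : 𝓞 K, algebraMap (𝓞 K) K b = y := ⟨⟨y, hy⟩, rfl⟩
  rw [← map_mul] at h
  have hab : a * b = 1 := RingOfIntegers.coe_injective h
  exact represents_one_of_unit (L := K) (Units.mkOfMulEqOne _ _ hab)

/-- Since `2 = -j(1+j)²`, an element `2ux` that is a square, with `u` a unit, forces `x` to be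
a unit up to squares. -/
theorem represents_one_of_two_mul {j x u u' t : K} (hj : j ^ 2 = -1) (hu : IsIntegral ℤ u)
    (hu' : IsIntegral ℤ u') (huu : u * u' = 1) (hx : x ≠ 0) (h : t ^ 2 = 2 * x * u) :
    Represents (𝓞 K) 1 x := by
  have hj' := isIntegral_of_sq_eq_neg_one hj
  have h1 : (1 + j) ≠ 0 := by
    intro h0
    have : (2 : K) = 0 := by linear_combination (1 - j) * h0 + hj
    exact two_ne_zero this
  have hu0 : u ≠ 0 := left_ne_zero_of_mul_eq_one huu
  have ht : t ≠ 0 := by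
    rintro rfl
    rw [zero_pow two_ne_zero, eq_comm] at h
    exact mul_ne_zero (mul_ne_zero two_ne_zero hx) hu0 h
  have h2 : Represents (𝓞 K) 1 (j * u') :=
    represents_one_of_mul_eq_one (hj'.mul hu') (hj'.neg.mul hu)
      (by linear_combination -j ^ 2 * huu - hj)
  have h3 := h2.mul_sq (div_ne_zero ht h1)
  convert h3 using 1
  field_simp
  rw [h]
  linear_combination x * hj - 2 * x * j * huu

theorem represents_one_add_sqrt_neg_one {j w : K} {p a b : ℕ} (hj : j ^ 2 = -1)
    (hw : w ^ 2 = 2 * (p : K)) (hwi : IsIntegral ℤ w) (hab : a ^ 2 + 1 = 2 * p * b ^ 2) :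
    Represents (𝓞 K) 1 (a + j) := by
  have h : (a : K) ^ 2 + 1 = 2 * p * b ^ 2 := by exact_mod_cast hab
  have ha : IsIntegral ℤ (a : K) := isIntegral_natCast _
  have hb : IsIntegral ℤ (b : K) := isIntegral_natCast _
  have hx : (a : K) + j ≠ 0 := by
    intro h0
    have : ((a ^ 2 + 1 : ℕ) : K) = 0 := by
      push_cast
      linear_combination (a - j) * h0 + hj
    exact (Nat.succ_ne_zero _) (Nat.cast_eq_zero.mp this)
  refine represents_one_of_two_mul (u := a + b * w) (u' := b * w - a) (t := a + j + b * w) hj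
    (ha.add (hb.mul hwi)) ((hb.mul hwi).sub ha) ?_ hx ?_
  · linear_combination b ^ 2 * hw - h
  · linear_combination b ^ 2 * hw - h + hj

theorem represents_one_one_add_sqrt {j τ w : K} {p q a b : ℕ} (hj : j ^ 2 = -1)
    (hw : w ^ 2 = 2 * (p : K)) (hwi : IsIntegral ℤ w) (hτ : τ ^ 2 = q) (hτi : IsIntegral ℤ τ)
    (hq : q ≠ 1) (hab : q * a ^ 2 = 2 * p * b ^ 2 + 1) :
    Represents (𝓞 K) 1 (1 + a * τ) := by
  have h : (q : K) * a ^ 2 = 2 * p * b ^ 2 + 1 := by exact_mod_cast hab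
  have ha : IsIntegral ℤ (a : K) := isIntegral_natCast _
  have hb : IsIntegral ℤ (b : K) := isIntegral_natCast _
  have hx : (1 : K) + a * τ ≠ 0 := by
    intro h0
    have h1 : ((2 * p * b ^ 2 : ℕ) : K) = 0 := by
      push_cast
      linear_combination (a * τ - 1) * h0 - h - a ^ 2 * hτ
    have h2 := Nat.cast_eq_zero.mp h1
    rw [h2] at hab
    exact hq (Nat.eq_one_of_mul_eq_one_right hab)
  refine represents_one_of_two_mul (u := a * τ + b * w) (u' := a * τ - b * w)
    (t := 1 + (a * τ + b * w)) hj ((ha.mul hτi).add (hb.mul hwi))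
    ((ha.mul hτi).sub (hb.mul hwi)) ?_ hx ?_
  · linear_combination a ^ 2 * hτ - b ^ 2 * hw + h
  · linear_combination b ^ 2 * hw - a ^ 2 * hτ - h

theorem exists_represents_one_add {j : K} {p a b : ℕ} (hj : j ^ 2 = -1) (hp : p % 8 = 5)
    (hab : a ^ 2 + 1 = 2 * p * b ^ 2) (h : Represents (𝓞 K) 1 (a + j)) :
    ∃ c, Represents (𝓞 K) c (1 + j) := by
  obtain ⟨ι, hι⟩ : ∃ ι : 𝓞 K, algebraMap (𝓞 K) K ι = j :=
    ⟨⟨j, isIntegral_of_sq_eq_neg_one hj⟩, rfl⟩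
  have hι2 : ι ^ 2 = -1 := by
    apply RingOfIntegers.coe_injective
    rw [map_pow, hι, hj, map_neg, map_one]
  have ha : a % 2 = 1 := by
    have h2 : (a ^ 2 + 1) % 2 = 0 := by rw [hab, mul_assoc]; omega
    rcases Nat.mod_two_eq_zero_or_one a with h0 | h0
    · simp [Nat.add_mod, Nat.pow_mod, h0] at h2
    · exact h0
  have hb : b % 2 = 1 := by
    rcases Nat.mod_two_eq_zero_or_one b with h0 | h0
    · obtain ⟨e, rfl⟩ : ∃ e, b = 2 * e := ⟨b / 2, by omega⟩
      have h4 : (a ^ 2 + 1) % 4 = 0 := by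
        rw [hab, show 2 * p * (2 * e) ^ 2 = 4 * (2 * p * e ^ 2) by ring]; omega
      have : a % 4 = 1 ∨ a % 4 = 3 := by omega
      rcases this with h5 | h5 <;> simp [Nat.add_mod, Nat.pow_mod, h5] at h4
    · exact h0
  obtain ⟨e, rfl⟩ : ∃ e, a = 2 * e + 1 := ⟨a / 2, by omega⟩
  have hne : (1 : K) + j ≠ 0 := by
    intro h0
    have : (2 : K) = 0 := by linear_combination (1 - j) * h0 + hj
    exact two_ne_zero this
  refine exists_represents_of_isSquare hne fun Q => ?_
  change EvenAt Q (1 + j)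
  by_cases h2 : (2 : 𝓞 K) ∈ Q.asIdeal
  · have hfac : ((2 * e + 1 : ℕ) : K) + j =
        (1 + j) * algebraMap (𝓞 K) K ((e + 1 : ℕ) - (e : ℕ) * ι) := by
      rw [map_sub, map_mul, hι, map_natCast, map_natCast]
      push_cast
      linear_combination (e : K) * hj
    have hsum : (e + 1) ^ 2 + e ^ 2 = p * b ^ 2 := by nlinarith
    have hprod : ((e + 1 : ℕ) - (e : ℕ) * ι) * ((e + 1 : ℕ) + (e : ℕ) * ι) =
        (((p * b ^ 2 : ℕ) : ℤ) : 𝓞 K) := by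
      rw [← hsum]
      push_cast
      linear_combination -(e : 𝓞 K) ^ 2 * hι2
    have hnot : ((e + 1 : ℕ) - (e : ℕ) * ι) ∉ Q.asIdeal := by
      intro hmem
      have := Ideal.mul_mem_right ((e + 1 : ℕ) + (e : ℕ) * ι) _ hmem
      rw [hprod, intCast_mem_iff Q.isPrime Nat.prime_two (by exact_mod_cast h2)] at this
      have h3 : 2 ∣ p * b ^ 2 := by exact_mod_cast this
      rw [Nat.prime_two.dvd_mul] at h3
      rcases h3 with h3 | h3
      · omega
      · have := Nat.prime_two.dvd_of_dvd_pow h3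
        omega
    have heven : EvenAt Q (((2 * e + 1 : ℕ) : K) + j) := h.isSquare_valuation Q
    have hne' : algebraMap (𝓞 K) K ((e + 1 : ℕ) - (e : ℕ) * ι) ≠ 0 := by
      intro h0
      rw [h0, mul_zero] at hfac
      exact h.ne_zero hfac
    rw [hfac, evenAt_mul_iff hne hne'] at heven
    exact heven.mpr (evenAt_of_notMem hnot)
  · rw [← hι, ← map_one (algebraMap (𝓞 K) K), ← map_add]
    refine evenAt_of_notMem fun hmem => h2 ?_
    have := Ideal.mul_mem_right (1 - ι) _ hmem
    rwa [show (1 + ι) * (1 - ι) = 2 by linear_combination -hι2] at this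

end Relations

end TwoClassGroup

namespace TwoClassGroup

open NumberField IsDedekindDomain

theorem not_isSquare_valuation_of_pow_eq {R : Type*} [CommRing R] [IsDedekindDomain R]
    {L : Type*} [Field L] [Algebra R L] [IsFractionRing R L] {P : HeightOneSpectrum R} {h : ℕ}
    (hh : Odd h) {π : R} (hπ : P.asIdeal ^ h = Ideal.span {π}) :
    ¬ EvenAt P (algebraMap R L π) := by
  classical
  have hP : P.asIdeal ^ h ≠ 0 := pow_ne_zero _ P.ne_bot
  have hπ0 : π ≠ 0 := by
    rintro rfl
    exact hP (by simpa using hπ)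
  unfold EvenAt
  rw [HeightOneSpectrum.valuation_of_algebraMap, P.intValuation_if_neg hπ0, isSquare_exp_iff,
    ← hπ, Associates.mk_pow,
    Associates.count_pow (by simpa using P.ne_bot) P.associates_irreducible,
    Associates.count_self P.associates_irreducible, mul_one, even_neg, Int.even_coe_nat,
    Nat.not_even_iff_odd]
  exact hh

theorem evenAt_of_pow_eq {R : Type*} [CommRing R] [IsDedekindDomain R]
    {L : Type*} [Field L] [Algebra R L] [IsFractionRing R L] {P P' : HeightOneSpectrum R} {h : ℕ}
    {π : R} (hπ : P.asIdeal ^ h = Ideal.span {π}) (hP : P' ≠ P) :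
    EvenAt P' (algebraMap R L π) := by
  apply evenAt_of_notMem
  intro hmem
  apply hP
  have h1 : P.asIdeal ^ h ≤ P'.asIdeal := by
    rw [hπ, Ideal.span_singleton_le_iff_mem]
    exact hmem
  ext1
  exact (P.isMaximal.eq_of_le P'.isPrime.ne_top (P'.isPrime.le_of_pow_le h1)).symm

theorem EvenAt.algebraMap_of_under {k K : Type*} [Field k] [NumberField k] [Field K]
    [NumberField K] [Algebra k K] {Q : HeightOneSpectrum (𝓞 K)} {x : k}
    (h : EvenAt (Q.under (𝓞 k)) x) : EvenAt Q (algebraMap k K x) := by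
  have hlies : Q.asIdeal.LiesOver (Q.under (𝓞 k)).asIdeal := ⟨rfl⟩
  unfold EvenAt at h ⊢
  rw [← HeightOneSpectrum.valuation_liesOver K (Q.under (𝓞 k)) Q x]
  exact h.pow _

section Labels

variable {F k : Type*} [Field F] [NumberField F] [Field k] [NumberField k] [Algebra F k]
  {i : F} {s : k} {p q : ℕ} {ι σ ω : 𝓞 k} {a b u v : ℕ} {P P' : HeightOneSpectrum (𝓞 k)}

namespace Generators

theorem evenAt_two (hp : p.Prime) (hp2 : p ≠ 2) (hpP : (p : 𝓞 k) ∈ P.asIdeal) :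
    EvenAt P (2 : k) := by
  have h2 : ((2 : ℤ) : 𝓞 k) ∉ P.asIdeal := by
    rw [intCast_mem_iff P.isPrime hp hpP]
    intro h
    exact hp2 ((Nat.prime_dvd_prime_iff_eq hp Nat.prime_two).mp (by exact_mod_cast h))
  have := evenAt_of_notMem (L := k) h2
  rwa [map_intCast, Int.cast_ofNat] at this

theorem not_dvd (hp : p.Prime) (hp2 : p ≠ 2) (huv : q * u ^ 2 = 2 * p * v ^ 2 + 1) :
    ¬ (p : ℤ) ∣ 2 * q * u := by
  intro h
  have h1 : p ∣ 2 * q * u := by exact_mod_cast h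
  rw [mul_assoc, hp.dvd_mul] at h1
  rcases h1 with h1 | h1
  · exact hp2 ((Nat.prime_dvd_prime_iff_eq hp Nat.prime_two).mp h1)
  · have h2 : p ∣ 2 * p * v ^ 2 + 1 := by
      rw [← huv, pow_two, ← mul_assoc]
      exact h1.mul_right _
    have h3 : p ∣ 2 * p * v ^ 2 := by
      rw [show 2 * p * v ^ 2 = p * (2 * v ^ 2) by ring]
      exact dvd_mul_right _ _
    exact hp.one_lt.ne' (Nat.dvd_one.mp ((Nat.dvd_add_right h3).mp h2))

theorem evenAt_add_iff_not_evenAt_sub (hg : Generators F k i s q ι σ ω)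
    (hF : IsQuad ℚ F (-1) i) (hk : IsQuad F k (q : F) s) (hp : p.Prime) (hp2 : p ≠ 2)
    (hab : a ^ 2 + 1 = 2 * p * b ^ 2) (huv : q * u ^ 2 = 2 * p * v ^ 2 + 1)
    (hpP : (p : 𝓞 k) ∈ P.asIdeal) :
    EvenAt P (a + algebraMap F k i) ↔ ¬ EvenAt P (a - algebraMap F k i) := by
  have hb : b ≠ 0 := by rintro rfl; simp at hab
  have hp0 : (p : k) ≠ 0 := Nat.cast_ne_zero.mpr hp.ne_zero
  have hb0 : (b : k) ≠ 0 := Nat.cast_ne_zero.mpr hb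
  have hi : algebraMap F k i ^ 2 = -1 := by rw [← map_pow, hF.sq_eq_neg_one, map_neg, map_one]
  have hab' : (a : k) ^ 2 + 1 = 2 * p * b ^ 2 := by exact_mod_cast hab
  have hprod : (a + algebraMap F k i) * (a - algebraMap F k i) = 2 * p * (b : k) ^ 2 := by
    linear_combination hab' - hi
  have hne : (a + algebraMap F k i) * (a - algebraMap F k i) ≠ 0 := by
    rw [hprod]
    exact mul_ne_zero (mul_ne_zero two_ne_zero hp0) (pow_ne_zero _ hb0)
  have hpe := hg.not_evenAt_prime hF hk hp (fun h => not_dvd hp hp2 huv (h.mul_right _)) hpP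
  have h1 : ¬ EvenAt P ((a + algebraMap F k i) * (a - algebraMap F k i)) := by
    rw [hprod, evenAt_mul_iff (mul_ne_zero two_ne_zero hp0) (pow_ne_zero _ hb0),
      evenAt_mul_iff two_ne_zero hp0]
    have := evenAt_two hp hp2 hpP
    have := evenAt_sq (v := P) (b : k)
    tauto
  rw [evenAt_mul_iff (left_ne_zero_of_mul hne) (right_ne_zero_of_mul hne)] at h1
  tauto

theorem evenAt_one_add_iff_not_evenAt_one_sub (hg : Generators F k i s q ι σ ω)
    (hF : IsQuad ℚ F (-1) i) (hk : IsQuad F k (q : F) s) (hp : p.Prime) (hp2 : p ≠ 2)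
    (hq : q ≠ 1) (huv : q * u ^ 2 = 2 * p * v ^ 2 + 1) (hpP : (p : 𝓞 k) ∈ P.asIdeal) :
    EvenAt P (1 + u * s) ↔ ¬ EvenAt P (1 - u * s) := by
  have hv : v ≠ 0 := by
    rintro rfl
    exact hq (Nat.eq_one_of_mul_eq_one_right (by simpa using huv))
  have hp0 : (p : k) ≠ 0 := Nat.cast_ne_zero.mpr hp.ne_zero
  have hv0 : (v : k) ≠ 0 := Nat.cast_ne_zero.mpr hv
  have hs : s ^ 2 = (q : k) := by rw [hk.sq_eq, map_natCast]
  have huv' : (q : k) * u ^ 2 = 2 * p * v ^ 2 + 1 := by exact_mod_cast huv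
  have hprod : (1 + u * s) * (1 - u * s) = 2 * p * (algebraMap F k i * v) ^ 2 := by
    have hi : algebraMap F k i ^ 2 = -1 := by
      rw [← map_pow, hF.sq_eq_neg_one, map_neg, map_one]
    linear_combination -u ^ 2 * hs - huv' - 2 * p * v ^ 2 * hi
  have hiv : algebraMap F k i * v ≠ 0 :=
    mul_ne_zero (by simpa using hF.ne_zero) hv0
  have hne : (1 + u * s) * (1 - u * s) ≠ 0 := by
    rw [hprod]
    exact mul_ne_zero (mul_ne_zero two_ne_zero hp0) (pow_ne_zero _ hiv)
  have hpe := hg.not_evenAt_prime hF hk hp (fun h => not_dvd hp hp2 huv (h.mul_right _)) hpP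
  have h1 : ¬ EvenAt P ((1 + u * s) * (1 - u * s)) := by
    rw [hprod, evenAt_mul_iff (mul_ne_zero two_ne_zero hp0) (pow_ne_zero _ hiv),
      evenAt_mul_iff two_ne_zero hp0]
    have := evenAt_two hp hp2 hpP
    have := evenAt_sq (v := P) (algebraMap F k i * v)
    tauto
  rw [evenAt_mul_iff (left_ne_zero_of_mul hne) (right_ne_zero_of_mul hne)] at h1
  tauto

/-- Residues of `ι` and `uσ` at a prime above `p`, determined by parities of valuations. -/
theorem exists_residues (hg : Generators F k i s q ι σ ω)
    (hF : IsQuad ℚ F (-1) i) (hk : IsQuad F k (q : F) s) (hp : p.Prime) (hp2 : p ≠ 2)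
    (hq : q ≠ 1) (hab : a ^ 2 + 1 = 2 * p * b ^ 2) (huv : q * u ^ 2 = 2 * p * v ^ 2 + 1)
    (X Y : Prop) : ∃ t n : ℤ, ∀ P : HeightOneSpectrum (𝓞 k), (p : 𝓞 k) ∈ P.asIdeal →
      (EvenAt P (a + algebraMap F k i) ↔ X) → (EvenAt P (1 + u * s) ↔ Y) →
        ι - t ∈ P.asIdeal ∧ ((u : ℤ) : 𝓞 k) * σ - n ∈ P.asIdeal := by
  classical
  refine ⟨if X then a else -a, if Y then 1 else -1, fun P hpP hX hY => ⟨?_, ?_⟩⟩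
  · have h := hg.evenAt_add_iff_not_evenAt_sub hF hk hp hp2 hab huv hpP
    split_ifs with hx
    · by_contra hn
      apply h.mp (hX.mpr hx)
      have hn' : (a : 𝓞 k) - ι ∉ P.asIdeal := fun h' => hn (by simpa using neg_mem h')
      simpa [hg.coe_ι] using evenAt_of_notMem (L := k) hn'
    · by_contra hn
      apply hx
      apply hX.mp
      have hn' : (a : 𝓞 k) + ι ∉ P.asIdeal := fun h' => hn (by simpa [add_comm] using h')
      simpa [hg.coe_ι] using evenAt_of_notMem (L := k) hn'
  · have h := hg.evenAt_one_add_iff_not_evenAt_one_sub hF hk hp hp2 hq huv hpP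
    split_ifs with hy
    · by_contra hn
      apply h.mp (hY.mpr hy)
      have hn' : 1 - (u : 𝓞 k) * σ ∉ P.asIdeal := fun h' => hn (by simpa using neg_mem h')
      simpa [hg.coe_σ] using evenAt_of_notMem (L := k) hn'
    · by_contra hn
      apply hy
      apply hY.mp
      have hn' : 1 + (u : 𝓞 k) * σ ∉ P.asIdeal := fun h' => hn (by simpa [add_comm] using h')
      simpa [hg.coe_σ] using evenAt_of_notMem (L := k) hn'

theorem eq_of_evenAt_iff (hg : Generators F k i s q ι σ ω)
    (hF : IsQuad ℚ F (-1) i) (hk : IsQuad F k (q : F) s) (hp : p.Prime) (hp2 : p ≠ 2)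
    (hq : q ≠ 1) (hab : a ^ 2 + 1 = 2 * p * b ^ 2) (huv : q * u ^ 2 = 2 * p * v ^ 2 + 1)
    (hpP : (p : 𝓞 k) ∈ P.asIdeal) (hpP' : (p : 𝓞 k) ∈ P'.asIdeal)
    (hX : EvenAt P (a + algebraMap F k i) ↔ EvenAt P' (a + algebraMap F k i))
    (hY : EvenAt P (1 + u * s) ↔ EvenAt P' (1 + u * s)) : P = P' := by
  obtain ⟨t, n, h⟩ := hg.exists_residues hF hk hp hp2 hq hab huv
    (EvenAt P' (a + algebraMap F k i)) (EvenAt P' (1 + u * s))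
  obtain ⟨h1, h2⟩ := h P hpP hX hY
  obtain ⟨h3, h4⟩ := h P' hpP' Iff.rfl Iff.rfl
  exact hg.eq_of_residues hF hk hp (not_dvd hp hp2 huv) hpP hpP' h1 h3 h2 h4

theorem absNorm_eq_of_natCast_mem (hg : Generators F k i s q ι σ ω)
    (hF : IsQuad ℚ F (-1) i) (hk : IsQuad F k (q : F) s) (hp : p.Prime) (hp2 : p ≠ 2)
    (hq : q ≠ 1) (hab : a ^ 2 + 1 = 2 * p * b ^ 2) (huv : q * u ^ 2 = 2 * p * v ^ 2 + 1)
    (hpP : (p : 𝓞 k) ∈ P.asIdeal) : Ideal.absNorm P.asIdeal = p := by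
  obtain ⟨t, n, h⟩ := hg.exists_residues hF hk hp hp2 hq hab huv
    (EvenAt P (a + algebraMap F k i)) (EvenAt P (1 + u * s))
  obtain ⟨h1, h2⟩ := h P hpP Iff.rfl Iff.rfl
  exact hg.absNorm_eq hF hk hp (not_dvd hp hp2 huv) hpP h1 h2

end Generators

end Labels

end TwoClassGroup

namespace TwoClassGroup

open NumberField IsDedekindDomain

section

variable {F k : Type*} [Field F] [NumberField F] [Field k] [NumberField k] [Algebra F k]
  {i : F} {s : k} {q : ℕ} {η : (𝓞 k)ˣ} [Fact q.Prime]

theorem represents_one_algebraMap_mul {K : Type*} [Field K] [NumberField K] [Algebra k K]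
    (hF : IsQuad ℚ F (-1) i) (η : (𝓞 k)ˣ) (j l : ℕ) {v : k} (hv : v ≠ 0) :
    Represents (𝓞 K) 1
      (algebraMap k K (algebraMap F k i ^ j * algebraMap (𝓞 k) k η ^ l * v ^ 2)) := by
  have hi : algebraMap k K (algebraMap F k i) ^ 2 = -1 := by
    rw [← map_pow, ← map_pow, hF.sq_eq_neg_one]
    simp only [map_neg, map_one]
  have hi' := isIntegral_of_sq_eq_neg_one hi
  have h1 : Represents (𝓞 K) 1 (algebraMap k K (algebraMap F k i)) :=
    represents_one_of_mul_eq_one hi' hi'.neg (by linear_combination -hi)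
  have h2 : Represents (𝓞 K) 1 (algebraMap k K (algebraMap (𝓞 k) k η)) :=
    represents_one_of_unit (L := K) (Units.map (algebraMap (𝓞 k) (𝓞 K)).toMonoidHom η)
  have h3 := ((h1.pow j).mul (h2.pow l)).mul_sq (v := algebraMap k K v) (by simpa using hv)
  simpa using h3

theorem odd_classNumber_biquadratic (hF : IsQuad ℚ F (-1) i) (hk : IsQuad F k (q : F) s)
    (hq : q % 8 = 3) (hη : Algebra.norm F (algebraMap (𝓞 k) k η) = -i) :
    Odd (Fintype.card (ClassGroup (𝓞 k))) := by
  rw [← Nat.not_even_iff_odd, even_iff_two_dvd]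
  intro h2
  obtain ⟨c, hc⟩ := exists_prime_orderOf_dvd_card 2 h2
  have hc2 : c ^ 2 = 1 := by rw [← hc, pow_orderOf_eq_one]
  obtain ⟨y, hy⟩ := exists_represents (L := k) hc2
  obtain ⟨j, l, f, hf, hN⟩ := represents_biquadratic hF hk hq hη hy
  have h1 := represents_one_algebraMap_mul (K := k) hF η j l hf
  rw [← hN] at h1
  rw [hy.unique h1, orderOf_one] at hc
  norm_num at hc

theorem exists_pow_eq_span (hF : IsQuad ℚ F (-1) i) (hk : IsQuad F k (q : F) s)
    (hq : q % 8 = 3) (hη : Algebra.norm F (algebraMap (𝓞 k) k η) = -i)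
    (P : HeightOneSpectrum (𝓞 k)) :
    ∃ (h : ℕ) (π : 𝓞 k), Odd h ∧ P.asIdeal ^ h = Ideal.span {π} := by
  have hP : P.asIdeal ∈ nonZeroDivisors (Ideal (𝓞 k)) := mem_nonZeroDivisors_of_ne_zero P.ne_bot
  refine ⟨Fintype.card (ClassGroup (𝓞 k)), ?_⟩
  have h1 : ClassGroup.mk0 (⟨P.asIdeal, hP⟩ ^ Fintype.card (ClassGroup (𝓞 k))) = 1 := by
    rw [map_pow, pow_card_eq_one]
  obtain ⟨π, hπ⟩ := (ClassGroup.mk0_eq_one_iff (pow_mem hP _)).mp h1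
  exact ⟨π, odd_classNumber_biquadratic hF hk hq hη, hπ⟩

theorem exists_norm_eq_pow {π : 𝓞 k} {P : Ideal (𝓞 k)} {p h : ℕ} (hP : Ideal.absNorm P = p)
    (hπ : P ^ h = Ideal.span {π}) : ∃ ε : ℤ, (ε = 1 ∨ ε = -1) ∧
      Algebra.norm ℚ (algebraMap (𝓞 k) k π) = ε * p ^ h := by
  have h1 : (Algebra.norm ℤ π).natAbs = p ^ h := by
    rw [← Ideal.absNorm_span_singleton, ← hπ, map_pow, hP]
  have h2 : Algebra.norm ℚ (algebraMap (𝓞 k) k π) = (Algebra.norm ℤ π : ℤ) :=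
    (Algebra.coe_norm_int π).symm
  rw [h2]
  rcases Int.natAbs_eq (Algebra.norm ℤ π) with h3 | h3
  · exact ⟨1, Or.inl rfl, by rw [h3, h1]; push_cast; ring⟩
  · exact ⟨-1, Or.inr rfl, by rw [h3, h1]; push_cast; ring⟩

end

theorem exists_natCast_mem {k : Type*} [Field k] [NumberField k]
    {p : ℕ} (hp : p.Prime) :
    ∃ P : HeightOneSpectrum (𝓞 k), (p : 𝓞 k) ∈ P.asIdeal := by
  have hpr := prime_natCast_rat hp
  have hpr' : Prime (Ideal.span {(p : 𝓞 ℚ)}) := by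
    rwa [Ideal.prime_span_singleton_iff]
  obtain ⟨P, hP⟩ := exists_under_eq (L := k) (HeightOneSpectrum.ofPrime hpr')
  refine ⟨P, ?_⟩
  have h1 : (p : 𝓞 ℚ) ∈ (P.under (𝓞 ℚ)).asIdeal := by
    rw [hP]
    exact Ideal.mem_span_singleton_self _
  have h2 : algebraMap (𝓞 ℚ) (𝓞 k) p ∈ P.asIdeal := h1
  rwa [map_natCast] at h2

end TwoClassGroup

namespace TwoClassGroup

open NumberField IsDedekindDomain

section

variable {k K : Type*} [Field k] [Field K] [NumberField K] [Algebra k K]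

theorem Represents.base_ne_zero {c : ClassGroup (𝓞 K)} {x : k}
    (hx : Represents (𝓞 K) c (algebraMap k K x)) : x ≠ 0 := by
  rintro rfl
  exact hx.ne_zero (map_zero _)

theorem Represents.map_mul {c d : ClassGroup (𝓞 K)} {x y : k}
    (hx : Represents (𝓞 K) c (algebraMap k K x)) (hy : Represents (𝓞 K) d (algebraMap k K y)) :
    Represents (𝓞 K) (c * d) (algebraMap k K (x * y)) := by
  rw [_root_.map_mul]
  exact hx.mul hy

theorem Represents.map_mul_one {c : ClassGroup (𝓞 K)} {x y : k}
    (hx : Represents (𝓞 K) c (algebraMap k K x)) (hy : Represents (𝓞 K) 1 (algebraMap k K y)) :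
    Represents (𝓞 K) c (algebraMap k K (x * y)) := by
  have := hx.map_mul hy
  rwa [mul_one] at this

end

variable {F k K : Type*} [Field F] [NumberField F] [Field k] [NumberField k] [Field K]
  [NumberField K] [Algebra F k] [Algebra k K] {i : F} {s : k} {w : K} {p q : ℕ}
  [Fact q.Prime]

namespace Tower

theorem algebraMap_i_sq (T : Tower F k K i s w p q) :
    algebraMap k K (algebraMap F k i) ^ 2 = -1 := by
  rw [← map_pow, ← map_pow, T.quad_F.sq_eq_neg_one]
  simp only [map_neg, map_one]

theorem w_sq (T : Tower F k K i s w p q) : w ^ 2 = 2 * (p : K) := by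
  rw [T.quad_K.sq_eq, map_mul, map_ofNat, map_natCast]

theorem isIntegral_w (T : Tower F k K i s w p q) : IsIntegral ℤ w := by
  refine IsIntegral.of_pow (n := 2) (by norm_num) ?_
  rw [T.w_sq, show (2 * (p : K)) = ((2 * p : ℕ) : K) by push_cast; ring]
  exact isIntegral_natCast _

theorem evenAt_of_represents (T : Tower F k K i s w p q) {c : ClassGroup (𝓞 K)} {m : k}
    (h : Represents (𝓞 K) c (algebraMap k K m)) {P : HeightOneSpectrum (𝓞 k)}
    (h2 : (2 : 𝓞 k) ∉ P.asIdeal) (hp : (p : 𝓞 k) ∉ P.asIdeal) : EvenAt P m := by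
  obtain ⟨Q, rfl⟩ := exists_under_eq (L := K) P
  obtain ⟨z, hz⟩ : ∃ z : 𝓞 K, algebraMap (𝓞 K) K z = w := ⟨⟨w, T.isIntegral_w⟩, rfl⟩
  have hz2 : z ^ 2 = 2 * (p : 𝓞 K) := by
    apply RingOfIntegers.coe_injective
    rw [map_pow, map_mul, map_natCast, map_ofNat, hz, T.w_sq]
  unfold EvenAt
  rw [← T.quad_K.valuation_eq Q z 0 (-(2 * p)) (by simp [hz2, map_ofNat]) ?_ ?_ m]
  · exact h.isSquare_valuation Q
  · intro r hr
    have hr' : w = algebraMap k K r := hz.symm.trans hr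
    apply T.quad_K.not_isSquare
    refine ⟨r, ?_⟩
    apply (algebraMap k K).injective
    rw [← T.quad_K.sq_eq, hr', map_mul, pow_two]
  · intro hmem
    have h8 : algebraMap (𝓞 k) (𝓞 K) (2 * 2 * 2 * p) ∈ Q.asIdeal := by
      have := Ideal.mul_mem_left Q.asIdeal (2 * z - algebraMap (𝓞 k) (𝓞 K) 0) hmem
      convert this using 1
      rw [map_zero, map_mul, map_mul, map_mul, map_natCast, map_ofNat]
      linear_combination -4 * hz2
    have h8' : (2 * 2 * 2 * p : 𝓞 k) ∈ (Q.under (𝓞 k)).asIdeal := h8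
    have hPp := (Q.under (𝓞 k)).isPrime
    rcases hPp.mem_or_mem h8' with h9 | h9
    · rcases hPp.mem_or_mem h9 with h9 | h9
      · exact h2 ((hPp.mem_or_mem h9).elim id id)
      · exact h2 h9
    · exact hp h9

variable {a b u v : ℕ} {P P₁ : HeightOneSpectrum (𝓞 k)} {ι σ ω π : 𝓞 k} {h : ℕ}
  {c : ClassGroup (𝓞 K)}

theorem represents_add_i (T : Tower F k K i s w p q) (hab : a ^ 2 + 1 = 2 * p * b ^ 2) :
    Represents (𝓞 K) 1 (algebraMap k K (a + algebraMap F k i)) := by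
  have := represents_one_add_sqrt_neg_one T.algebraMap_i_sq T.w_sq T.isIntegral_w hab
  simpa using this

theorem represents_sub_i (T : Tower F k K i s w p q) (hab : a ^ 2 + 1 = 2 * p * b ^ 2) :
    Represents (𝓞 K) 1 (algebraMap k K (a - algebraMap F k i)) := by
  have := represents_one_add_sqrt_neg_one (j := -algebraMap k K (algebraMap F k i))
    (by rw [neg_sq, T.algebraMap_i_sq]) T.w_sq T.isIntegral_w hab
  simpa [sub_eq_add_neg] using this

theorem algebraMap_s_sq (T : Tower F k K i s w p q) : algebraMap k K s ^ 2 = (q : K) := by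
  rw [← map_pow, T.quad_k.sq_eq, map_natCast, map_natCast]

theorem isIntegral_algebraMap_s (T : Tower F k K i s w p q) :
    IsIntegral ℤ (algebraMap k K s) := by
  refine IsIntegral.of_pow (n := 2) (by norm_num) ?_
  rw [T.algebraMap_s_sq]
  exact isIntegral_natCast _

theorem represents_one_add_s (T : Tower F k K i s w p q)
    (huv : q * u ^ 2 = 2 * p * v ^ 2 + 1) :
    Represents (𝓞 K) 1 (algebraMap k K (1 + u * s)) := by
  have := represents_one_one_add_sqrt T.algebraMap_i_sq T.w_sq T.isIntegral_w T.algebraMap_s_sq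
    T.isIntegral_algebraMap_s (Fact.out : q.Prime).one_lt.ne' huv
  simpa using this

theorem represents_one_sub_s (T : Tower F k K i s w p q)
    (huv : q * u ^ 2 = 2 * p * v ^ 2 + 1) :
    Represents (𝓞 K) 1 (algebraMap k K (1 - u * s)) := by
  have := represents_one_one_add_sqrt (τ := -algebraMap k K s) T.algebraMap_i_sq T.w_sq
    T.isIntegral_w (by rw [neg_sq, T.algebraMap_s_sq]) T.isIntegral_algebraMap_s.neg
    (Fact.out : q.Prime).one_lt.ne' huv
  simpa [sub_eq_add_neg] using this

theorem p_ne_two (T : Tower F k K i s w p q) : p ≠ 2 := by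
  rintro rfl
  exact absurd T.mod_p (by norm_num)

theorem exists_evenAt_iff_add_i (T : Tower F k K i s w p q) (hp : p.Prime)
    (hg : Generators F k i s q ι σ ω) (hab : a ^ 2 + 1 = 2 * p * b ^ 2)
    (huv : q * u ^ 2 = 2 * p * v ^ 2 + 1) (X : Prop) :
    ∃ l : k, Represents (𝓞 K) 1 (algebraMap k K l) ∧ ∀ P : HeightOneSpectrum (𝓞 k),
      (p : 𝓞 k) ∈ P.asIdeal → (EvenAt P l ↔ ¬ (EvenAt P (a + algebraMap F k i) ↔ X)) := by
  by_cases hX : X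
  · refine ⟨_, T.represents_sub_i hab, fun P hP => ?_⟩
    have := hg.evenAt_add_iff_not_evenAt_sub T.quad_F T.quad_k hp T.p_ne_two hab huv hP
    tauto
  · refine ⟨_, T.represents_add_i hab, fun P hP => ?_⟩
    tauto

theorem exists_evenAt_iff_one_add_s (T : Tower F k K i s w p q) (hp : p.Prime)
    (hg : Generators F k i s q ι σ ω) (huv : q * u ^ 2 = 2 * p * v ^ 2 + 1) (Y : Prop) :
    ∃ l : k, Represents (𝓞 K) 1 (algebraMap k K l) ∧ ∀ P : HeightOneSpectrum (𝓞 k),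
      (p : 𝓞 k) ∈ P.asIdeal → (EvenAt P l ↔ ¬ (EvenAt P (1 + u * s) ↔ Y)) := by
  by_cases hY : Y
  · refine ⟨_, T.represents_one_sub_s huv, fun P hP => ?_⟩
    have := hg.evenAt_one_add_iff_not_evenAt_one_sub T.quad_F T.quad_k hp T.p_ne_two
      (Fact.out : q.Prime).one_lt.ne' huv hP
    tauto
  · refine ⟨_, T.represents_one_add_s huv, fun P hP => ?_⟩
    tauto

theorem represents_two_mul (T : Tower F k K i s w p q) :
    Represents (𝓞 K) 1 (algebraMap k K (2 * p)) := by
  rw [← T.quad_K.sq_eq]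
  exact represents_one_sq T.quad_K.ne_zero

theorem not_evenAt_two_mul (T : Tower F k K i s w p q) (hp : p.Prime)
    (hg : Generators F k i s q ι σ ω) (huv : q * u ^ 2 = 2 * p * v ^ 2 + 1)
    (hP : (p : 𝓞 k) ∈ P.asIdeal) : ¬ EvenAt P (2 * p : k) := by
  rw [evenAt_mul_iff two_ne_zero (Nat.cast_ne_zero.mpr hp.ne_zero)]
  have h1 := hg.not_evenAt_prime T.quad_F T.quad_k hp
    (fun h => Generators.not_dvd hp T.p_ne_two huv (h.mul_right _)) hP
  have h2 := Generators.evenAt_two hp T.p_ne_two hP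
  tauto

theorem exists_evenAt_iff_ne (T : Tower F k K i s w p q) (hp : p.Prime)
    (hg : Generators F k i s q ι σ ω) (hab : a ^ 2 + 1 = 2 * p * b ^ 2)
    (huv : q * u ^ 2 = 2 * p * v ^ 2 + 1) (hP₁ : (p : 𝓞 k) ∈ P₁.asIdeal) (hh : Odd h)
    (hπ : P₁.asIdeal ^ h = Ideal.span {π})
    (hc : Represents (𝓞 K) c (algebraMap k K (algebraMap (𝓞 k) k π)))
    (hP : (p : 𝓞 k) ∈ P.asIdeal) :
    ∃ n : k, Represents (𝓞 K) c (algebraMap k K n) ∧ ∀ P' : HeightOneSpectrum (𝓞 k),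
      (p : 𝓞 k) ∈ P'.asIdeal → (EvenAt P' n ↔ P' ≠ P) := by
  have hq := (Fact.out : q.Prime).one_lt.ne'
  have hev {x y : k} {c d : ClassGroup (𝓞 K)} (hx : Represents (𝓞 K) c (algebraMap k K x))
      (hy : Represents (𝓞 K) d (algebraMap k K y)) (P' : HeightOneSpectrum (𝓞 k)) :
      EvenAt P' (x * y) ↔ (EvenAt P' x ↔ EvenAt P' y) :=
        evenAt_mul_iff hx.base_ne_zero hy.base_ne_zero
  have heq {P P' : HeightOneSpectrum (𝓞 k)} (hpP : (p : 𝓞 k) ∈ P.asIdeal)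
      (hpP' : (p : 𝓞 k) ∈ P'.asIdeal) :
      P = P' ↔ (EvenAt P (a + algebraMap F k i) ↔ EvenAt P' (a + algebraMap F k i)) ∧
        (EvenAt P (1 + u * s) ↔ EvenAt P' (1 + u * s)) := by
    refine ⟨by rintro rfl; exact ⟨Iff.rfl, Iff.rfl⟩, fun hXY => ?_⟩
    exact hg.eq_of_evenAt_iff T.quad_F T.quad_k hp T.p_ne_two hq hab huv hpP hpP' hXY.1 hXY.2
  have hπe (P' : HeightOneSpectrum (𝓞 k)) : EvenAt P' (algebraMap (𝓞 k) k π) ↔ P' ≠ P₁ := by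
    refine ⟨?_, evenAt_of_pow_eq hπ⟩
    rintro he rfl
    exact not_isSquare_valuation_of_pow_eq hh hπ he
  obtain ⟨x, hx, hxe⟩ := T.exists_evenAt_iff_add_i hp hg hab huv
    (EvenAt P₁ (a + algebraMap F k i))
  obtain ⟨y, hy, hye⟩ := T.exists_evenAt_iff_one_add_s hp hg huv (EvenAt P₁ (1 + u * s))
  have h1 := heq hP hP₁
  by_cases hX : EvenAt P (a + algebraMap F k i) ↔ EvenAt P₁ (a + algebraMap F k i)
  · by_cases hY : EvenAt P (1 + u * s) ↔ EvenAt P₁ (1 + u * s)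
    · rw [h1.mpr ⟨hX, hY⟩]
      exact ⟨_, hc, fun P' _ => hπe P'⟩
    · refine ⟨_, hc.map_mul_one hx, fun P' hP' => ?_⟩
      have h2 := heq hP' hP₁
      have h3 := heq hP' hP
      have h4 := hxe P' hP'
      rw [hev hc hx, hπe, h4, Ne, Ne, h2, h3]
      clear * - hX hY
      generalize EvenAt P' (a + algebraMap F k i) = A, EvenAt P' (1 + u * s) = B,
        EvenAt P (a + algebraMap F k i) = A₁, EvenAt P (1 + u * s) = B₁,
        EvenAt P₁ (a + algebraMap F k i) = A₂, EvenAt P₁ (1 + u * s) = B₂ at *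
      grind
  · by_cases hY : EvenAt P (1 + u * s) ↔ EvenAt P₁ (1 + u * s)
    · refine ⟨_, hc.map_mul_one hy, fun P' hP' => ?_⟩
      have h2 := heq hP' hP₁
      have h3 := heq hP' hP
      have h4 := hye P' hP'
      rw [hev hc hy, hπe, h4, Ne, Ne, h2, h3]
      clear * - hX hY
      generalize EvenAt P' (a + algebraMap F k i) = A, EvenAt P' (1 + u * s) = B,
        EvenAt P (a + algebraMap F k i) = A₁, EvenAt P (1 + u * s) = B₁,
        EvenAt P₁ (a + algebraMap F k i) = A₂, EvenAt P₁ (1 + u * s) = B₂ at *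
      grind
    · refine ⟨_, ((hc.map_mul_one hx).map_mul_one hy).map_mul_one T.represents_two_mul,
        fun P' hP' => ?_⟩
      have h2 := heq hP' hP₁
      have h3 := heq hP' hP
      have h4 := hxe P' hP'
      have h5 := hye P' hP'
      have h6 := T.not_evenAt_two_mul hp hg huv hP'
      rw [hev ((hc.map_mul_one hx).map_mul_one hy) T.represents_two_mul, hev (hc.map_mul_one hx) hy,
        hev hc hx, hπe]
      rw [h4, h5, Ne, Ne, h2, h3, iff_false_right h6]
      clear * - hX hY
      generalize EvenAt P' (a + algebraMap F k i) = A, EvenAt P' (1 + u * s) = B,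
        EvenAt P (a + algebraMap F k i) = A₁, EvenAt P (1 + u * s) = B₁,
        EvenAt P₁ (a + algebraMap F k i) = A₂, EvenAt P₁ (1 + u * s) = B₂ at *
      grind

theorem exists_represents_of_pow_eq (T : Tower F k K i s w p q) (hp : p.Prime)
    (hg : Generators F k i s q ι σ ω) (huv : q * u ^ 2 = 2 * p * v ^ 2 + 1)
    (hP₁ : (p : 𝓞 k) ∈ P₁.asIdeal) (hh : Odd h) (hπ : P₁.asIdeal ^ h = Ideal.span {π}) :
    ∃ c, Represents (𝓞 K) c (algebraMap k K (algebraMap (𝓞 k) k π)) := by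
  have hπ0 : algebraMap (𝓞 k) k π ≠ 0 := by
    intro h0
    have := not_isSquare_valuation_of_pow_eq (L := k) hh hπ
    rw [h0] at this
    exact this ⟨0, by simp⟩
  have h2p : (2 * p : k) ≠ 0 := mul_ne_zero two_ne_zero (Nat.cast_ne_zero.mpr hp.ne_zero)
  refine exists_represents_of_isSquare (by simpa using hπ0) fun Q => ?_
  change EvenAt Q _
  by_cases hQ : Q.under (𝓞 k) = P₁
  · have h1 : EvenAt (Q.under (𝓞 k)) (algebraMap (𝓞 k) k π * (2 * p)) := by
      rw [hQ, evenAt_mul_iff hπ0 h2p]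
      have h3 := not_isSquare_valuation_of_pow_eq (L := k) hh hπ
      have h4 := T.not_evenAt_two_mul hp hg huv hP₁
      tauto
    have h5 := h1.algebraMap_of_under (K := K)
    rw [map_mul, evenAt_mul_iff (by simpa using hπ0) (by simpa using h2p)] at h5
    exact h5.mpr (T.represents_two_mul.isSquare_valuation Q)
  · exact (evenAt_of_pow_eq hπ hQ).algebraMap_of_under

theorem exists_evenAt_of_represents (T : Tower F k K i s w p q)
    (hc : ∀ P : HeightOneSpectrum (𝓞 k), (p : 𝓞 k) ∈ P.asIdeal →
      ∃ n : k, Represents (𝓞 K) c (algebraMap k K n) ∧ ∀ P' : HeightOneSpectrum (𝓞 k),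
        (p : 𝓞 k) ∈ P'.asIdeal → (EvenAt P' n ↔ P' ≠ P))
    {d : ClassGroup (𝓞 K)} {m : k} (hd : Represents (𝓞 K) d (algebraMap k K m)) :
    ∃ (e : ℕ) (m' : k), Represents (𝓞 K) (d * c ^ e) (algebraMap k K m') ∧
      ∀ P : HeightOneSpectrum (𝓞 k), (p : 𝓞 k) ∈ P.asIdeal → EvenAt P m' := by
  classical
  have hp0 : (p : 𝓞 k) ≠ 0 := by
    have := T.mod_p
    exact Nat.cast_ne_zero.mpr (by rintro rfl; omega)
  have hfin : {P : HeightOneSpectrum (𝓞 k) | (p : 𝓞 k) ∈ P.asIdeal}.Finite := by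
    refine (Ideal.finite_factors (I := Ideal.span {(p : 𝓞 k)}) (by simpa using hp0)).subset ?_
    intro P hP
    exact Ideal.dvd_span_singleton.mpr hP
  suffices H : ∀ S : Finset (HeightOneSpectrum (𝓞 k)), (∀ P ∈ S, (p : 𝓞 k) ∈ P.asIdeal) →
      ∃ (e : ℕ) (m' : k), Represents (𝓞 K) (d * c ^ e) (algebraMap k K m') ∧
        ∀ P ∈ S, EvenAt P m' by
    obtain ⟨e, m', h1, h2⟩ := H hfin.toFinset (fun P hP => by simpa using hP)
    exact ⟨e, m', h1, fun P hP => h2 P (by simpa using hP)⟩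
  intro S
  induction S using Finset.induction_on with
  | empty => exact fun _ => ⟨0, m, by simpa using hd, by simp⟩
  | insert P S hPS ih =>
    intro hS
    obtain ⟨e, m', h1, h2⟩ := ih fun P' hP' => hS P' (Finset.mem_insert_of_mem hP')
    have hP := hS P (Finset.mem_insert_self _ _)
    by_cases hm : EvenAt P m'
    · exact ⟨e, m', h1, by simpa [hm] using h2⟩
    · obtain ⟨n, hn, hne'⟩ := hc P hP
      refine ⟨e + 1, m' * n, ?_, ?_⟩
      · rw [pow_succ, ← mul_assoc]
        exact h1.map_mul hn
      · intro P' hP'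
        rw [evenAt_mul_iff h1.base_ne_zero hn.base_ne_zero, hne' P' (hS P' hP')]
        rcases Finset.mem_insert.mp hP' with rfl | hP'S
        · simpa using hm
        · have : P' ≠ P := by rintro rfl; exact hPS hP'S
          simp [this, h2 P' hP'S]

end Tower

end TwoClassGroup

namespace TwoClassGroup

open NumberField IsDedekindDomain

theorem Generators.evenAt_one_add {F k : Type*} [Field F] [Field k] [NumberField k]
    [Algebra F k] {i : F} {s : k} {q : ℕ} {ι σ ω : 𝓞 k}
    (hg : Generators F k i s q ι σ ω)
    {P : HeightOneSpectrum (𝓞 k)} (hP : (2 : 𝓞 k) ∉ P.asIdeal) :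
    EvenAt P (1 + algebraMap F k i) := by
  rw [← hg.coe_ι, ← map_one (algebraMap (𝓞 k) k), ← map_add]
  refine evenAt_of_notMem fun hmem => hP ?_
  have := Ideal.mul_mem_right (1 - ι) _ hmem
  rwa [show (1 + ι) * (1 - ι) = 2 by linear_combination -hg.ι_sq] at this

section

variable {F k : Type*} [Field F] [NumberField F] [Field k] [NumberField k] [Algebra F k]
  {i : F} {s : k} {q : ℕ}

theorem norm_rat_one_add_pow_mul (hF : IsQuad ℚ F (-1) i) (hk : IsQuad F k (q : F) s) {η : k}
    (hη : Algebra.norm F η = -i) (e j l : ℕ) (v : k) :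
    Algebra.norm ℚ ((1 + algebraMap F k i) ^ e * (algebraMap F k i ^ j * η ^ l * v ^ 2)) =
      (2 ^ e * Algebra.norm ℚ v) ^ 2 := by
  have hi : Algebra.norm ℚ (algebraMap F k i) = 1 := by
    rw [← Algebra.norm_norm (S := F), hk.norm_algebraMap, hF.sq_eq_neg_one]
    have := hF.norm_algebraMap (-1)
    simpa using this
  have h1i : Algebra.norm ℚ (1 + algebraMap F k i) = 2 ^ 2 := by
    rw [← Algebra.norm_norm (S := F), ← map_one (algebraMap F k), ← map_add,
      hk.norm_algebraMap, map_pow]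
    have := hF.norm_eq 1 1
    simp only [map_one, one_mul] at this
    rw [this]
    norm_num
  have hη' : Algebra.norm ℚ η = 1 := by
    rw [← Algebra.norm_norm (S := F), hη]
    have := hF.norm_eq 0 (-1)
    simp only [map_zero, map_neg, map_one, zero_add, neg_mul, one_mul] at this
    rw [this]
    norm_num
  simp only [map_mul, map_pow, hi, h1i, hη', one_pow, one_mul]
  rw [mul_pow, ← pow_mul, ← pow_mul, mul_comm 2 e]

end

variable {F k K : Type*} [Field F] [NumberField F] [Field k] [NumberField k] [Field K]
  [NumberField K] [Algebra F k] [Algebra k K] {i : F} {s : k} {w : K} {p q : ℕ}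
  [Fact q.Prime]

namespace Tower

theorem exists_represents_one_add_i (T : Tower F k K i s w p q) {a b : ℕ}
    (hab : a ^ 2 + 1 = 2 * p * b ^ 2) :
    ∃ c, Represents (𝓞 K) c (algebraMap k K (1 + algebraMap F k i)) := by
  have h := T.represents_add_i hab
  rw [map_add, map_natCast] at h
  rw [map_add, map_one]
  exact exists_represents_one_add T.algebraMap_i_sq T.mod_p hab h

/-- An element of `k` representing a class of `K`, with even valuations at the primes above `p`,
represents a power of the class of `1 + i`. -/
theorem exists_mul_pow_eq_one (T : Tower F k K i s w p q) (hp : p.Prime) {η : (𝓞 k)ˣ}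
    (hη : Algebra.norm F (algebraMap (𝓞 k) k η) = -i) {ι σ ω : 𝓞 k}
    (hg : Generators F k i s q ι σ ω) {c₀ c : ClassGroup (𝓞 K)}
    (hc₀ : Represents (𝓞 K) c₀ (algebraMap k K (1 + algebraMap F k i))) {m : k}
    (hc : Represents (𝓞 K) c (algebraMap k K m))
    (hm : ∀ P : HeightOneSpectrum (𝓞 k), (p : 𝓞 k) ∈ P.asIdeal → EvenAt P m) :
    ∃ f : ℕ, c * c₀ ^ f = 1 := by
  have hnot2 {P : HeightOneSpectrum (𝓞 k)} (hP : (p : 𝓞 k) ∈ P.asIdeal) :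
      (2 : 𝓞 k) ∉ P.asIdeal := by
    have h := intCast_mem_iff P.isPrime hp hP 2
    rw [Int.cast_ofNat] at h
    rw [h]
    intro h2
    exact T.p_ne_two ((Nat.prime_dvd_prime_iff_eq hp Nat.prime_two).mp (by exact_mod_cast h2))
  have key {d : ClassGroup (𝓞 K)} {x : k} (hd : Represents (𝓞 K) d (algebraMap k K x))
      (hx : ∀ P : HeightOneSpectrum (𝓞 k), (2 : 𝓞 k) ∈ P.asIdeal ∨ (p : 𝓞 k) ∈ P.asIdeal →
        EvenAt P x) : d = 1 := by
    obtain ⟨c', hc'⟩ := exists_represents_of_isSquare (R := 𝓞 k) hd.base_ne_zero fun P => by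
      by_cases hP : (2 : 𝓞 k) ∈ P.asIdeal ∨ (p : 𝓞 k) ∈ P.asIdeal
      · exact hx P hP
      · rw [not_or] at hP
        exact T.evenAt_of_represents hd hP.1 hP.2
    obtain ⟨j, l, f, hf, hN⟩ := represents_biquadratic T.quad_F T.quad_k T.mod_q hη hc'
    rw [hN] at hd
    exact hd.unique (represents_one_algebraMap_mul T.quad_F η j l hf)
  by_cases h2 : ∀ P : HeightOneSpectrum (𝓞 k), (2 : 𝓞 k) ∈ P.asIdeal → EvenAt P m
  · exact ⟨0, by rw [pow_zero, mul_one]; exact key hc fun P hP => hP.elim (h2 P) (hm P)⟩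
  · push Not at h2
    obtain ⟨P₂, hP₂, hm₂⟩ := h2
    refine ⟨1, ?_⟩
    rw [pow_one]
    refine key (hc.map_mul hc₀) ?_
    rintro P (hP | hP)
    · rw [hg.eq_of_two_mem T.quad_F T.quad_k hP hP₂,
        evenAt_mul_iff hc.base_ne_zero hc₀.base_ne_zero]
      have := hg.not_evenAt_one_add T.quad_F T.quad_k hP₂
      tauto
    · exact (hm P hP).mul (hg.evenAt_one_add (hnot2 hP))

theorem exists_generating_classes [Fact p.Prime] (T : Tower F k K i s w p q) :
    ∃ c₀ c₁ : ClassGroup (𝓞 K), c₀ ^ 2 = 1 ∧ c₁ ^ 2 = 1 ∧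
      (∀ c : ClassGroup (𝓞 K), c ^ 2 = 1 → ∃ e f : ℕ, c = c₀ ^ e * c₁ ^ f) ∧
      ∀ d : ClassGroup (𝓞 K), d ^ 2 ≠ c₀ ∧ d ^ 2 ≠ c₁ ∧ d ^ 2 ≠ c₀ * c₁ := by
  have hp : p.Prime := Fact.out
  obtain ⟨φ⟩ := T.nonempty_embeddings
  obtain ⟨a, b, hab⟩ := exists_sq_add_one_eq T.mod_p
  obtain ⟨u, v, huv⟩ := exists_mul_sq_sub_eq_one T.mod_p T.mod_q T.legendre
  obtain ⟨η, x, y, hxy, hη2, hη⟩ := exists_unit_norm_eq_neg_i T.quad_F T.quad_k T.mod_q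
  obtain ⟨ι, σ, ω, hg⟩ := exists_generators T.quad_F T.quad_k T.mod_q
  obtain ⟨P₁, hP₁⟩ := exists_natCast_mem (k := k) hp
  have hnorm := hg.absNorm_eq_of_natCast_mem T.quad_F T.quad_k hp T.p_ne_two
    (Fact.out : q.Prime).one_lt.ne' hab huv hP₁
  obtain ⟨h, π, hh, hπ⟩ := exists_pow_eq_span T.quad_F T.quad_k T.mod_q hη P₁
  obtain ⟨ε, hε, hπN⟩ := exists_norm_eq_pow hnorm hπ
  obtain ⟨c₁, hc₁⟩ := T.exists_represents_of_pow_eq hp hg huv hP₁ hh hπ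
  obtain ⟨c₀, hc₀⟩ := T.exists_represents_one_add_i hab
  have hodd (e j l : ℕ) {v : k} (hv : v ≠ 0) (y : K) : Algebra.norm k y ≠
      algebraMap (𝓞 k) k π * ((1 + algebraMap F k i) ^ e *
        (algebraMap F k i ^ j * algebraMap (𝓞 k) k η ^ l * v ^ 2)) := by
    refine φ.norm_ne_of_odd T.quad_F T.quad_k T.quad_K T.mod_p hε hh
      (r := 2 ^ e * Algebra.norm ℚ v)
      (mul_ne_zero (by positivity) (Algebra.norm_ne_zero_iff.mpr hv)) ?_ y
    rw [map_mul, hπN, norm_rat_one_add_pow_mul T.quad_F T.quad_k hη]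
  refine ⟨c₀, c₁, hc₀.sq_eq_one, hc₁.sq_eq_one, fun c hc => ?_, fun d => ⟨?_, ?_, ?_⟩⟩
  · obtain ⟨m, -, hm⟩ := T.exists_represents_algebraMap hη hc
    obtain ⟨e, m', hm', hev⟩ := T.exists_evenAt_of_represents
      (fun P hP => T.exists_evenAt_iff_ne hp hg hab huv hP₁ hh hπ hc₁ hP) hm
    obtain ⟨f, hf⟩ := T.exists_mul_pow_eq_one hp hη hg hc₀ hm' hev
    refine ⟨f, e, ?_⟩
    have h0 : c₀ ^ f * c₀ ^ f = 1 := by rw [← pow_add, ← two_mul, pow_mul, hc₀.sq_eq_one, one_pow]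
    have h1 : c₁ ^ e * c₁ ^ e = 1 := by rw [← pow_add, ← two_mul, pow_mul, hc₁.sq_eq_one, one_pow]
    calc c = c * (c₁ ^ e * c₁ ^ e) * (c₀ ^ f * c₀ ^ f) := by rw [h0, h1, mul_one, mul_one]
      _ = c * c₁ ^ e * c₀ ^ f * (c₀ ^ f * c₁ ^ e) := by ac_rfl
      _ = c₀ ^ f * c₁ ^ e := by rw [hf, one_mul]
  · rintro rfl
    obtain ⟨j, l, v, y, hv, hN⟩ :=
      T.exists_norm_eq_of_represents_sq hη hc₀.sq_eq_one hc₀.base_ne_zero hc₀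
    exact φ.norm_ne_one_add T.quad_k T.quad_K T.mod_p hxy hη2 j l hv y hN
  · rintro rfl
    obtain ⟨j, l, v, y, hv, hN⟩ :=
      T.exists_norm_eq_of_represents_sq hη hc₁.sq_eq_one hc₁.base_ne_zero hc₁
    exact hodd 0 j l hv y (by rw [hN, pow_zero, one_mul])
  · intro hd
    have hc := hc₁.map_mul hc₀
    rw [mul_comm c₁, ← hd] at hc
    obtain ⟨j, l, v, y, hv, hN⟩ :=
      T.exists_norm_eq_of_represents_sq hη hc.sq_eq_one hc.base_ne_zero hc
    exact hodd 1 j l hv y (by rw [hN, pow_one, mul_assoc])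

end Tower

end TwoClassGroup

namespace TwoClassGroup

theorem sq_eq_one_of_pow_two_pow {G : Type*} [CommGroup G]
    (hsq : ∀ d : G, d ^ 4 = 1 → d ^ 2 = 1) (n : ℕ) {x : G} (hx : x ^ 2 ^ n = 1) : x ^ 2 = 1 := by
  induction n generalizing x with
  | zero => simp_all
  | succ n ih =>
    apply hsq
    have := ih (x := x ^ 2) (by rw [← pow_mul, ← pow_succ', hx])
    rw [← this, ← pow_mul]

theorem pow_eq_one_or_self {G : Type*} [Monoid G] {c : G} (hc : c ^ 2 = 1) (n : ℕ) :
    c ^ n = 1 ∨ c ^ n = c := by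
  rcases Nat.even_or_odd' n with ⟨m, rfl | rfl⟩
  · exact Or.inl (by rw [pow_mul, hc, one_pow])
  · exact Or.inr (by rw [pow_succ, pow_mul, hc, one_pow, one_mul])

theorem nonempty_sylow_mulEquiv {G : Type*} [CommGroup G] [Finite G] {c₀ c₁ : G}
    (h₀ : c₀ ^ 2 = 1) (h₁ : c₁ ^ 2 = 1)
    (hgen : ∀ c : G, c ^ 2 = 1 → ∃ e f : ℕ, c = c₀ ^ e * c₁ ^ f)
    (hsq : ∀ d : G, d ^ 2 ≠ c₀ ∧ d ^ 2 ≠ c₁ ∧ d ^ 2 ≠ c₀ * c₁) (P : Sylow 2 G) :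
    Nonempty (P ≃* Multiplicative (ZMod 2 × ZMod 2)) := by
  have hmem (c : G) (hc : c ^ 2 = 1) : c = 1 ∨ c = c₀ ∨ c = c₁ ∨ c = c₀ * c₁ := by
    obtain ⟨e, f, rfl⟩ := hgen c hc
    rcases pow_eq_one_or_self h₀ e with he | he <;> rcases pow_eq_one_or_self h₁ f with hf | hf <;>
      simp [he, hf]
  have h4 (d : G) (hd : d ^ 4 = 1) : d ^ 2 = 1 := by
    have := hmem (d ^ 2) (by rw [← pow_mul, hd])
    have := hsq d
    tauto
  have hP (x : G) : x ∈ P ↔ x ^ 2 = 1 := by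
    constructor
    · intro hx
      obtain ⟨n, hn⟩ := P.isPGroup' ⟨x, hx⟩
      exact sq_eq_one_of_pow_two_pow h4 n (congrArg Subtype.val hn)
    · intro hx
      have hz : IsPGroup 2 (Subgroup.zpowers x) := by
        rintro ⟨y, hy⟩
        obtain ⟨m, rfl⟩ := Subgroup.mem_zpowers_iff.mp hy
        refine ⟨1, Subtype.ext ?_⟩
        change (x ^ m) ^ 2 ^ 1 = 1
        rw [pow_one, ← zpow_natCast, zpow_comm, zpow_natCast, hx, one_zpow]
      obtain ⟨Q, hQ⟩ := hz.exists_le_sylow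
      have : Unique (Sylow 2 G) := Sylow.unique_of_normal P inferInstance
      rw [Subsingleton.elim P Q]
      exact hQ (Subgroup.mem_zpowers x)
  have hset : ((P : Subgroup G) : Set G) = {1, c₀, c₁, c₀ * c₁} := by
    ext x
    change x ∈ P ↔ _
    rw [hP]
    refine ⟨hmem x, ?_⟩
    rintro (rfl | rfl | rfl | rfl)
    · exact one_pow 2
    · exact h₀
    · exact h₁
    · rw [mul_pow, h₀, h₁, one_mul]
  have hone := hsq 1
  rw [one_pow] at hone
  obtain ⟨n₀, n₁, n₂⟩ := hone
  have hcard : Nat.card P = 4 := by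
    have h01 : c₀ ≠ c₁ := by
      rintro rfl
      exact n₂ (by rw [← pow_two, h₀])
    change ((P : Subgroup G) : Set G).ncard = 4
    rw [hset, Set.ncard_insert_of_notMem (by simp [n₀, n₁, n₂]),
      Set.ncard_insert_of_notMem (by simp [h01, n₁.symm]),
      Set.ncard_pair (by simpa using n₀.symm)]
  have : IsKleinFour P := by
    refine ⟨hcard, ?_⟩
    have hdvd : Monoid.exponent P ∣ 2 := by
      rw [Monoid.exponent_dvd_iff_forall_pow_eq_one]
      rintro ⟨x, hx⟩
      exact Subtype.ext ((hP x).mp hx)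
    rcases (Nat.dvd_prime Nat.prime_two).mp hdvd with h | h
    · have := Monoid.exp_eq_one_iff.mp h
      have h1 : Nat.card P = 1 := Nat.card_of_subsingleton (1 : P)
      exact absurd (hcard.symm.trans h1) (by norm_num)
    · exact h
  exact IsKleinFour.nonempty_mulEquiv

end TwoClassGroup

namespace TwoClassGroup

open NumberField IsDedekindDomain

theorem isQuad_adjoin {M E : Type*} [Field M] [Field E] [Algebra M E] {d : M} {w : E}
    (hw : w ^ 2 = algebraMap M E d) (hd : ¬ IsSquare d) :
    IsQuad M (IntermediateField.adjoin M {w}) d (IntermediateField.AdjoinSimple.gen M w) := by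
  have hwi : IsIntegral M w := by
    refine IsIntegral.of_pow (n := 2) (by norm_num) ?_
    rw [hw]
    exact isIntegral_algebraMap
  refine ⟨?_, hd, ?_⟩
  · apply Subtype.ext
    exact hw
  · rintro ⟨x, hx⟩
    have hspan : ∀ y ∈ Algebra.adjoin M {w},
        ∃ r s : M, y = algebraMap M E r + algebraMap M E s * w := by
      intro y hy
      induction hy using Algebra.adjoin_induction with
      | mem x hx => exact ⟨0, 1, by simpa using hx⟩
      | algebraMap r => exact ⟨r, 0, by simp⟩
      | add x y _ _ hx hy =>
        obtain ⟨r, s, rfl⟩ := hx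
        obtain ⟨r', s', rfl⟩ := hy
        exact ⟨r + r', s + s', by simp only [map_add]; ring⟩
      | mul x y _ _ hx hy =>
        obtain ⟨r, s, rfl⟩ := hx
        obtain ⟨r', s', rfl⟩ := hy
        refine ⟨r * r' + d * s * s', r * s' + s * r', ?_⟩
        simp only [map_add, map_mul, ← hw]
        ring
    obtain ⟨r, s, h⟩ := hspan x (by
      rw [← IntermediateField.adjoin_simple_toSubalgebra_of_isAlgebraic hwi.isAlgebraic]
      exact hx)
    exact ⟨r, s, Subtype.ext h⟩

theorem IsQuad.isSquare_cases {M L : Type*} [Field M] [Field L] [Algebra M L] [NeZero (2 : M)]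
    {d : M} {w : L} (h : IsQuad M L d w) {x : M} (hx : IsSquare (algebraMap M L x)) :
    IsSquare x ∨ IsSquare (d * x) := by
  obtain ⟨y, hy⟩ := hx
  obtain ⟨r, s, rfl⟩ := h.exists_eq y
  have h1 : algebraMap M L x + algebraMap M L 0 * w =
      algebraMap M L (r ^ 2 + d * s ^ 2) + algebraMap M L (2 * r * s) * w := by
    simp only [map_add, map_mul, map_pow, map_zero, map_ofNat, hy]
    linear_combination (algebraMap M L s) ^ 2 * h.sq_eq
  obtain ⟨h2, h3⟩ := h.coord_ext h1
  rcases mul_eq_zero.mp h3.symm with h4 | rfl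
  · obtain rfl := (mul_eq_zero.mp h4).resolve_left (NeZero.ne 2)
    exact Or.inr ⟨d * s, by rw [h2]; ring⟩
  · exact Or.inl ⟨r, by rw [h2]; ring⟩

theorem not_isSquare_natCast_of_isQuad {F : Type*} [Field F] [CharZero F] {i : F}
    (hF : IsQuad ℚ F (-1) i) {n : ℕ} (hn : ¬ IsSquare n) : ¬ IsSquare (n : F) := by
  intro h
  have hn0 : 0 < n := Nat.pos_of_ne_zero (by rintro rfl; exact hn ⟨0, rfl⟩)
  rw [← map_natCast (algebraMap ℚ F)] at h
  rcases hF.isSquare_cases h with h | ⟨y, hy⟩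
  · exact hn (Rat.isSquare_natCast_iff.mp h)
  · have : (0 : ℚ) < n := by exact_mod_cast hn0
    nlinarith [mul_self_nonneg y]

theorem numberField_of_isQuad {M L : Type*} [Field M] [NumberField M] [Field L] [Algebra M L]
    {d : M} {w : L} (h : IsQuad M L d w) : NumberField L := by
  have hc : CharZero L := charZero_of_injective_algebraMap (algebraMap M L).injective
  have := h.finiteDimensional
  have : IsScalarTower ℚ M L := IsScalarTower.of_algebraMap_eq fun x => by simp
  have := FiniteDimensional.trans ℚ M L
  constructor

theorem sylow_of_tower {F k K : Type*} [Field F] [NumberField F] [Field k] [NumberField k]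
    [Field K] [NumberField K] [Algebra F k] [Algebra k K] {i : F} {s : k} {w : K} {p q : ℕ}
    [Fact p.Prime] [Fact q.Prime] (T : Tower F k K i s w p q) {L : Type*} [Field L]
    (e : K ≃+* L) (P : Sylow 2 (ClassGroup (𝓞 L))) :
    Nonempty (P ≃* Multiplicative (ZMod 2 × ZMod 2)) := by
  let E : ClassGroup (𝓞 K) ≃* ClassGroup (𝓞 L) :=
    ClassGroup.mulEquiv (RingOfIntegers.mapRingEquiv e)
  have : Finite (ClassGroup (𝓞 L)) := Finite.of_equiv _ E.toEquiv
  obtain ⟨c₀, c₁, h₀, h₁, hgen, hsq⟩ := T.exists_generating_classes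
  refine nonempty_sylow_mulEquiv (c₀ := E c₀) (c₁ := E c₁) ?_ ?_ ?_ ?_ P
  · rw [← map_pow, h₀, map_one]
  · rw [← map_pow, h₁, map_one]
  · intro c hc
    obtain ⟨a, b, hab⟩ := hgen (E.symm c) (by rw [← map_pow, hc, map_one])
    exact ⟨a, b, by rw [← map_pow, ← map_pow, ← map_mul, ← hab, E.apply_symm_apply]⟩
  · intro d
    obtain ⟨d, rfl⟩ := E.surjective d
    simpa only [← map_pow, ← map_mul, ne_eq, E.injective.eq_iff] using hsq d

/-- Intermediate fields with the same elements, over possibly different base fields, are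
isomorphic as rings. -/
def ringEquivOfMemIff {A B E : Type*} [Field A] [Field B] [Field E] [Algebra A E] [Algebra B E]
    (K : IntermediateField A E) (L : IntermediateField B E) (h : ∀ x, x ∈ K ↔ x ∈ L) :
    K ≃+* L where
  toFun x := ⟨x, (h x).1 x.2⟩
  invFun x := ⟨x, (h x).2 x.2⟩
  left_inv _ := rfl
  right_inv _ := rfl
  map_mul' _ _ := rfl
  map_add' _ _ := rfl

theorem mem_iff_mem_adjoin {E : Type*} [Field E] [CharZero E] {F : IntermediateField ℚ E}
    {k : IntermediateField F E} {K : IntermediateField k E} {dF : ℚ} {dk : F} {dK : k} {i : F}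
    {s : k} {w : K} (hF : IsQuad ℚ F dF i) (hk : IsQuad F k dk s) (hK : IsQuad k K dK w)
    (x : E) : x ∈ K ↔ x ∈ IntermediateField.adjoin ℚ {(w : E), (s : E), (i : E)} := by
  set L := IntermediateField.adjoin ℚ {(w : E), (s : E), (i : E)} with hL
  have hmem {x : E} (hx : x ∈ ({(w : E), (s : E), (i : E)} : Set E)) : x ∈ L :=
    IntermediateField.subset_adjoin ℚ _ hx
  have hFL : ∀ x : F, (x : E) ∈ L := fun x => by
    obtain ⟨a, b, rfl⟩ := hF.exists_eq x
    exact add_mem (algebraMap_mem _ a) (mul_mem (algebraMap_mem _ b) (hmem (by simp)))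
  have hkL : ∀ x : k, (x : E) ∈ L := fun x => by
    obtain ⟨a, b, rfl⟩ := hk.exists_eq x
    exact add_mem (hFL a) (mul_mem (hFL b) (hmem (by simp)))
  have hKL : ∀ x : K, (x : E) ∈ L := fun x => by
    obtain ⟨a, b, rfl⟩ := hK.exists_eq x
    exact add_mem (hkL a) (mul_mem (hkL b) (hmem (by simp)))
  refine ⟨fun hx => hKL ⟨x, hx⟩, fun hx => ?_⟩
  induction hx using IntermediateField.adjoin_induction with
  | mem x hx =>
    rcases hx with rfl | rfl | rfl
    · exact w.2
    · exact K.algebraMap_mem s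
    · exact K.algebraMap_mem (algebraMap F k i)
  | algebraMap r => simp
  | add x y _ _ hx hy => exact add_mem hx hy
  | inv x _ hx => exact inv_mem hx
  | mul x y _ _ hx hy => exact mul_mem hx hy

theorem sylow_of_isQuad {p q : ℕ} [Fact p.Prime] [Fact q.Prime] (hp : p % 8 = 5)
    (hq : q % 8 = 3) (hleg : legendreSym q (p : ℤ) = 1) {F : IntermediateField ℚ ℂ}
    {k : IntermediateField F ℂ} {K : IntermediateField k ℂ} {i : F} {s : k} {w : K}
    (hF : IsQuad ℚ F (-1) i) (hk : IsQuad F k (q : F) s) (hK : IsQuad k K (2 * (p : k)) w)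
    (P : Sylow 2 (ClassGroup (𝓞 (IntermediateField.adjoin ℚ {(w : ℂ), (s : ℂ), (i : ℂ)})))) :
    Nonempty (P ≃* Multiplicative (ZMod 2 × ZMod 2)) := by
  have : NumberField F := numberField_of_isQuad hF
  have : NumberField k := numberField_of_isQuad hk
  have : NumberField K := numberField_of_isQuad hK
  exact sylow_of_tower ⟨hF, hk, hK, hp, hq, hleg⟩
    (ringEquivOfMemIff K _ (mem_iff_mem_adjoin hF hk hK)) P

theorem not_isSquare_two_mul_prime {F k : Type*} [Field F] [CharZero F] [Field k] [Algebra F k]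
    {i : F} {s : k} {p q : ℕ} (hp : p % 8 = 5) (hq : q % 8 = 3) (hF : IsQuad ℚ F (-1) i)
    (hk : IsQuad F k (q : F) s) : ¬ IsSquare (2 * (p : k)) := by
  intro h
  have h1 : 2 * (p : k) = algebraMap F k ((2 * p : ℕ) : F) := by
    rw [map_natCast, Nat.cast_mul, Nat.cast_ofNat]
  rw [h1] at h
  rcases hk.isSquare_cases h with h | h
  · exact not_isSquare_natCast_of_isQuad hF (not_isSquare_of_mod_four (by omega)) h
  · rw [← Nat.cast_mul] at h
    refine not_isSquare_natCast_of_isQuad hF (not_isSquare_of_mod_four ?_) h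
    have h2 : (2 * p) % 4 = 2 := by omega
    have h3 : q % 4 = 3 := by omega
    rw [Nat.mul_mod, h2, h3]

theorem sylow_adjoin {p q : ℕ} [Fact p.Prime] [Fact q.Prime] (hp : p % 8 = 5) (hq : q % 8 = 3)
    (hleg : legendreSym q (p : ℤ) = 1) {i s w : ℂ} (hi : i ^ 2 = -1) (hs : s ^ 2 = q)
    (hw : w ^ 2 = 2 * p) (P : Sylow 2 (ClassGroup (𝓞 (IntermediateField.adjoin ℚ {w, s, i})))) :
    Nonempty (P ≃* Multiplicative (ZMod 2 × ZMod 2)) := by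
  have hF := isQuad_adjoin (M := ℚ) (d := -1) (w := i)
    (by rw [hi, map_neg, map_one]) (by
      rintro ⟨y, hy⟩
      nlinarith [mul_self_nonneg y])
  have hk := isQuad_adjoin (M := IntermediateField.adjoin ℚ {i}) (d := q) (w := s)
    (by rw [hs, map_natCast])
    (not_isSquare_natCast_of_isQuad hF (Fact.out : q.Prime).prime.not_isSquare)
  have hK := isQuad_adjoin (M := IntermediateField.adjoin (IntermediateField.adjoin ℚ {i}) {s})
    (d := 2 * p) (w := w) (by rw [hw, map_mul, map_ofNat, map_natCast])
    (not_isSquare_two_mul_prime hp hq hF hk)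
  exact sylow_of_isQuad hp hq hleg hF hk hK P

end TwoClassGroup

theorem twoClassGroup_Qsqrt2p_sqrtq_i_type_two_two
    (p q : ℕ) [Fact (Nat.Prime p)] [Fact (Nat.Prime q)]
    (hp : p % 8 = 5) (hq : q % 8 = 3) (hleg : legendreSym q (p : ℤ) = 1) :
    TwoClassGroupIsTypeTwoTwo (IntermediateField.adjoin ℚ
      {((Real.sqrt (2 * p) : ℝ) : ℂ), ((Real.sqrt q : ℝ) : ℂ), Complex.I}) := by
  intro P
  refine TwoClassGroup.sylow_adjoin hp hq hleg Complex.I_sq ?_ ?_ P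
  · rw [← Complex.ofReal_pow, Real.sq_sqrt (Nat.cast_nonneg q), Complex.ofReal_natCast]
  · rw [← Complex.ofReal_pow, Real.sq_sqrt (by positivity)]
    push_cast
    rfl
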